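/- Let (S,s) be the spectrum of a Noetherian strictly henselian local ring, f: X → S a semistable morphism that is smooth over a dense open U ⊆ S, and φ: T → S a non-degenerate trait through s. A vertex labelling m: V(Γ_s) → ℤ is T-Cartier if and only if there exists a Cartier divisor D on X_T := X ×_S T, supported in the closed fibre, whose associated vertex labelling (assigning to each vertex the multiplicity of D along the corresponding irreducible component of the closed fibre of X_T) equals m. -/

import Mathlib

/-!
Common infrastructure for formalizing "Néron models of jacobians over base schemes of
dimension greater than 1" (semistable morphisms, strata, dual graphs, alignment,
specialisation maps, Cartier/Weil divisors, Picard data, Néron models).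

Notes on design choices (Mathlib has no algebraic spaces, no Picard functor, no strict
henselisation and no excellent rings):
* Algebraic spaces are replaced by schemes throughout.
* The label of a point of a semistable morphism over a strictly henselian local base is
  taken in the local ring itself (which agrees with the strict henselisation there), and
  alignment over a general base is defined via base change to arbitrary strictly
  henselian Noetherian local test rings (which is equivalent to the definition via
  geometric points, since the strict henselisations are among such test rings).
* Excellence of the base is beyond current Mathlib and is omitted from hypotheses.
-/

open AlgebraicGeometry CategoryTheory CategoryTheory.Limits

universe u

noncomputable section

namespace NeronSemistable

/-! ### Local properties of morphisms of schemes -/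

/-- `f` is smooth at the point `x` if it is smooth on an open neighbourhood of `x`. -/
def SmoothAtPt {X S : Scheme.{u}} (f : X ⟶ S) (x : X) : Prop :=
  ∃ U : X.Opens, x ∈ U ∧ IsSmooth (U.ι ≫ f)

/-- `f` is étale at the point `x` if it is étale on an open neighbourhood of `x`. -/
def EtaleAtPt {X S : Scheme.{u}} (f : X ⟶ S) (x : X) : Prop :=
  ∃ U : X.Opens, x ∈ U ∧ IsEtale (U.ι ≫ f)

/-- `f` is flat at `x` if the induced map of stalks is flat. -/
def FlatAtPt {X S : Scheme.{u}} (f : X ⟶ S) (x : X) : Prop :=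
  letI := (f.stalkMap x).hom.toAlgebra
  Module.Flat (S.presheaf.stalk (f.base x)) (X.presheaf.stalk x)

/-- A morphism of schemes is flat if it is flat at every point. -/
def SchemeFlat {X S : Scheme.{u}} (f : X ⟶ S) : Prop := ∀ x : X, FlatAtPt f x

/-- The non-smooth locus of a morphism, as a set of points. -/
def NonSmoothLocus {X S : Scheme.{u}} (f : X ⟶ S) : Set X := {x | ¬ SmoothAtPt f x}

/-! ### Fibres -/

/-- The scheme-theoretic fibre `X_s` of `f : X ⟶ S` over `s ∈ S`. -/
def fiberScheme {X S : Scheme.{u}} (f : X ⟶ S) (s : S) : Scheme.{u} :=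
  pullback f (S.fromSpecResidueField s)

/-- The projection from the fibre `X_s` to `X`. -/
def fiberι {X S : Scheme.{u}} (f : X ⟶ S) (s : S) : fiberScheme f s ⟶ X :=
  pullback.fst f (S.fromSpecResidueField s)

/-- The structure morphism of the fibre `X_s` to the spectrum of the residue field. -/
def fiberRes {X S : Scheme.{u}} (f : X ⟶ S) (s : S) :
    fiberScheme f s ⟶ Spec (S.residueField s) :=
  pullback.snd f (S.fromSpecResidueField s)

/-- `f : X ⟶ S` has geometrically connected fibres. -/
def GeomConnFibers {X S : Scheme.{u}} (f : X ⟶ S) : Prop :=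
  ∀ (K : Type u) [Field K] [IsAlgClosed K] (g : Spec (CommRingCat.of K) ⟶ S),
    ConnectedSpace ↑(pullback f g)

/-- A subset `T` of a scheme `Z` over (the spectrum of) a field object `k` is geometrically
irreducible if its preimage in `Z ×_k K` is irreducible for every field extension `K` of `k`. -/
def GeomIrreducibleOver (k : CommRingCat.{u}) {Z : Scheme.{u}} (g : Z ⟶ Spec k)
    (T : Set Z) : Prop :=
  ∀ (K : Type u) [Field K] (ψ : k ⟶ CommRingCat.of K),
    IsIrreducible ((pullback.fst g (Spec.map ψ)).base ⁻¹' T)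

/-! ### Standard local models `Spec R[x₁,…,xₙ]/(x₁⋯x_l − b)` and semistable morphisms -/

open MvPolynomial in
/-- The ring `R[x₁,…,xₙ]/(x₁⋯x_l − b)`. -/
abbrev stdRing (R : Type u) [CommRing R] (n l : ℕ) (b : R) : Type u :=
  MvPolynomial (Fin n) R ⧸
    Ideal.span {(∏ i : Fin n, if (i : ℕ) < l then X i else 1) - C b}

/-- The standard local model as a scheme. -/
def stdScheme (R : Type u) [CommRing R] (n l : ℕ) (b : R) : Scheme.{u} :=
  Spec (CommRingCat.of (stdRing R n l b))

/-- The structure morphism of the standard local model. -/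
def stdSpec (R : CommRingCat.{u}) (n l : ℕ) (b : R) : stdScheme ↥R n l b ⟶ Spec R :=
  Spec.map (CommRingCat.ofHom (algebraMap ↥R (stdRing ↥R n l b)))

open MvPolynomial in
/-- The class of the coordinate `x_i` in the standard model. -/
def stdCoord (R : Type u) [CommRing R] (n l : ℕ) (b : R) (i : Fin n) : stdRing R n l b :=
  Ideal.Quotient.mk _ (X i)

/-- The data of a commutative diagram exhibiting `f` étale-locally at `x` as a standard
semistable model `Spec R[x₁,…,xₙ]/(x₁⋯x_l − b)`, as in the definition of a semistable
morphism. -/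
structure ChartData {X S : Scheme.{u}} (f : X ⟶ S) (x : X) where
  R : CommRingCat.{u}
  n : ℕ
  l : ℕ
  hln : l ≤ n
  b : ↥R
  etS : Spec R ⟶ S
  etS_etale : IsEtale etS
  s' : ↑(Spec R)
  hs' : etS.base s' = f.base x
  U : Scheme.{u}
  U_conn : ConnectedSpace ↑U
  gX : U ⟶ X
  gX_etale : IsEtale gX
  x' : ↑U
  hx' : gX.base x' = x
  gT : U ⟶ stdScheme ↥R n l b
  gT_etale : IsEtale gT
  comm : gT ≫ stdSpec R n l b ≫ etS = gX ≫ f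

/-- A morphism is semistable if it is proper with geometrically connected fibres and admits
standard semistable charts étale-locally at every point. -/
def IsSemistable {X S : Scheme.{u}} (f : X ⟶ S) : Prop :=
  IsProper f ∧ GeomConnFibers f ∧ ∀ x : X, Nonempty (ChartData f x)

/-! ### Local rings: regularity, strict henselianity -/

/-- The closed point of `Spec R` for a local ring `R` (with the local-ring witness passed
explicitly). -/
def closedPt (R : CommRingCat.{u}) (h : IsLocalRing ↥R) : ↑(Spec R) :=
  (@IsLocalRing.closedPoint ↥R _ h : PrimeSpectrum ↥R)

/-- A commutative ring is strictly henselian local if it is a henselian local ring with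
separably closed residue field. -/
structure StrictlyHenselianLocal (A : Type u) [CommRing A] : Prop where
  toIsLocalRing : IsLocalRing A
  henselian : HenselianLocalRing A
  sepClosedResidue : @IsSepClosed (@IsLocalRing.ResidueField A _ toIsLocalRing)
      (@IsLocalRing.ResidueField.field A _ toIsLocalRing)

/-- A Noetherian local ring is regular if its maximal ideal is generated by
`dim R` many elements. -/
def IsRegularLocal (A : Type u) [CommRing A] : Prop :=
  IsNoetherianRing A ∧ ∃ (h : IsLocalRing A) (s : Finset A),
    Ideal.span (s : Set A) = @IsLocalRing.maximalIdeal A _ h ∧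
    (s.card : WithBot (WithTop ℕ)) = ringKrullDim A

/-- A scheme is regular if all its local rings are regular (and it is locally Noetherian). -/
def IsRegularScheme (X : Scheme.{u}) : Prop :=
  IsLocallyNoetherian X ∧ ∀ x : X, IsRegularLocal ↥(X.presheaf.stalk x)

/-! ### Labels of points of semistable morphisms over a local base -/

/-- Over an affine base `Spec R`, the point `x` (of the non-smooth locus of its fibre) has
label `(b)`, `b ∈ R`, if there is a local chart
`U ⟶ Spec R[x₁,…,xₙ]/(x₁⋯x_l − b)` at `x` (with the coordinates `x₁,…,x_l` contained in
the prime ideal of the image of `x`).  Over a strictly henselian local ring this agrees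
with the usual label in the strict henselisation. -/
def HasLabel {R : CommRingCat.{u}} {X : Scheme.{u}} (f : X ⟶ Spec R) (x : X) (b : ↥R) :
    Prop :=
  ∃ (n l : ℕ), l ≤ n ∧
    ∃ (U : Scheme.{u}) (gX : U ⟶ X) (x' : ↑U) (gT : U ⟶ stdScheme ↥R n l b),
      IsEtale gX ∧ IsEtale gT ∧ gX.base x' = x ∧
      gT ≫ stdSpec R n l b = gX ≫ f ∧
      ∀ i : Fin n, (i : ℕ) < l → stdCoord ↥R n l b i ∈ (gT.base x').asIdeal

/-! ### Reduced closed subschemes and strata of fibres -/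

/-- A realisation of the closed subset `C ⊆ X` as a reduced closed subscheme of `X`
(such a realisation always exists and is unique up to unique isomorphism). -/
structure ReducedClosedSubscheme (X : Scheme.{u}) (C : Set X) where
  Z : Scheme.{u}
  ι : Z ⟶ X
  isClosedImmersion : IsClosedImmersion ι
  reduced : IsReduced Z
  range : Set.range ι.base = C

/-- `Sing` is the sequence of iterated non-smooth loci of a scheme `Z` over a field object
`k`: `Sing 0 = Z`, and `Sing (r+1)` is the non-smooth locus over `k` of `Sing r` endowed
with its reduced induced closed subscheme structure. -/
def IsSingSeq {k : CommRingCat.{u}} {Z : Scheme.{u}} (g : Z ⟶ Spec k)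
    (Sing : ℕ → Set Z) : Prop :=
  Sing 0 = Set.univ ∧
  ∀ r : ℕ, ∃ W : ReducedClosedSubscheme Z (Sing r),
    Sing (r + 1) = W.ι.base '' {z | ¬ SmoothAtPt (W.ι ≫ g) z}

/-- `T` is an `r`-stratum of the scheme `Z` over the field object `k`: an irreducible
component of the smooth locus of the `r`-th iterated non-smooth locus of `Z` over `k`. -/
def IsStratum {k : CommRingCat.{u}} {Z : Scheme.{u}} (g : Z ⟶ Spec k) (r : ℕ)
    (T : Set Z) : Prop :=
  ∃ Sing : ℕ → Set Z, IsSingSeq g Sing ∧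
    ∃ W : ReducedClosedSubscheme Z (Sing r),
      ∃ T' ∈ irreducibleComponents {z : W.Z // SmoothAtPt (W.ι ≫ g) z},
        T = W.ι.base '' (Subtype.val '' T')

/-! ### Dual graphs, cycles and alignment over a local base -/

/-- The (1-)stratum `T` of the closed fibre of `f` has label `b` (i.e. some — equivalently,
by constancy of labels, any — point of it has label `b`). -/
def StratumHasLabel {R : CommRingCat.{u}} {X : Scheme.{u}} (f : X ⟶ Spec R)
    (s : ↑(Spec R)) (T : Set (fiberScheme f s)) (b : ↥R) : Prop :=
  ∃ z ∈ T, HasLabel f ((fiberι f s).base z) b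

/-- A cycle in the dual graph of the fibre of `f : X ⟶ Spec R` over the point `s`:
a cyclic sequence of pairwise distinct vertices (irreducible components of the fibre)
joined by pairwise distinct edges (1-strata, each contained in exactly the two
neighbouring components). -/
structure GraphCycle {R : CommRingCat.{u}} {X : Scheme.{u}} (f : X ⟶ Spec R)
    (s : ↑(Spec R)) where
  N : ℕ
  hN : 0 < N
  v : Fin N → Set (fiberScheme f s)
  hv : ∀ i, v i ∈ irreducibleComponents ↑(fiberScheme f s)
  v_inj : Function.Injective v
  T : Fin N → Set (fiberScheme f s)
  hT : ∀ i, IsStratum (fiberRes f s) 1 (T i)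
  T_inj : Function.Injective T
  incident : ∀ i : Fin N,
    {c ∈ irreducibleComponents ↑(fiberScheme f s) | T i ⊆ c} =
      {v i, v (⟨((i : ℕ) + 1) % N, Nat.mod_lt _ hN⟩ : Fin N)}

/-- `f : X ⟶ Spec R` (for `R` local) is aligned at the closed point: for any cycle in the
dual graph of the closed fibre, the labels of any two of its edges admit equal positive
powers (as ideals of `R`). -/
def AlignedOver {R : CommRingCat.{u}} (hR : IsLocalRing ↥R) {X : Scheme.{u}}
    (f : X ⟶ Spec R) : Prop :=
  ∀ (c : GraphCycle f (closedPt R hR)) (i j : Fin c.N) (bi bj : ↥R),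
    StratumHasLabel f (closedPt R hR) (c.T i) bi →
    StratumHasLabel f (closedPt R hR) (c.T j) bj →
    ∃ n m : ℕ, 0 < n ∧ 0 < m ∧ Ideal.span {bi} ^ n = Ideal.span {bj} ^ m

/-- `f : X ⟶ S` is aligned (at every geometric point): the base change of `f` to any
Noetherian strictly henselian local test ring over `S` is aligned at the closed point.
(Taking the test ring to be a strict henselisation of a local ring of `S` recovers the
notion of alignment at a geometric point of `S`.) -/
def IsAligned {X S : Scheme.{u}} (f : X ⟶ S) : Prop :=
  ∀ (A : CommRingCat.{u}), IsNoetherianRing ↥A →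
    ∀ (h : StrictlyHenselianLocal ↥A) (g : Spec A ⟶ S),
      AlignedOver h.toIsLocalRing (pullback.snd f g)

/-! ### The specialisation relation on irreducible components of fibres -/

/-- The irreducible component `Z` of the fibre `X_s` specialises (under `sp_{s→η}`) to the
irreducible component `Y` of `X_η`, i.e. `Z` is contained in the fibre over `s` of the
closure of `Y` in `X`. -/
def spRel {X S : Scheme.{u}} (f : X ⟶ S) (s η : S)
    (Z : Set (fiberScheme f s)) (Y : Set (fiberScheme f η)) : Prop :=
  (fiberι f s).base '' Z ⊆ closure ((fiberι f η).base '' Y)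

/-- `C` is a connected component of the subset `A` of a topological space. -/
def IsConnCompOf {α : Type u} [TopologicalSpace α] (A C : Set α) : Prop :=
  ∃ x : ↥A, C = Subtype.val '' connectedComponent x
/-! ### Orders of vanishing, Weil divisors and Cartier divisors -/

/-- `a` has order (length of `A/(a)` as an `A`-module, computed as the Krull dimension of
the lattice of submodules) equal to `m`. -/
def elemOrd (A : Type u) [CommRing A] (a : A) (m : ℕ) : Prop :=
  Order.krullDim (Submodule A (A ⧸ Ideal.span {a})) = (m : ℕ∞)

/-- The order of vanishing of `a ∈ R` at the point `p` of `Spec R` is `k`. -/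
def IsLocOrd {R : Type u} [CommRing R] (a : R) (p : PrimeSpectrum R) (k : ℕ) : Prop :=
  elemOrd (Localization (@Ideal.primeCompl R _ p.asIdeal p.2))
    (algebraMap R (Localization (@Ideal.primeCompl R _ p.asIdeal p.2)) a) k

/-- `z` is a divisorial point of `X`: its local ring has Krull dimension 1, i.e. the
closure of `z` is a prime divisor on `X`. -/
def IsDivisorialPt (X : Scheme.{u}) (z : X) : Prop :=
  ringKrullDim ↥(X.presheaf.stalk z) = 1

/-- The order of vanishing at `z ∈ V` of the section `h ∈ Γ(X, V)` is `m`. -/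
def germOrd {X : Scheme.{u}} (V : X.Opens) (h : Γ(X, V)) (z : X) (hz : z ∈ V)
    (m : ℕ) : Prop :=
  elemOrd ↥(X.presheaf.stalk z) (X.presheaf.germ V z hz h) m

/-- A Weil divisor on `X` is recorded as a coefficient function on points of `X`; only its
values at divisorial points are relevant. `CutsOn D V h₁ h₂` says that on the open set `V`
the divisor `D` is cut out by the pair of nonzerodivisors `(h₁, h₂)` (i.e. `D` equals
`div h₁ − div h₂` on `V`). -/
def CutsOn {X : Scheme.{u}} (D : X → ℤ) (V : X.Opens) (h₁ h₂ : Γ(X, V)) : Prop :=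
  h₁ ∈ nonZeroDivisors Γ(X, V) ∧ h₂ ∈ nonZeroDivisors Γ(X, V) ∧
  ∀ z (hz : z ∈ V), IsDivisorialPt X z →
    ∀ m₁ m₂ : ℕ, germOrd V h₁ z hz m₁ → germOrd V h₂ z hz m₂ →
      D z = (m₁ : ℤ) - (m₂ : ℤ)

/-- The Weil divisor `D` is a Cartier divisor: it is cut out locally by ratios of
nonzerodivisor sections. -/
def IsCartierDiv {X : Scheme.{u}} (D : X → ℤ) : Prop :=
  ∀ x : X, ∃ V : X.Opens, x ∈ V ∧ ∃ h₁ h₂ : Γ(X, V), CutsOn D V h₁ h₂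

/-- `D'` is the pullback along `p : W ⟶ X` of the Cartier divisor `D` on `X`: at every
divisorial point of `W`, the coefficient of `D'` is computed by pulling back local
equations of `D`. -/
def IsDivPullback {W X : Scheme.{u}} (p : W ⟶ X) (D : X → ℤ) (D' : W → ℤ) : Prop :=
  ∀ w : W, IsDivisorialPt W w →
    ∀ (V : X.Opens) (hw : p.base w ∈ V) (h₁ h₂ : Γ(X, V)), CutsOn D V h₁ h₂ →
      ∀ m₁ m₂ : ℕ, germOrd (p ⁻¹ᵁ V) (p.app V h₁) w hw m₁ →
        germOrd (p ⁻¹ᵁ V) (p.app V h₂) w hw m₂ →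
          D' w = (m₁ : ℤ) - (m₂ : ℤ)

/-- Two Weil divisors on `X` are linearly equivalent if their difference is the divisor of
a global ratio of nonzerodivisor sections. -/
def LinEquivDiv {X : Scheme.{u}} (D D' : X → ℤ) : Prop :=
  ∃ h₁ h₂ : Γ(X, ⊤), h₁ ∈ nonZeroDivisors Γ(X, ⊤) ∧ h₂ ∈ nonZeroDivisors Γ(X, ⊤) ∧
    ∀ z : X, IsDivisorialPt X z →
      ∀ m₁ m₂ : ℕ, germOrd ⊤ h₁ z trivial m₁ → germOrd ⊤ h₂ z trivial m₂ →
        D z - D' z = (m₁ : ℤ) - (m₂ : ℤ)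

/-! ### Group schemes over a base (group objects via generalized points) -/

/-- A group scheme over `S`: a scheme `G/S` together with multiplication, unit and
inverse morphisms satisfying the group axioms (expressed on generalized points). -/
structure GroupSchemeOver (S : Scheme.{u}) where
  G : Scheme.{u}
  π : G ⟶ S
  e : S ⟶ G
  e_sec : e ≫ π = 𝟙 S
  mul : pullback π π ⟶ G
  mul_over : mul ≫ π = pullback.fst π π ≫ π
  inv : G ⟶ G
  inv_over : inv ≫ π = π
  mul_assoc' : ∀ {T : Scheme.{u}} (a b c : T ⟶ G) (hab : a ≫ π = b ≫ π)
    (hbc : b ≫ π = c ≫ π)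
    (h₁ : (pullback.lift a b hab ≫ mul) ≫ π = c ≫ π)
    (h₂ : a ≫ π = (pullback.lift b c hbc ≫ mul) ≫ π),
    pullback.lift (pullback.lift a b hab ≫ mul) c h₁ ≫ mul =
      pullback.lift a (pullback.lift b c hbc ≫ mul) h₂ ≫ mul
  one_mul' : ∀ {T : Scheme.{u}} (a : T ⟶ G) (h : (a ≫ π ≫ e) ≫ π = a ≫ π),
    pullback.lift (a ≫ π ≫ e) a h ≫ mul = a
  mul_one' : ∀ {T : Scheme.{u}} (a : T ⟶ G) (h : a ≫ π = (a ≫ π ≫ e) ≫ π),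
    pullback.lift a (a ≫ π ≫ e) h ≫ mul = a
  inv_mul' : ∀ {T : Scheme.{u}} (a : T ⟶ G) (h : (a ≫ inv) ≫ π = a ≫ π),
    pullback.lift (a ≫ inv) a h ≫ mul = a ≫ π ≫ e
/-! ### Line bundles via Čech gluing data, and the relative Picard scheme -/

/-- A line bundle on a scheme `Y`, presented by Čech gluing data: an open cover together
with unit transition functions satisfying the cocycle condition. -/
structure GluingData (Y : Scheme.{u}) where
  I : Type u
  U : I → Y.Opens
  covers : iSup U = ⊤
  t : ∀ i j : I, Γ(Y, U i ⊓ U j)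
  t_isUnit : ∀ i j, IsUnit (t i j)
  cocycle : ∀ i j k : I,
    (Y.presheaf.map (homOfLE (inf_le_left : (U i ⊓ U j) ⊓ U k ≤ U i ⊓ U j)).op) (t i j) *
    (Y.presheaf.map (homOfLE (le_inf (inf_le_left.trans inf_le_right)
      (inf_le_right : (U i ⊓ U j) ⊓ U k ≤ U k))).op) (t j k) =
    (Y.presheaf.map (homOfLE (le_inf (inf_le_left.trans inf_le_left)
      (inf_le_right : (U i ⊓ U j) ⊓ U k ≤ U k))).op) (t i k)

/-- The trivial line bundle. -/
def trivialGluing (Y : Scheme.{u}) : GluingData Y where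
  I := PUnit
  U := fun _ => ⊤
  covers := by simp
  t := fun _ _ => 1
  t_isUnit := fun _ _ => isUnit_one
  cocycle := by intro i j k; simp

/-- `D'` is the pullback of the gluing data `D` along `φ : Z ⟶ Y`. -/
def IsPullbackGluing {Z Y : Scheme.{u}} (φ : Z ⟶ Y) (D : GluingData Y)
    (D' : GluingData Z) : Prop :=
  ∃ eqv : D.I ≃ D'.I,
    (∀ i, D'.U (eqv i) = φ ⁻¹ᵁ D.U i) ∧
    ∀ (i j : D.I) (hle : D'.U (eqv i) ⊓ D'.U (eqv j) ≤ φ ⁻¹ᵁ (D.U i ⊓ D.U j)),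
      D'.t (eqv i) (eqv j) =
        (Z.presheaf.map (homOfLE hle).op) ((φ.app (D.U i ⊓ D.U j)) (D.t i j))

/-- Two gluing data on `Y` present isomorphic line bundles: on a common refinement their
transition functions differ by a coboundary. -/
def GluingIso {Y : Scheme.{u}} (D₁ D₂ : GluingData Y) : Prop :=
  ∃ (K : Type u) (W : K → Y.Opens) (_ : iSup W = ⊤)
    (r₁ : K → D₁.I) (r₂ : K → D₂.I)
    (_ : ∀ k, W k ≤ D₁.U (r₁ k)) (_ : ∀ k, W k ≤ D₂.U (r₂ k))
    (s : ∀ k, Γ(Y, W k)),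
    (∀ k, IsUnit (s k)) ∧
    ∀ (k k' : K) (hle₁ : W k ⊓ W k' ≤ D₁.U (r₁ k) ⊓ D₁.U (r₁ k'))
      (hle₂ : W k ⊓ W k' ≤ D₂.U (r₂ k) ⊓ D₂.U (r₂ k')),
      (Y.presheaf.map (homOfLE hle₁).op) (D₁.t (r₁ k) (r₁ k')) *
        (Y.presheaf.map (homOfLE (inf_le_right : W k ⊓ W k' ≤ W k')).op) (s k') =
      (Y.presheaf.map (homOfLE (inf_le_left : W k ⊓ W k' ≤ W k)).op) (s k) *
        (Y.presheaf.map (homOfLE hle₂).op) (D₂.t (r₂ k) (r₂ k'))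

/-- `D₃` is (isomorphic to) the tensor product of the line bundles presented by `D₁` and
`D₂`: on a common refinement, its transition functions are the products of those of `D₁`
and `D₂`, up to a coboundary. -/
def TensorIso {Y : Scheme.{u}} (D₁ D₂ D₃ : GluingData Y) : Prop :=
  ∃ (K : Type u) (W : K → Y.Opens) (_ : iSup W = ⊤)
    (r₁ : K → D₁.I) (r₂ : K → D₂.I) (r₃ : K → D₃.I)
    (_ : ∀ k, W k ≤ D₁.U (r₁ k)) (_ : ∀ k, W k ≤ D₂.U (r₂ k))
    (_ : ∀ k, W k ≤ D₃.U (r₃ k)) (s : ∀ k, Γ(Y, W k)),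
    (∀ k, IsUnit (s k)) ∧
    ∀ (k k' : K) (hle₁ : W k ⊓ W k' ≤ D₁.U (r₁ k) ⊓ D₁.U (r₁ k'))
      (hle₂ : W k ⊓ W k' ≤ D₂.U (r₂ k) ⊓ D₂.U (r₂ k'))
      (hle₃ : W k ⊓ W k' ≤ D₃.U (r₃ k) ⊓ D₃.U (r₃ k')),
      (Y.presheaf.map (homOfLE hle₃).op) (D₃.t (r₃ k) (r₃ k')) *
        (Y.presheaf.map (homOfLE (inf_le_right : W k ⊓ W k' ≤ W k')).op) (s k') =
      (Y.presheaf.map (homOfLE (inf_le_left : W k ⊓ W k' ≤ W k)).op) (s k) *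
        ((Y.presheaf.map (homOfLE hle₁).op) (D₁.t (r₁ k) (r₁ k')) *
          (Y.presheaf.map (homOfLE hle₂).op) (D₂.t (r₂ k) (r₂ k')))

/-- An fppf cover: faithfully flat and locally of finite presentation. -/
def IsFppfCover {T' T : Scheme.{u}} (c : T' ⟶ T) : Prop :=
  SchemeFlat c ∧ LocallyOfFinitePresentation c ∧ Function.Surjective c.base

/-- For `g : T ⟶ S` and `c : T' ⟶ T`, the induced morphism `X ×_S T' ⟶ X ×_S T`. -/
def inducedMap {X S T T' : Scheme.{u}} (f : X ⟶ S) (g : T ⟶ S) (c : T' ⟶ T) :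
    pullback f (c ≫ g) ⟶ pullback f g :=
  pullback.map f (c ≫ g) f g (𝟙 X) c (𝟙 S) (by simp) (by simp)

/-- Data exhibiting a group scheme `P/S` as (a scheme representing) the relative Picard
functor `Pic_{X/S}`, i.e. the fppf sheafification of `T ↦ Pic(X ×_S T)`:
a natural assignment `toPic` from line bundles on `X ×_S T` to `T`-points of `P`, which is
compatible with pullback, isomorphism and tensor products, sends the trivial bundle to the
unit section, and is fppf-locally bijective. -/
structure PicardData {X S : Scheme.{u}} (f : X ⟶ S) extends GroupSchemeOver S where
  lfp : LocallyOfFinitePresentation π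
  toPic : ∀ {T : Scheme.{u}} (g : T ⟶ S), GluingData (pullback f g) → (T ⟶ G)
  toPic_over : ∀ {T : Scheme.{u}} (g : T ⟶ S) (D : GluingData (pullback f g)),
    toPic g D ≫ π = g
  toPic_trivial : ∀ {T : Scheme.{u}} (g : T ⟶ S),
    toPic g (trivialGluing _) = g ≫ e
  toPic_pullback : ∀ {T T' : Scheme.{u}} (g : T ⟶ S) (c : T' ⟶ T)
    (D : GluingData (pullback f g)) (D' : GluingData (pullback f (c ≫ g))),
    IsPullbackGluing (inducedMap f g c) D D' → toPic (c ≫ g) D' = c ≫ toPic g D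
  toPic_iso : ∀ {T : Scheme.{u}} (g : T ⟶ S) (D₁ D₂ : GluingData (pullback f g)),
    GluingIso D₁ D₂ → toPic g D₁ = toPic g D₂
  toPic_mul : ∀ {T : Scheme.{u}} (g : T ⟶ S) (D₁ D₂ D₃ : GluingData (pullback f g))
    (_ : TensorIso D₁ D₂ D₃)
    (h : toPic g D₁ ≫ π = toPic g D₂ ≫ π),
    pullback.lift (toPic g D₁) (toPic g D₂) h ≫ mul = toPic g D₃
  locally_surjective : ∀ {T : Scheme.{u}} (g : T ⟶ S) (h : T ⟶ G), h ≫ π = g →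
    ∃ (T' : Scheme.{u}) (c : T' ⟶ T), IsFppfCover c ∧
      ∃ D' : GluingData (pullback f (c ≫ g)), toPic (c ≫ g) D' = c ≫ h
  locally_injective : ∀ {T : Scheme.{u}} (g : T ⟶ S)
    (D₁ D₂ : GluingData (pullback f g)), toPic g D₁ = toPic g D₂ →
    ∃ (T' : Scheme.{u}) (c : T' ⟶ T), IsFppfCover c ∧
      ∃ (D₁' D₂' : GluingData (pullback f (c ≫ g))) (E : GluingData T')
        (E' E₂ : GluingData (pullback f (c ≫ g))),
        IsPullbackGluing (inducedMap f g c) D₁ D₁' ∧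
        IsPullbackGluing (inducedMap f g c) D₂ D₂' ∧
        IsPullbackGluing (pullback.snd f (c ≫ g)) E E' ∧
        TensorIso D₁' E' E₂ ∧ GluingIso E₂ D₂'

/-! ### `Pic⁰`, scheme-theoretic closures and Néron models -/

/-- The fibrewise identity component of a group scheme `P/S` over the open set `U ⊆ S`:
the set of points lying over `U` and belonging to the connected component of the unit
section inside their fibre. -/
def pic0Set {S : Scheme.{u}} (P : GroupSchemeOver S) (U : S.Opens) : Set P.G :=
  {p | P.π.base p ∈ U ∧
    p ∈ connectedComponentIn (P.π.base ⁻¹' {P.π.base p}) (P.e.base (P.π.base p))}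

/-- `(Z, ι)` is the scheme-theoretic closure (scheme-theoretic image) of `g : A ⟶ P`:
the smallest closed subscheme of `P` through which `g` factors. -/
structure IsSchClosure {A P : Scheme.{u}} (g : A ⟶ P) (Z : Scheme.{u}) (ι : Z ⟶ P) :
    Prop where
  isClosedImmersion : IsClosedImmersion ι
  factors : ∃ g' : A ⟶ Z, g' ≫ ι = g
  smallest : ∀ (W : Scheme.{u}) (κ : W ⟶ P), IsClosedImmersion κ →
    (∃ w : A ⟶ W, w ≫ κ = g) → ∃ ρ : Z ⟶ W, ρ ≫ κ = ι

/-- A Néron model over `S` of a smooth "abelian" scheme `A` over the dense open `U ⊆ S`: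
a smooth separated scheme `N/S` with an isomorphism `N ×_S U ≅ A` over `U`, satisfying
the Néron mapping property.  (The paper allows `N` to be an algebraic space; algebraic
spaces are not available in Mathlib, so schemes are used.) -/
structure NeronModelData {S : Scheme.{u}} (U : S.Opens) {A : Scheme.{u}}
    (aU : A ⟶ U.toScheme) where
  N : Scheme.{u}
  ν : N ⟶ S
  smooth : IsSmooth ν
  separated : IsSeparated ν
  isoU : (ν ⁻¹ᵁ U).toScheme ≅ A
  isoU_over : isoU.hom ≫ aU = ν ∣_ U
  mapping : ∀ (T : Scheme.{u}) (t : T ⟶ S), IsSmooth t →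
    ∀ (φU : (t ⁻¹ᵁ U).toScheme ⟶ A), φU ≫ aU = t ∣_ U →
      ∃! φ : T ⟶ N, φ ≫ ν = t ∧
        (t ⁻¹ᵁ U).ι ≫ φ = φU ≫ isoU.inv ≫ (ν ⁻¹ᵁ U).ι

/-! ### Projective morphisms -/

attribute [local instance] MvPolynomial.gradedAlgebra

/-- Projective `n`-space (over `Spec (ULift ℤ)`). -/
def projSpace (n : ℕ) : Scheme.{u} :=
  Proj (MvPolynomial.homogeneousSubmodule (Fin (n + 1)) (ULift.{u} ℤ))

/-- Relative projective `n`-space over `S`. -/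
def projSpaceOver (S : Scheme.{u}) (n : ℕ) : Scheme.{u} :=
  pullback (terminal.from (projSpace.{u} n)) (terminal.from S)

/-- A morphism is projective if it factors as a closed immersion into some relative
projective space over the base. -/
def IsProjectiveMorphism {X S : Scheme.{u}} (f : X ⟶ S) : Prop :=
  ∃ (n : ℕ) (ι : X ⟶ projSpaceOver S n),
    IsClosedImmersion ι ∧ ι ≫ pullback.snd _ _ = f
end NeronSemistable
end

noncomputable section
namespace NeronSemistable

open TensorProduct in
lemma artin_field {F : Type*} [CommRing F] [IsArtinianRing F] [IsReduced F] [Nontrivial F]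
    (h : ∀ e : F, e * e = e → e = 0 ∨ e = 1) : IsField F := by
  refine ⟨⟨0, 1, zero_ne_one⟩, mul_comm, ?_⟩
  intro r hr
  obtain ⟨n, y, hy⟩ := IsArtinian.exists_pow_succ_smul_dvd r (1 : F)
  have h1 : r * (r * y - 1) = 0 := by
    apply IsReduced.eq_zero
    refine ⟨n + 1, ?_⟩
    have h2 : r ^ n * (r * y - 1) = 0 := by
      have : r ^ (n + 1) * y = r ^ n * 1 := by simpa using hy
      linear_combination this
    calc (r * (r * y - 1)) ^ (n + 1) = (r ^ n * (r * y - 1)) * (r * (r * y - 1) ^ n) := by rw [mul_pow]; ring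
      _ = 0 := by rw [h2, zero_mul]
  rcases h (r * y) (by linear_combination y * h1) with h3 | h3
  · exact absurd (by linear_combination (-1 : F) * h1 + r * h3) hr
  · exact ⟨y, h3⟩

open TensorProduct in
lemma etale_artin_reduced {P E : Type*} (K : Type*) [CommRing P] [Field K] [Algebra P K]
    [CommRing E] [Algebra P E] [Algebra.Etale P E] :
    IsArtinianRing (E ⊗[P] K) ∧ IsReduced (E ⊗[P] K) := by
  have : IsArtinianRing (K ⊗[P] E) := by
    have : Module.Finite K (K ⊗[P] E) := Algebra.FormallyUnramified.finite_of_free _ _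
    exact IsArtinianRing.of_finite K _
  have hred : IsReduced (K ⊗[P] E) := Algebra.FormallyUnramified.isReduced_of_field K _
  let e : K ⊗[P] E ≃ₐ[P] E ⊗[P] K := Algebra.TensorProduct.comm P K E
  exact ⟨e.toRingEquiv.surjective.isArtinianRing, isReduced_of_injective e.symm e.symm.injective⟩

/-- localization of a reduced artinian ring, expressed by units -/
lemma artin_quot {F F' : Type*} [CommRing F] [CommRing F'] [IsArtinianRing F] [IsReduced F]
    (φ : F →+* F') (M : Submonoid F) (hM : ∀ s ∈ M, IsUnit (φ s))
    (hs : ∀ x : F', ∃ s ∈ M, ∃ a, φ s * x = φ a) :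
    Function.Surjective φ := by
  intro x
  obtain ⟨s, hsM, a, ha⟩ := hs x
  obtain ⟨n, y, hy⟩ := IsArtinian.exists_pow_succ_smul_dvd s (1 : F)
  refine ⟨y * a, ?_⟩
  have h1 : φ s * φ y = 1 := by
    have : s ^ (n + 1) * y = s ^ n * 1 := by simpa using hy
    have h2 := congrArg φ this
    simp only [map_mul, map_pow, mul_one] at h2
    apply ((hM s hsM).pow n).mul_left_cancel
    rw [mul_one]; linear_combination h2
  rw [map_mul, ← ha, ← mul_assoc, mul_comm (φ y), h1, one_mul]

open TensorProduct in
lemma etale_loc_tensor_surj {P E O : Type*} (K : Type*) [CommRing P] [Field K] [Algebra P K]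
    [CommRing E] [Algebra P E] [Algebra.Etale P E] [CommRing O] [Algebra E O] [Algebra P O]
    [IsScalarTower P E O] (M : Submonoid E) [IsLocalization M O] :
    Function.Surjective (Algebra.TensorProduct.map (IsScalarTower.toAlgHom P E O)
      (AlgHom.id P K)) := by
  obtain ⟨_, _⟩ := etale_artin_reduced (P := P) (E := E) K
  refine artin_quot (Algebra.TensorProduct.map (IsScalarTower.toAlgHom P E O)
      (AlgHom.id P K)).toRingHom
    (M.map (Algebra.TensorProduct.includeLeft : E →ₐ[P] E ⊗[P] K)) ?_ ?_
  · rintro _ ⟨s, hs, rfl⟩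
    have : IsUnit (algebraMap E O s) := IsLocalization.map_units O (⟨s, hs⟩ : M)
    simpa using this.map (Algebra.TensorProduct.includeLeft : O →ₐ[P] O ⊗[P] K)
  · intro x
    induction x using TensorProduct.induction_on with
    | zero => exact ⟨1, one_mem _, 0, by simp⟩
    | add x y hx hy =>
      obtain ⟨s, hs, a, ha⟩ := hx
      obtain ⟨t, ht, b, hb⟩ := hy
      refine ⟨s * t, mul_mem hs ht, t * a + s * b, ?_⟩
      rw [map_add, map_mul, map_mul, map_mul, ← ha, ← hb]; ring
    | tmul o k =>
      obtain ⟨⟨a, s⟩, rfl⟩ := IsLocalization.mk'_surjective M o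
      refine ⟨s.1 ⊗ₜ 1, ⟨s.1, s.2, by simp⟩, a ⊗ₜ k, ?_⟩
      simp

open TensorProduct in
lemma etale_local_normal {P E O : Type*} [CommRing P] [IsDomain P] [IsIntegrallyClosed P]
    [CommRing E] [Algebra P E] [Algebra.Etale P E] [CommRing O] [Algebra E O] (q : Ideal E)
    [q.IsPrime] [IsLocalization.AtPrime O q] :
    ∃ _ : IsDomain O, IsIntegrallyClosed O := by
  letI : Algebra P O := ((algebraMap E O).comp (algebraMap P E)).toAlgebra
  haveI : IsScalarTower P E O := IsScalarTower.of_algebraMap_eq' rfl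
  have : IsLocalRing O := IsLocalization.AtPrime.isLocalRing O q
  generalize hK : FractionRing P = K at *
  obtain ⟨_, _, _⟩ : ∃ (_ : Field K) (_ : Algebra P K), IsFractionRing P K := by
    subst hK; exact ⟨inferInstance, inferInstance, inferInstance⟩
  have hbij : Function.Bijective (TensorProduct.toIntegralClosure P O K) :=
    TensorProduct.toIntegralClosure_bijective_of_tower (S := E)
      TensorProduct.toIntegralClosure_bijective_of_smooth
      (TensorProduct.toIntegralClosure_bijective_of_isLocalization q.primeCompl)
  obtain ⟨_, _⟩ := etale_artin_reduced (P := P) (E := E) K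
  have hφ := etale_loc_tensor_surj (P := P) (E := E) (O := O) K q.primeCompl
  have : IsArtinianRing (O ⊗[P] K) := Function.Surjective.isArtinianRing (f := (Algebra.TensorProduct.map
    (IsScalarTower.toAlgHom P E O) (AlgHom.id P K)).toRingHom) hφ
  have hintg : ∀ x : O ⊗[P] K, IsIntegral O x → ∃ o : O, o ⊗ₜ[P] (1 : K) = x := by
    intro x hx
    obtain ⟨y, hy⟩ := hbij.2 ⟨x, hx⟩
    have hy' : (TensorProduct.toIntegralClosure P O K y : O ⊗[P] K) = x := congrArg Subtype.val hy
    rw [← hy']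
    clear hy hy'
    induction y using TensorProduct.induction_on with
    | zero => exact ⟨0, by simp⟩
    | add a b ha hb =>
      obtain ⟨o1, h1⟩ := ha
      obtain ⟨o2, h2⟩ := hb
      exact ⟨o1 + o2, by rw [TensorProduct.add_tmul, h1, h2, map_add]; rfl⟩
    | tmul o k =>
      obtain ⟨p, hp⟩ := IsIntegrallyClosed.isIntegral_iff.1 k.2
      refine ⟨p • o, ?_⟩
      have : (TensorProduct.toIntegralClosure P O K (o ⊗ₜ k) : O ⊗[P] K) = o ⊗ₜ k.1 := rfl
      rw [this, ← hp, TensorProduct.smul_tmul, Algebra.smul_def, mul_one]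
  have hinj : Function.Injective (fun o : O => o ⊗ₜ[P] (1 : K)) := by
    have : Module.Flat E O := IsLocalization.flat O q.primeCompl
    have : Module.Flat P O := Module.Flat.trans P E O
    have h := Module.Flat.lTensor_preserves_injective_linearMap (M := O) (Algebra.linearMap P K)
      (IsFractionRing.injective P K)
    intro a b hab
    apply (TensorProduct.rid P O).symm.injective
    apply h
    simpa using hab
  have hred2 : IsReduced (O ⊗[P] K) := by
    constructor
    intro x ⟨n, hn⟩
    obtain ⟨z, rfl⟩ := hφ x
    obtain ⟨m, y, hy⟩ := IsArtinian.exists_pow_succ_smul_dvd z (1 : E ⊗[P] K)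
    have h1 : z * (z * y - 1) = 0 := by
      apply IsReduced.eq_zero
      refine ⟨m + 1, ?_⟩
      have h2 : z ^ m * (z * y - 1) = 0 := by
        have : z ^ (m + 1) * y = z ^ m * 1 := by simpa using hy
        linear_combination this
      calc (z * (z * y - 1)) ^ (m + 1) = (z ^ m * (z * y - 1)) * (z * (z * y - 1) ^ m) := by rw [mul_pow]; ring
        _ = 0 := by rw [h2, zero_mul]
    have h3 : ∀ j, z = z * (z * y) ^ j := by
      intro j
      induction j with
      | zero => simp
      | succ j ih =>
        rw [pow_succ, ← mul_assoc, ← ih]; linear_combination (-1 : E ⊗[P] K) * h1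
    rw [h3 n, mul_pow, map_mul, map_mul, map_pow, hn]; simp
  have hO : Nontrivial O := inferInstance
  have hnt : Nontrivial (O ⊗[P] K) := hinj.nontrivial
  have hfield : IsField (O ⊗[P] K) := by
    apply artin_field
    intro e he
    obtain ⟨o, rfl⟩ := hintg e ⟨Polynomial.X ^ 2 - Polynomial.X, by
      apply Polynomial.monic_X_pow_sub; simp, by simp [pow_two, he]⟩
    have : o * o = o := by
      apply hinj; simpa using he
    rcases IsLocalRing.isUnit_or_isUnit_one_sub_self o with h | h
    · right
      have : o = 1 := h.mul_left_cancel (by rw [this, mul_one])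
      subst this; rfl
    · left
      have : o = 0 := h.mul_left_cancel (by rw [mul_zero, sub_mul, one_mul, this, sub_self])
      subst this; simp
  letI := hfield.toField
  let ι : O →+* (O ⊗[P] K) := (Algebra.TensorProduct.includeLeft : O →ₐ[P] O ⊗[P] K).toRingHom
  have hι : Function.Injective ι := hinj
  have hdom : IsDomain O := hι.isDomain ι
  refine ⟨hdom, ?_⟩
  rw [isIntegrallyClosed_iff (FractionRing O)]
  intro x hx
  let j : FractionRing O →+* (O ⊗[P] K) := IsFractionRing.lift hι
  have hj : ∀ o, j (algebraMap O _ o) = ι o := fun o => IsFractionRing.lift_algebraMap hι o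
  have hx' : IsIntegral O (j x) := by
    obtain ⟨p, hp, hpx⟩ := hx
    refine ⟨p, hp, ?_⟩
    have := congrArg j hpx
    rw [Polynomial.hom_eval₂, map_zero] at this
    rw [← this]
    congr 1
    ext o
    exact (hj o).symm
  obtain ⟨o, ho⟩ := hintg _ hx'
  exact ⟨o, j.injective (by rw [hj]; exact ho)⟩

lemma smooth_local_normal {A B O : Type*} [CommRing A] [IsDomain A] [UniqueFactorizationMonoid A]
    [CommRing B] [Algebra A B] [Algebra.Smooth A B] [CommRing O] [Algebra B O] (q : Ideal B)
    [q.IsPrime] [IsLocalization.AtPrime O q] :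
    ∃ _ : IsDomain O, IsIntegrallyClosed O := by
  have : Algebra.IsSmoothAt A q := inferInstance
  obtain ⟨f, hf, n, alg, tow, hst⟩ :=
    Algebra.IsSmoothAt.exists_isStandardEtale_mvPolynomial (R := A) (p := q)
  have hdis := (Ideal.disjoint_powers_iff_notMem_of_isPrime _).mpr hf
  have : (Ideal.map (algebraMap B (Localization.Away f)) q).IsPrime :=
    IsLocalization.isPrime_of_isPrime_disjoint (.powers f) _ _ ‹_› hdis
  set Q := Ideal.map (algebraMap B (Localization.Away f)) q with hQ
  obtain ⟨h1, h2⟩ := etale_local_normal (P := MvPolynomial (Fin n) A) (E := Localization.Away f)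
    (O := Localization.AtPrime Q) Q
  have hl : IsLocalization.AtPrime (Localization.AtPrime Q) (Q.comap (algebraMap B (Localization.Away f))) :=
    IsLocalization.isLocalization_isLocalization_atPrime_isLocalization (.powers f) _ Q
  have hc : Q.comap (algebraMap B (Localization.Away f)) = q :=
    IsLocalization.comap_map_of_isPrime_disjoint (.powers f) _ ‹_› hdis
  have hl2 : IsLocalization q.primeCompl (Localization.AtPrime Q) := by
    convert! hl
    exact hc.symm
  let e : O ≃ₐ[B] Localization.AtPrime Q := IsLocalization.algEquiv q.primeCompl _ _
  exact ⟨e.toRingEquiv.toMulEquiv.isDomain _, IsIntegrallyClosed.of_equiv e.toRingEquiv.symm⟩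


/-- order at least `n` at the prime `p` (with respect to a uniformizing element `π`) -/
def OrdGe {O : Type*} [CommRing O] (π : O) (p : Ideal O) (n : ℕ) (a : O) : Prop :=
  ∃ s, s ∉ p ∧ π ^ n ∣ s * a

/-- order exactly `n` at the prime `p` (with respect to a uniformizing element `π`) -/
def OrdEx {O : Type*} [CommRing O] (π : O) (p : Ideal O) (n : ℕ) (a : O) : Prop :=
  ∃ s t, s ∉ p ∧ t ∉ p ∧ s * a = π ^ n * t

section ords
variable {O : Type*} [CommRing O] {π : O} {p : Ideal O}

lemma OrdGe.mul (hp : p.IsPrime) {n m : ℕ} {a b : O} (ha : OrdGe π p n a) (hb : OrdGe π p m b) :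
    OrdGe π p (n + m) (a * b) := by
  obtain ⟨s, hs, c, hc⟩ := ha
  obtain ⟨t, ht, d, hd⟩ := hb
  refine ⟨s * t, fun h => (hp.mem_or_mem h).elim hs ht, c * d, ?_⟩
  calc s * t * (a * b) = (s * a) * (t * b) := by ring
    _ = _ := by rw [hc, hd]; ring

lemma OrdEx.mul (hp : p.IsPrime) {n m : ℕ} {a b : O} (ha : OrdEx π p n a) (hb : OrdEx π p m b) :
    OrdEx π p (n + m) (a * b) := by
  obtain ⟨s, c, hs, hc, e1⟩ := ha
  obtain ⟨t, d, ht, hd, e2⟩ := hb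
  refine ⟨s * t, c * d, fun h => (hp.mem_or_mem h).elim hs ht,
    fun h => (hp.mem_or_mem h).elim hc hd, ?_⟩
  calc s * t * (a * b) = (s * a) * (t * b) := by ring
    _ = _ := by rw [e1, e2]; ring

lemma OrdEx.ge {n : ℕ} {a : O} (ha : OrdEx π p n a) : OrdGe π p n a := by
  obtain ⟨s, c, hs, hc, e1⟩ := ha
  exact ⟨s, hs, c, e1⟩

lemma OrdGe.mono {n m : ℕ} {a : O} (ha : OrdGe π p n a) (h : m ≤ n) : OrdGe π p m a := by
  obtain ⟨s, hs, e1⟩ := ha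
  exact ⟨s, hs, (pow_dvd_pow π h).trans e1⟩

lemma ordEx_zero (hp : p.IsPrime) {a : O} (ha : a ∉ p) : OrdEx π p 0 a :=
  ⟨1, a, fun h => hp.ne_top ((Ideal.eq_top_iff_one _).2 h), ha, by simp⟩

lemma ordEx_one (hp : p.IsPrime) : OrdEx π p 0 (1 : O) :=
  ordEx_zero hp fun h => hp.ne_top ((Ideal.eq_top_iff_one _).2 h)

lemma ordGe_zero (hp : p.IsPrime) {a : O} : OrdGe π p 0 a :=
  ⟨1, fun h => hp.ne_top ((Ideal.eq_top_iff_one _).2 h), by simp⟩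

lemma OrdEx.pow (hp : p.IsPrime) {n : ℕ} {a : O} (ha : OrdEx π p n a) (m : ℕ) :
    OrdEx π p (m * n) (a ^ m) := by
  induction m with
  | zero => simpa using ordEx_one hp
  | succ m ih => rw [pow_succ, Nat.succ_mul]; exact ih.mul hp ha

lemma OrdGe.pow (hp : p.IsPrime) {n : ℕ} {a : O} (ha : OrdGe π p n a) (m : ℕ) :
    OrdGe π p (m * n) (a ^ m) := by
  induction m with
  | zero => simpa using ordGe_zero hp
  | succ m ih => rw [pow_succ, Nat.succ_mul]; exact ih.mul hp ha

lemma OrdGe.add (hp : p.IsPrime) {n : ℕ} {a b : O} (ha : OrdGe π p n a) (hb : OrdGe π p n b) :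
    OrdGe π p n (a + b) := by
  obtain ⟨s, hs, c, hc⟩ := ha
  obtain ⟨t, ht, d, hd⟩ := hb
  refine ⟨s * t, fun h => (hp.mem_or_mem h).elim hs ht, t * c + s * d, ?_⟩
  linear_combination t * hc + s * hd

lemma OrdEx.prod (hp : p.IsPrime) {ι : Type*} (s : Finset ι) (n : ι → ℕ) (a : ι → O)
    (h : ∀ i ∈ s, OrdEx π p (n i) (a i)) : OrdEx π p (∑ i ∈ s, n i) (∏ i ∈ s, a i) := by
  classical
  induction s using Finset.induction_on with
  | empty => simpa using ordEx_one hp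
  | insert i s hi ih =>
    rw [Finset.sum_insert hi, Finset.prod_insert hi]
    exact (h i (by simp)).mul hp (ih fun j hj => h j (by simp [hj]))

lemma ordEx_self (hp : p.IsPrime) : OrdEx π p 1 π :=
  ⟨1, 1, fun h => hp.ne_top ((Ideal.eq_top_iff_one _).2 h),
    fun h => hp.ne_top ((Ideal.eq_top_iff_one _).2 h), by simp⟩

lemma OrdGe.le_of_ordEx (hp : p.IsPrime) (hπ : ∀ a, π * a = 0 → a = 0) (hπp : π ∈ p) {n m : ℕ}
    {a : O} (ha : OrdGe π p n a) (hb : OrdEx π p m a) : n ≤ m := by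
  by_contra h
  push Not at h
  obtain ⟨s, hs, c, hc⟩ := ha
  obtain ⟨t, d, ht, hd, e⟩ := hb
  obtain ⟨j, rfl⟩ := Nat.exists_eq_add_of_lt h
  have hpow : ∀ N : ℕ, ∀ a, π ^ N * a = 0 → a = 0 := by
    intro N
    induction N with
    | zero => intro a h; simpa using h
    | succ N ih => intro a h; apply hπ; apply ih; rw [← h]; ring
  have h1 : s * d - π * (π ^ j * (t * c)) = 0 := by
    apply hpow m
    have : t * (s * a) = s * (t * a) := by ring
    rw [hc, e] at this
    linear_combination -this
  have h2 : s * d ∈ p := by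
    rw [sub_eq_zero.1 h1]; exact Ideal.mul_mem_right _ _ hπp
  exact (hp.mem_or_mem h2).elim hs hd

lemma OrdEx.unique (hp : p.IsPrime) (hπ : ∀ a, π * a = 0 → a = 0) (hπp : π ∈ p) {n m : ℕ}
    {a : O} (ha : OrdEx π p n a) (hb : OrdEx π p m a) : n = m :=
  le_antisymm (ha.ge.le_of_ordEx hp hπ hπp hb) (hb.ge.le_of_ordEx hp hπ hπp ha)

/-- existence of orders for divisors of powers of `π` -/
lemma exists_ordEx (hp : p.IsPrime) (hπ : ∀ a, π * a = 0 → a = 0)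
    (h1 : ∀ a ∈ p, OrdGe π p 1 a) (M : ℕ) :
    ∀ a c s : O, s ∉ p → a * c = s * π ^ M → ∃ n, OrdEx π p n a := by
  induction M with
  | zero =>
    intro a c s hs h
    refine ⟨0, ordEx_zero hp fun ha => hs ?_⟩
    rw [pow_zero, mul_one] at h
    rw [← h]; exact Ideal.mul_mem_right _ _ ha
  | succ M ih =>
    intro a c s hs h
    by_cases ha : a ∈ p
    · obtain ⟨t, ht, b, hb⟩ := h1 a ha
      rw [pow_one] at hb
      obtain ⟨n, s1, t1, hs1, ht1, e1⟩ := ih b c (t * s) (fun h => (hp.mem_or_mem h).elim ht hs) (by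
        rw [← sub_eq_zero]; apply hπ
        linear_combination t * h - c * hb)
      exact ⟨n + 1, s1 * t, t1, fun h => (hp.mem_or_mem h).elim hs1 ht, ht1, by
        linear_combination s1 * hb + π * e1⟩
    · exact ⟨0, ordEx_zero hp ha⟩

end ords

/-- The local structure of the chart. -/
structure LModel {O : Type*} [CommRing O] (π : O) {ι : Type*} [Fintype ι] (x : ι → O) (k : ℕ) :
    Prop where
  nzd : ∀ a, π * a = 0 → a = 0
  kpos : 0 < k
  unit : ∃ u, IsUnit u ∧ ∏ i, x i = π ^ k * u
  prime : ∀ i, (Ideal.span {π, x i}).IsPrime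
  notMem : ∀ i j, i ≠ j → x j ∉ Ideal.span {π, x i}
  inter : ∀ a, (∀ i, a ∈ Ideal.span {π, x i}) → π ∣ a
  prime2 : ∀ i j, i ≠ j → (Ideal.span {π, x i, x j}).IsPrime
  notMem2 : ∀ i j r, i ≠ j → r ≠ i → r ≠ j → x r ∉ Ideal.span {π, x i, x j}

namespace LModel
variable {O : Type*} [CommRing O] {π : O} {ι : Type*} [Fintype ι] {x : ι → O} {k : ℕ}

lemma pi_mem (i : ι) : π ∈ Ideal.span {π, x i} := Ideal.subset_span (by simp)
lemma x_mem (i : ι) : x i ∈ Ideal.span {π, x i} := Ideal.subset_span (by simp)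

lemma pow_nzd (h : LModel π x k) (N : ℕ) : ∀ a, π ^ N * a = 0 → a = 0 := by
  induction N with
  | zero => intro a h; simpa using h
  | succ N ih => intro a e; apply h.nzd; apply ih; rw [← e]; ring

lemma ord_x_same (h : LModel π x k) (i : ι) : OrdEx π (Ideal.span {π, x i}) k (x i) := by
  classical
  obtain ⟨u, hu, e⟩ := h.unit
  have hp := h.prime i
  refine ⟨∏ j ∈ Finset.univ.erase i, x j, u, ?_, ?_, ?_⟩
  · intro hm
    obtain ⟨j, hj, hj2⟩ := (hp.prod_mem_iff).1 hm
    exact h.notMem i j (Finset.ne_of_mem_erase hj).symm hj2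
  · exact fun hm => hp.ne_top (Ideal.eq_top_of_isUnit_mem _ hm hu)
  · rw [← e, Finset.prod_erase_mul _ _ (Finset.mem_univ i)]

lemma ord_x_ne (h : LModel π x k) (i j : ι) (hij : i ≠ j) :
    OrdEx π (Ideal.span {π, x i}) 0 (x j) := ordEx_zero (h.prime i) (h.notMem i j hij)

lemma ordGe_one (h : LModel π x k) (i : ι) (a : O) (ha : a ∈ Ideal.span {π, x i}) :
    OrdGe π (Ideal.span {π, x i}) 1 a := by
  obtain ⟨c, d, rfl⟩ := Ideal.mem_span_pair.1 ha
  have hp := h.prime i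
  refine OrdGe.add hp ?_ ?_
  · simpa using (ordGe_zero (π := π) hp (a := c)).mul hp (ordEx_self hp).ge
  · simpa using (ordGe_zero (π := π) hp (a := d)).mul hp ((h.ord_x_same i).ge.mono h.kpos)

lemma mem_of_ordGe_one (h : LModel π x k) (i : ι) (a : O)
    (ha : OrdGe π (Ideal.span {π, x i}) 1 a) : a ∈ Ideal.span {π, x i} := by
  obtain ⟨s, hs, c, hc⟩ := ha
  refine ((h.prime i).mem_or_mem (x := s) (y := a) ?_).resolve_left hs
  rw [hc, pow_one]; exact Ideal.mul_mem_right _ _ (pi_mem i)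

lemma dvd_of_ordGe (h : LModel π x k) (n : ℕ) :
    ∀ a, (∀ i, OrdGe π (Ideal.span {π, x i}) n a) → π ^ n ∣ a := by
  induction n with
  | zero => intro a _; simp
  | succ n ih =>
    intro a ha
    obtain ⟨b, rfl⟩ := ih a fun i => (ha i).mono (Nat.le_succ n)
    have : π ∣ b := by
      apply h.inter
      intro i
      apply h.mem_of_ordGe_one
      obtain ⟨s, hs, c, hc⟩ := ha i
      refine ⟨s, hs, c, ?_⟩
      rw [← sub_eq_zero]; apply h.pow_nzd n
      linear_combination hc
    rw [pow_succ]; exact mul_dvd_mul_left _ this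

lemma dvd_of_ord (h : LModel π x k) (a b b' : O) (M : ℕ) (hb : b * b' = π ^ M) (n : ι → ℕ)
    (ha : ∀ i, OrdGe π (Ideal.span {π, x i}) (n i) a)
    (hbn : ∀ i, OrdEx π (Ideal.span {π, x i}) (n i) b) : b ∣ a := by
  have key : π ^ M ∣ a * b' := by
    apply h.dvd_of_ordGe
    intro i
    have hp := h.prime i
    obtain ⟨m, hm⟩ := exists_ordEx hp h.nzd (h.ordGe_one i) M b' b 1
      (fun h => hp.ne_top ((Ideal.eq_top_iff_one _).2 h)) (by rw [mul_comm, hb, one_mul])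
    have h1 := (hbn i).mul hp hm
    rw [hb] at h1
    have h2 := (ordEx_self (π := π) hp).pow hp M
    have h3 := h1.unique hp h.nzd (pi_mem i) h2
    rw [show M = n i + m by omega]
    exact (ha i).mul hp hm.ge
  obtain ⟨w, hw⟩ := key
  refine ⟨w, ?_⟩
  rw [← sub_eq_zero]
  apply h.pow_nzd M
  rw [← hb]
  linear_combination b * hw - w * b * hb

lemma x_dvd_pow (h : LModel π x k) (i : ι) : ∃ c, x i * c = π ^ k := by
  classical
  obtain ⟨u, hu, e⟩ := h.unit
  obtain ⟨v, hv⟩ := hu.exists_right_inv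
  refine ⟨(∏ j ∈ Finset.univ.erase i, x j) * v, ?_⟩
  rw [← mul_assoc, Finset.mul_prod_erase _ _ (Finset.mem_univ i), e, mul_assoc, hv, mul_one]

lemma prod_x_dvd (h : LModel π x k) (e : ι → ℕ) : ∃ c M, (∏ i, x i ^ e i) * c = π ^ M := by
  choose c hc using h.x_dvd_pow
  refine ⟨∏ i, c i ^ e i, ∑ i, k * e i, ?_⟩
  rw [← Finset.prod_mul_distrib, ← Finset.prod_pow_eq_pow_sum]
  refine Finset.prod_congr rfl fun i _ => ?_
  rw [← mul_pow, hc, pow_mul]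

lemma ord_prod_x (h : LModel π x k) (e : ι → ℕ) (i : ι) :
    OrdEx π (Ideal.span {π, x i}) (k * e i) (∏ j, x j ^ e j) := by
  classical
  have hp := h.prime i
  have := OrdEx.prod (π := π) hp Finset.univ (fun j => if j = i then k * e i else 0)
    (fun j => x j ^ e j) (by
      intro j _
      by_cases hj : j = i
      · subst hj; simpa [mul_comm] using (h.ord_x_same j).pow hp (e j)
      · simpa [hj] using (h.ord_x_ne i j (Ne.symm hj)).pow hp (e j))
  simpa using this

/-- ring-theoretic core of the direction Cartier divisor ⇒ `T`-Cartier. -/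
theorem core_dvd (h : LModel π x k) (a a' : O) (M : ℕ) (haa : a * a' = π ^ M) (α : ι → ℕ)
    (hα : ∀ i, OrdEx π (Ideal.span {π, x i}) (α i) a) (i j : ι) :
    (k : ℤ) ∣ (α i : ℤ) - α j := by
  classical
  by_cases hij : i = j
  · subst hij; simp
  -- enlarge
  set e : ι → ℕ := fun r => if r = j then 0 else α j with he
  have hord : ∀ r, OrdEx π (Ideal.span {π, x r}) (α r + k * e r) (a * ∏ r, x r ^ e r) :=
    fun r => (hα r).mul (h.prime r) (h.ord_prod_x e r)
  have hge : ∀ r, α j ≤ α r + k * e r := by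
    intro r
    by_cases hr : r = j
    · subst hr; omega
    · have : α j ≤ k * α j := Nat.le_mul_of_pos_left _ h.kpos
      simp [he, hr]; omega
  obtain ⟨c, hc⟩ := h.dvd_of_ordGe (α j) _ fun r => (hord r).ge.mono (hge r)
  have hcord : ∀ r, OrdEx π (Ideal.span {π, x r}) (α r + k * e r - α j) c := by
    intro r
    obtain ⟨s, t, hs, ht, est⟩ := hord r
    refine ⟨s, t, hs, ht, ?_⟩
    rw [← sub_eq_zero]; apply h.pow_nzd (α j)
    have : π ^ (α r + k * e r) = π ^ (α j) * π ^ (α r + k * e r - α j) := by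
      rw [← pow_add]; congr 1; have := hge r; omega
    rw [hc, this] at est
    linear_combination est
  set γ : ι → ℕ := fun r => α r + k * e r - α j with hγ
  -- c divides a power of π
  obtain ⟨d, M1, hd⟩ := h.prod_x_dvd e
  have hcd : ∃ c' M2, c * c' = π ^ M2 := by
    refine ⟨π ^ (α j) * (a' * d), M + M1, ?_⟩
    calc c * (π ^ (α j) * (a' * d)) = (π ^ α j * c) * (a' * d) := by ring
      _ = (a * a') * ((∏ r, x r ^ e r) * d) := by rw [← hc]; ring
      _ = _ := by rw [haa, hd, pow_add]
  obtain ⟨c', M2, hc'⟩ := hcd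
  obtain ⟨d2, M3, hd2⟩ := h.prod_x_dvd γ
  have hck : ∀ r, OrdEx π (Ideal.span {π, x r}) (k * γ r) (c ^ k) := fun r =>
    (hcord r).pow (h.prime r) k
  have hγj : γ j = 0 := by simp [hγ, he]
  have hd1 : ∏ r, x r ^ γ r ∣ c ^ k :=
    h.dvd_of_ord _ _ d2 M3 hd2 (fun r => k * γ r) (fun r => (hck r).ge) (h.ord_prod_x γ)
  have hd2 : c ^ k ∣ ∏ r, x r ^ γ r :=
    h.dvd_of_ord _ _ (c' ^ k) (M2 * k) (by rw [← mul_pow, hc', pow_mul]) (fun r => k * γ r)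
      (fun r => (h.ord_prod_x γ r).ge) hck
  -- reduce modulo p_j
  have hpj := h.prime j
  let φ := Ideal.Quotient.mk (Ideal.span {π, x j})
  have hker : ∀ y, φ y = 0 ↔ y ∈ Ideal.span {π, x j} := fun y => Ideal.Quotient.eq_zero_iff_mem
  have hdvd : ∀ y, φ (x i) ∣ φ y → y ∈ Ideal.span {π, x j, x i} := by
    rintro y ⟨w, hw⟩
    obtain ⟨w, rfl⟩ := Ideal.Quotient.mk_surjective w
    have : y - x i * w ∈ Ideal.span {π, x j} := by
      rw [← hker, map_sub, map_mul]; exact sub_eq_zero.2 hw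
    have h1 : y = (y - x i * w) + x i * w := by ring
    rw [h1]
    refine add_mem (Ideal.span_mono (by simp [Set.insert_subset_iff]) this)
      (Ideal.mul_mem_right _ _ (Ideal.subset_span (by simp)))
  have hdvd' : ∀ y, y ∈ Ideal.span {π, x j, x i} → φ (x i) ∣ φ y := by
    intro y hy
    rw [Ideal.mem_span_insert] at hy
    obtain ⟨a1, z, hz, rfl⟩ := hy
    obtain ⟨b1, c1, rfl⟩ := Ideal.mem_span_pair.1 hz
    have e1 : φ π = 0 := (hker _).2 (pi_mem j)
    have e2 : φ (x j) = 0 := (hker _).2 (x_mem j)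
    simp [e1, e2]
  have hpr : Prime (φ (x i)) := by
    refine ⟨fun h0 => h.notMem j i (Ne.symm hij) ((hker _).1 h0), fun hu => ?_, fun y z hyz => ?_⟩
    · apply (h.prime2 j i (Ne.symm hij)).ne_top
      rw [Ideal.eq_top_iff_one]
      exact hdvd 1 (by rw [map_one]; exact hu.dvd)
    · obtain ⟨y, rfl⟩ := Ideal.Quotient.mk_surjective y
      obtain ⟨z, rfl⟩ := Ideal.Quotient.mk_surjective z
      have := hdvd (y * z) (by rw [map_mul]; exact hyz)
      rcases (h.prime2 j i (Ne.symm hij)).mem_or_mem this with h1 | h1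
      · exact Or.inl (hdvd' _ h1)
      · exact Or.inr (hdvd' _ h1)
  have hassoc : emultiplicity (φ (x i)) (φ (c ^ k)) = emultiplicity (φ (x i)) (φ (∏ r, x r ^ γ r)) :=
    le_antisymm (emultiplicity_le_emultiplicity_of_dvd_right (map_dvd φ hd2))
      (emultiplicity_le_emultiplicity_of_dvd_right (map_dvd φ hd1))
  have hrhs : emultiplicity (φ (x i)) (φ (∏ r, x r ^ γ r)) = γ i := by
    rw [← Finset.mul_prod_erase _ _ (Finset.mem_univ i), map_mul, emultiplicity_mul hpr, map_pow,
      emultiplicity_pow_self_of_prime hpr, emultiplicity_eq_zero.2, add_zero]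
    intro hd
    rw [map_prod] at hd
    obtain ⟨r, hr, hd⟩ := (Prime.dvd_finset_prod_iff hpr _).1 hd
    rw [map_pow] at hd
    by_cases hrj : r = j
    · subst hrj; rw [hγj, pow_zero] at hd; exact hpr.not_unit (isUnit_of_dvd_one hd)
    · exact h.notMem2 j i r (Ne.symm hij) hrj (Finset.ne_of_mem_erase hr)
        (hdvd _ (hpr.dvd_of_dvd_pow hd))
  rw [hrhs, map_pow, emultiplicity_pow hpr] at hassoc
  have : ∃ n : ℕ, k * n = γ i := by
    cases hn : emultiplicity (φ (x i)) (φ c) with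
    | top =>
      rw [hn] at hassoc
      have : (k : ℕ∞) * ⊤ = ⊤ := ENat.mul_top (by have := h.kpos; simp; omega)
      rw [this] at hassoc
      exact absurd hassoc.symm (ENat.coe_ne_top _)
    | coe n =>
      rw [hn] at hassoc
      exact ⟨n, by exact_mod_cast hassoc⟩
  obtain ⟨n, hn⟩ := this
  have hi := hge i
  have h5 : (γ i : ℤ) = α i + k * e i - α j := by
    simp only [hγ]; push_cast [Nat.cast_sub hi]; ring
  refine ⟨n - e i, ?_⟩
  have : (k : ℤ) * n = γ i := by exact_mod_cast hn
  linear_combination -this - h5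
end LModel


namespace LModel

/-- ring-theoretic core of the direction `T`-Cartier ⇒ Cartier divisor. -/
theorem core_exists {O O' : Type u} [CommRing O] [CommRing O'] [Algebra O O'] [IsLocalRing O']
    [Module.FaithfullyFlat O O'] {ι : Type*} [Fintype ι] [Nonempty ι]
    {π : O} {x : ι → O'} {k : ℕ} (h : LModel (algebraMap O O' π) x k) (m : ι → ℕ)
    (hm : ∀ i j, (k : ℤ) ∣ (m i : ℤ) - m j)
    (hmin : ∀ i j, (Ideal.span {algebraMap O O' π, x j}).comap (algebraMap O O') ≤
      (Ideal.span {algebraMap O O' π, x i}).comap (algebraMap O O') → m i = m j) :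
    ∃ a a' : O, ∃ M : ℕ, a * a' = π ^ M ∧ ∀ i,
      OrdEx π ((Ideal.span {algebraMap O O' π, x i}).comap (algebraMap O O')) (m i) a := by
  classical
  set φ := algebraMap O O' with hφ
  set p : ι → Ideal O' := fun i => Ideal.span {φ π, x i} with hp
  have hpp : ∀ i, (p i).IsPrime := h.prime
  obtain ⟨i0, hi0⟩ := Finite.exists_min m
  have he : ∀ i, ∃ e : ℕ, m i = m i0 + k * e := by
    intro i
    obtain ⟨e, he⟩ : k ∣ m i - m i0 := by
      have := hm i i0
      rw [← Int.natCast_dvd_natCast, Nat.cast_sub (hi0 i)]; exact this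
    exact ⟨e, by have := hi0 i; omega⟩
  choose e he using he
  set g : O' := (φ π) ^ (m i0) * ∏ i, x i ^ e i with hg
  have hgord : ∀ i, OrdEx (φ π) (p i) (m i) g := by
    intro i
    rw [he i]
    have := ((ordEx_self (π := φ π) (hpp i)).pow (hpp i) (m i0)).mul (hpp i) (h.ord_prod_x e i)
    simpa using this
  obtain ⟨c0, M0, hc0⟩ := h.prod_x_dvd e
  have hgM : g * c0 = (φ π) ^ (m i0 + M0) := by
    rw [hg, mul_assoc, hc0, pow_add]
  -- choose the auxiliary elements
  have hs : ∀ i, ∃ s : O, s ∉ (p i).comap φ ∧ (φ π) ^ (m i) ∣ φ s * g := by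
    intro i
    have ht : ∀ j, ∃ t : O, t ∉ (p i).comap φ ∧ (m j < m i → t ∈ (p j).comap φ) := by
      intro j
      by_cases hj : (p j).comap φ ≤ (p i).comap φ
      · exact ⟨1, fun h1 => (hpp i).ne_top ((Ideal.eq_top_iff_one _).2 (by simpa using h1)),
          fun hlt => absurd (hmin i j hj) (by omega)⟩
      · obtain ⟨t, h1, h2⟩ := SetLike.not_le_iff_exists.1 hj
        exact ⟨t, h2, fun _ => h1⟩
    choose t ht1 ht2 using ht
    have hpi : ((p i).comap φ).IsPrime := Ideal.comap_isPrime φ (p i)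
    refine ⟨∏ j, t j ^ m i, ?_, ?_⟩
    · intro hmem
      obtain ⟨j, _, hj⟩ := hpi.prod_mem_iff.1 hmem
      exact ht1 j (hpi.mem_of_pow_mem _ hj)
    · apply h.dvd_of_ordGe
      intro j
      by_cases hj : m j < m i
      · have h1 := (h.ordGe_one j (φ (t j)) (ht2 j hj)).pow (hpp j) (m i)
        have h2 := (h1.mul (hpp j) (ordGe_zero (hpp j)
          (a := (∏ r ∈ Finset.univ.erase j, φ (t r) ^ m i) * g))).mono (m := m i) (by omega)
        rw [← mul_assoc, Finset.mul_prod_erase _ (fun r => φ (t r) ^ m i) (Finset.mem_univ j)] at h2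
        simpa [map_prod, map_pow] using h2
      · have h2 := ((ordGe_zero (π := φ π) (hpp j) (a := φ (∏ j, t j ^ m i))).mul (hpp j)
          (hgord j).ge).mono (m := m i) (by omega)
        exact h2
  choose s hs1 y hy using hs
  -- equational criterion
  let f : (ι →₀ O) →ₗ[O] (Option ι →₀ O) := Finsupp.linearCombination O fun i =>
    s i • Finsupp.single none (1 : O) - (π ^ m i) • Finsupp.single (some i) (1 : O)
  let X : (Option ι →₀ O) →ₗ[O] O' := Finsupp.linearCombination O fun o => o.elim g y
  have hXf : X ∘ₗ f = 0 := by
    ext i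
    have := hy i
    simp only [X, f, LinearMap.comp_apply, Finsupp.lsingle_apply, Finsupp.linearCombination_single,
      one_smul, map_sub, map_smul, Option.elim, LinearMap.zero_apply]
    rw [Algebra.smul_def, Algebra.smul_def, ← hφ, hy i, map_pow, sub_self]
  obtain ⟨N, a, Y, hXY, haf⟩ := Module.Flat.exists_factorization_of_comp_eq_zero_of_free hXf
  set hh : Fin N → O := fun j => a (Finsupp.single none 1) j with hhh
  have hdiv : ∀ i j, π ^ m i ∣ s i * hh j := by
    intro i j
    have := congrArg (fun l => l (Finsupp.single i 1) j) haf
    simp only [f, LinearMap.comp_apply, Finsupp.linearCombination_single, one_smul, map_sub,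
      map_smul, LinearMap.zero_apply, Finsupp.coe_sub, Finsupp.coe_smul, Pi.sub_apply,
      Pi.smul_apply, smul_eq_mul, Finsupp.coe_zero, Pi.zero_apply] at this
    exact ⟨_, sub_eq_zero.1 this⟩
  have hgsum : g = ∑ j, φ (hh j) * Y (Finsupp.single j 1) := by
    have h1 : X (Finsupp.single none 1) = g := by simp [X]
    rw [← h1, hXY, LinearMap.comp_apply]
    conv_lhs => rw [← Finsupp.univ_sum_single (a (Finsupp.single none 1))]
    rw [map_sum]
    refine Finset.sum_congr rfl fun j _ => ?_
    rw [show Finsupp.single j (a (Finsupp.single none 1) j) =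
      (a (Finsupp.single none 1) j) • Finsupp.single j (1 : O) by simp, map_smul, Algebra.smul_def]
  have hgdvd : ∀ j, g ∣ φ (hh j) := by
    intro j
    refine h.dvd_of_ord _ _ c0 _ hgM m (fun i => ?_) hgord
    refine ⟨φ (s i), hs1 i, ?_⟩
    rw [← map_mul, ← map_pow]; exact map_dvd φ (hdiv i j)
  choose w hw using hgdvd
  have hgnzd : ∀ b, g * b = 0 → b = 0 := by
    intro b hb
    apply h.pow_nzd (m i0 + M0)
    rw [← hgM]; linear_combination c0 * hb
  have hone : ∑ j, w j * Y (Finsupp.single j 1) = 1 := by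
    rw [← sub_eq_zero]; apply hgnzd
    rw [mul_sub, Finset.mul_sum, mul_one, sub_eq_zero]
    conv_rhs => rw [hgsum]
    refine Finset.sum_congr rfl fun j _ => ?_
    rw [hw j]; ring
  obtain ⟨j, hj⟩ : ∃ j, IsUnit (w j) := by
    by_contra hcon
    push Not at hcon
    have : (1 : O') ∈ IsLocalRing.maximalIdeal O' := by
      rw [← hone]
      exact sum_mem fun j _ => Ideal.mul_mem_right _ _
        ((IsLocalRing.mem_maximalIdeal _).2 (hcon j))
    exact (IsLocalRing.maximalIdeal.isMaximal O').ne_top ((Ideal.eq_top_iff_one _).2 this)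
  have hdesc : hh j ∣ π ^ (m i0 + M0) := by
    rw [← Ideal.mem_span_singleton]
    rw [← Ideal.comap_map_eq_self_of_faithfullyFlat (B := O') (Ideal.span {hh j}), Ideal.mem_comap,
      Ideal.map_span, Set.image_singleton, Ideal.mem_span_singleton, map_pow, ← hgM]
    obtain ⟨v, hv⟩ := hj.exists_right_inv
    refine ⟨v * c0, ?_⟩
    have := hw j
    rw [← hφ, hw j]; linear_combination -(g * c0) * hv
  obtain ⟨a', ha'⟩ := hdesc
  refine ⟨hh j, a', _, ha'.symm, fun i => ?_⟩
  obtain ⟨t, ht⟩ := hdiv i j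
  refine ⟨s i, t, hs1 i, fun hmem => ?_, ht⟩
  have h1 : OrdGe (φ π) (p i) (m i + 1) (φ (s i * hh j)) := by
    rw [ht, map_mul, map_pow]
    simpa using (((ordEx_self (π := φ π) (hpp i)).pow (hpp i) (m i)).ge).mul (hpp i)
      (h.ordGe_one i (φ t) hmem)
  have h2 : OrdEx (φ π) (p i) (m i) (φ (s i * hh j)) := by
    rw [map_mul, hw j]
    have hwn : w j ∉ p i := fun hmem => (hpp i).ne_top (Ideal.eq_top_of_isUnit_mem _ hmem hj)
    simpa using (ordEx_zero (π := φ π) (hpp i) (a := φ (s i)) (hs1 i)).mul (hpp i)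
      ((hgord i).mul (hpp i) (ordEx_zero (hpp i) hwn))
  have := h1.le_of_ordEx (hpp i) h.nzd (pi_mem i) h2
  omega

end LModel


lemma elemOrd_iff (A : Type u) [CommRing A] (a : A) (m : ℕ) : elemOrd A a m ↔ Ring.ord A a = m := by
  rw [elemOrd, ← Module.coe_length, Ring.ord]
  norm_cast

lemma elemOrd_unique {A : Type u} [CommRing A] {a : A} {m n : ℕ} (h1 : elemOrd A a m)
    (h2 : elemOrd A a n) : m = n := by
  rw [elemOrd_iff] at h1 h2
  rw [h1] at h2
  exact_mod_cast h2

lemma elemOrd_assoc {A : Type u} [CommRing A] {a b : A} {m : ℕ} (h : Associated a b)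
    (h1 : elemOrd A a m) : elemOrd A b m := by
  rw [elemOrd_iff] at h1 ⊢
  rw [← h1, Ring.ord_eq_of_associated h]

lemma elemOrd_unit {A : Type u} [CommRing A] {a : A} (h : IsUnit a) : elemOrd A a 0 := by
  rw [elemOrd_iff, Ring.ord_of_isUnit h]; rfl

lemma elemOrd_dvr_pow {A : Type u} [CommRing A] [IsDomain A] [IsDiscreteValuationRing A] {ϖ : A}
    (h : Irreducible ϖ) (n : ℕ) : elemOrd A (ϖ ^ n) n := by
  rw [elemOrd_iff, Ring.ord_pow (mem_nonZeroDivisors_of_ne_zero h.ne_zero), Ring.ord_of_irreducible h]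
  simp

lemma elemOrd_dvr_zero {A : Type u} [CommRing A] [IsDomain A] [IsDiscreteValuationRing A] (n : ℕ) :
    ¬ elemOrd A 0 n := by
  obtain ⟨ϖ, h⟩ := IsDiscreteValuationRing.exists_irreducible A
  intro hn
  have h1 := elemOrd_dvr_pow h (n + 1)
  rw [elemOrd_iff] at hn h1
  have := Ring.ord_le_ord_of_dvd (dvd_zero (ϖ ^ (n + 1)))
  rw [hn, h1] at this
  have : n + 1 ≤ n := by exact_mod_cast this
  omega

/-- in a DVR, elements of the same order are associated -/
lemma assoc_of_elemOrd {A : Type u} [CommRing A] [IsDomain A] [IsDiscreteValuationRing A] {a b : A}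
    (ha : a ≠ 0) (hb : b ≠ 0) (h : ∀ m n, elemOrd A a m → elemOrd A b n → m = n) :
    Associated a b := by
  obtain ⟨ϖ, hϖ⟩ := IsDiscreteValuationRing.exists_irreducible A
  obtain ⟨n, h1⟩ := IsDiscreteValuationRing.associated_pow_irreducible ha hϖ
  obtain ⟨m, h2⟩ := IsDiscreteValuationRing.associated_pow_irreducible hb hϖ
  have := h _ _ (elemOrd_assoc h1.symm (elemOrd_dvr_pow hϖ n))
    (elemOrd_assoc h2.symm (elemOrd_dvr_pow hϖ m))
  subst this
  exact h1.trans h2.symm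

lemma ordGe_one_of_minimal {O : Type*} [CommRing O] {π : O} {z : Ideal O}
    (hz : z ∈ (Ideal.span {π}).minimalPrimes) (hrad : ∀ (a : O) (n : ℕ), π ∣ a ^ n → π ∣ a) :
    ∀ a ∈ z, OrdGe π z 1 a := by
  intro a ha
  have hzp : z.IsPrime := hz.1.1
  by_contra hcon
  let S : Submonoid O := {
    carrier := {y | ∃ s n, s ∉ z ∧ y = s * a ^ n}
    one_mem' := ⟨1, 0, fun h => hzp.ne_top ((Ideal.eq_top_iff_one _).2 h), by simp⟩
    mul_mem' := by
      rintro _ _ ⟨s, n, hs, rfl⟩ ⟨t, m, ht, rfl⟩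
      exact ⟨s * t, n + m, fun h => (hzp.mem_or_mem h).elim hs ht, by ring⟩ }
  have hdis : Disjoint (Ideal.span {π} : Set O) (S : Set O) := by
    rw [Set.disjoint_left]
    rintro y hy ⟨s, n, hs, rfl⟩
    rw [SetLike.mem_coe, Ideal.mem_span_singleton] at hy
    refine hcon ⟨s, hs, ?_⟩
    rw [pow_one]
    apply hrad _ (n + 1)
    rw [show (s * a) ^ (n + 1) = (s * a ^ n) * (s ^ n * a) by ring]
    exact hy.mul_right _
  obtain ⟨q, hq, hle, hd⟩ := Ideal.exists_le_prime_disjoint _ S hdis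
  have hqz : q ≤ z := by
    intro y hy
    by_contra hyz
    exact Set.disjoint_left.1 hd hy ⟨y, 0, hyz, by simp⟩
  have : z ≤ q := hz.2 ⟨hq, hle⟩ hqz
  exact Set.disjoint_left.1 hd (this ha) ⟨1, 1, fun h => hzp.ne_top ((Ideal.eq_top_iff_one _).2 h),
    by simp⟩

/-- the local ring at a minimal prime over `π` is a discrete valuation ring. -/
lemma dvr_of_minimal {O : Type*} [CommRing O] {π : O} {z : Ideal O} [z.IsPrime]
    (hπ : ∀ a, π * a = 0 → a = 0) (hπz : π ∈ z) (h1 : ∀ a ∈ z, OrdGe π z 1 a)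
    (Oz : Type u) [CommRing Oz] [Algebra O Oz] [IsLocalization.AtPrime Oz z] [IsNoetherianRing Oz] :
    ∃ _ : IsDomain Oz, IsDiscreteValuationRing Oz ∧ Irreducible (algebraMap O Oz π) := by
  have hloc : IsLocalRing Oz := IsLocalization.AtPrime.isLocalRing Oz z
  have hnz : ∀ a, algebraMap O Oz π * a = 0 → a = 0 := by
    intro a ha
    obtain ⟨⟨b, s⟩, hb⟩ := IsLocalization.surj z.primeCompl a
    have e1 : algebraMap O Oz (π * b) = 0 := by
      rw [map_mul, ← hb]; simp only; rw [← mul_assoc, ha, zero_mul]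
    obtain ⟨t, ht⟩ := (IsLocalization.map_eq_zero_iff z.primeCompl Oz _).1 e1
    have e2 : (t : O) * b = 0 := hπ _ (by linear_combination ht)
    have e3 : algebraMap O Oz b = 0 := (IsLocalization.map_eq_zero_iff z.primeCompl Oz _).2 ⟨t, e2⟩
    rw [e3] at hb
    exact (IsLocalization.map_units Oz s).mul_left_eq_zero.1 hb
  have hmax : IsLocalRing.maximalIdeal Oz = Ideal.span {algebraMap O Oz π} := by
    apply le_antisymm
    · intro a ha
      obtain ⟨⟨b, s⟩, hb⟩ := IsLocalization.surj z.primeCompl a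
      have hbz : b ∈ z := by
        rw [← IsLocalization.AtPrime.to_map_mem_maximal_iff Oz z, ← hb]
        exact Ideal.mul_mem_right _ _ ha
      obtain ⟨t, ht, c, hc⟩ := h1 b hbz
      rw [Ideal.mem_span_singleton]
      have hu : IsUnit (algebraMap O Oz t * algebraMap O Oz s) :=
        (IsLocalization.map_units Oz (⟨t, ht⟩ : z.primeCompl)).mul (IsLocalization.map_units Oz s)
      rw [← hu.dvd_mul_left]
      refine ⟨algebraMap O Oz c, ?_⟩
      rw [mul_assoc, mul_comm (algebraMap O Oz s), hb, ← map_mul, hc, map_mul, pow_one]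
    · rw [Ideal.span_singleton_le_iff_mem, IsLocalization.AtPrime.to_map_mem_maximal_iff Oz z]
      exact hπz
  -- domain
  have hne : algebraMap O Oz π ≠ 0 := fun h0 => by
    have := hnz 1 (by rw [h0, zero_mul]); exact one_ne_zero this
  have hdom : IsDomain Oz := by
    have hfac : ∀ a : Oz, a ≠ 0 → ∃ (n : ℕ) (u : Oz), IsUnit u ∧ a = algebraMap O Oz π ^ n * u := by
      intro a ha
      have hfin : FiniteMultiplicity (algebraMap O Oz π) a := by
        by_contra hcon
        apply ha
        have hk := Ideal.iInf_pow_eq_bot_of_isLocalRing (IsLocalRing.maximalIdeal Oz)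
          (IsLocalRing.maximalIdeal.isMaximal Oz).ne_top
        rw [← Ideal.mem_bot, ← hk, Ideal.mem_iInf]
        intro n
        rw [hmax, Ideal.span_singleton_pow, Ideal.mem_span_singleton]
        exact FiniteMultiplicity.not_iff_forall.1 hcon n
      obtain ⟨c, hc, hc2⟩ := hfin.exists_eq_pow_mul_and_not_dvd
      refine ⟨_, c, ?_, hc⟩
      by_contra hu
      apply hc2
      rw [← Ideal.mem_span_singleton, ← hmax]
      exact (IsLocalRing.mem_maximalIdeal _).2 hu
    have hpow : ∀ n : ℕ, ∀ a, algebraMap O Oz π ^ n * a = 0 → a = 0 := by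
      intro n
      induction n with
      | zero => intro a h; simpa using h
      | succ n ih => intro a e; apply hnz; apply ih; rw [← e]; ring
    have : NoZeroDivisors Oz := ⟨by
      intro a b hab
      by_contra hcon
      push Not at hcon
      obtain ⟨n, u, hu, rfl⟩ := hfac a hcon.1
      rw [mul_assoc] at hab
      exact hcon.2 (hu.mul_right_eq_zero.1 (hpow _ _ hab))⟩
    exact NoZeroDivisors.to_isDomain Oz
  have hfield : ¬ IsField Oz := by
    rw [IsLocalRing.isField_iff_maximalIdeal_eq, hmax, Ideal.span_singleton_eq_bot]; exact hne
  have hdvr : IsDiscreteValuationRing Oz :=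
    ((IsDiscreteValuationRing.TFAE Oz hfield).out 4 0).1 (by rw [hmax]; exact ⟨⟨_, rfl⟩⟩)
  refine ⟨hdom, hdvr, ?_⟩
  exact (IsDiscreteValuationRing.irreducible_iff_uniformizer _).2 hmax

lemma elemOrd_of_ordEx {O : Type*} [CommRing O] {π : O} {z : Ideal O} [z.IsPrime]
    (hπ : ∀ a, π * a = 0 → a = 0) (hπz : π ∈ z) (h1 : ∀ a ∈ z, OrdGe π z 1 a)
    (Oz : Type u) [CommRing Oz] [Algebra O Oz] [IsLocalization.AtPrime Oz z] [IsNoetherianRing Oz]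
    {a : O} {n : ℕ} (ha : OrdEx π z n a) : elemOrd Oz (algebraMap O Oz a) n := by
  obtain ⟨_, _, hirr⟩ := dvr_of_minimal hπ hπz h1 Oz
  obtain ⟨s, t, hs, ht, e⟩ := ha
  have us := IsLocalization.map_units Oz (⟨s, hs⟩ : z.primeCompl)
  have ut := IsLocalization.map_units Oz (⟨t, ht⟩ : z.primeCompl)
  refine elemOrd_assoc ?_ (elemOrd_dvr_pow hirr n)
  have e' : algebraMap O Oz s * algebraMap O Oz a = algebraMap O Oz π ^ n * algebraMap O Oz t := by
    rw [← map_mul, e, map_mul, map_pow]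
  refine (associated_mul_unit_right _ _ ut).trans ?_
  rw [← e']
  exact associated_unit_mul_left _ _ us

/-- normal local noetherian domain whose maximal ideal is a colon ideal is a DVR -/
lemma dvr_of_colon {R : Type*} [CommRing R] [IsDomain R] [IsLocalRing R] [IsNoetherianRing R]
    [IsIntegrallyClosed R] {a b : R} (ha₂ : a ≠ 0) (ha₁ : a ∈ IsLocalRing.maximalIdeal R)
    (hb₂ : b ∉ Ideal.span {a})
    (hb₃ : ∀ m ∈ IsLocalRing.maximalIdeal R, ∃ k : R, k * a = b * m) :
    IsDiscreteValuationRing R := by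
  classical
  have hfield : ¬ IsField R := by
    rw [IsLocalRing.isField_iff_maximalIdeal_eq]
    intro h
    rw [h] at ha₁
    exact ha₂ ha₁
  refine ((IsDiscreteValuationRing.TFAE R hfield).out 4 0).1 ?_
  have hb₄ : b ≠ 0 := by rintro rfl; apply hb₂; exact zero_mem _
  let K := FractionRing R
  let x : K := algebraMap R K b / algebraMap R K a
  let M := Submodule.map (Algebra.linearMap R K) (IsLocalRing.maximalIdeal R)
  have ha₃ : algebraMap R K a ≠ 0 := IsFractionRing.to_map_eq_zero_iff.not.mpr ha₂
  by_cases hx : ∀ y ∈ M, x * y ∈ M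
  · have := isIntegral_of_smul_mem_submodule M ?_ ?_ x hx
    · obtain ⟨y, e⟩ := IsIntegrallyClosed.algebraMap_eq_of_integral this
      refine (hb₂ (Ideal.mem_span_singleton'.mpr ⟨y, ?_⟩)).elim
      apply IsFractionRing.injective R K
      rw [map_mul, e, div_mul_cancel₀ _ ha₃]
    · rw [Submodule.ne_bot_iff]; refine ⟨_, ⟨a, ha₁, rfl⟩, ?_⟩
      exact (IsFractionRing.to_map_eq_zero_iff (K := K)).not.mpr ha₂
    · apply Submodule.FG.map; exact IsNoetherian.noetherian _
  · have :
        (M.map (DistribSMul.toLinearMap R K x)).comap (Algebra.linearMap R K) = ⊤ := by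
      contrapose! hx with h
      rintro m' ⟨m, hm, rfl : algebraMap R K m = m'⟩
      obtain ⟨k, hk⟩ := hb₃ m hm
      have hk' : x * algebraMap R K m = algebraMap R K k := by
        rw [← mul_div_right_comm, ← map_mul, ← hk, map_mul, mul_div_cancel_right₀ _ ha₃]
      exact ⟨k, IsLocalRing.le_maximalIdeal h ⟨_, ⟨_, hm, rfl⟩, hk'⟩, hk'.symm⟩
    obtain ⟨y, hy₁, hy₂⟩ : ∃ y ∈ IsLocalRing.maximalIdeal R, b * y = a := by
      rw [Ideal.eq_top_iff_one, Submodule.mem_comap] at this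
      obtain ⟨_, ⟨y, hy, rfl⟩, hy' : x * algebraMap R K y = algebraMap R K 1⟩ := this
      rw [map_one, ← mul_div_right_comm, div_eq_one_iff_eq ha₃, ← map_mul] at hy'
      exact ⟨y, hy, IsFractionRing.injective R K hy'⟩
    refine ⟨⟨y, ?_⟩⟩
    apply le_antisymm
    · intro m hm; obtain ⟨k, hk⟩ := hb₃ m hm; rw [← hy₂, mul_comm, mul_assoc] at hk
      rw [← mul_left_cancel₀ hb₄ hk, mul_comm]; exact Ideal.mem_span_singleton'.mpr ⟨_, rfl⟩
    · rwa [Submodule.span_le, Set.singleton_subset_iff]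

/-- Hartogs-type extension. -/
theorem hartogs {O : Type u} [CommRing O] [IsDomain O] [IsNoetherianRing O] (π h1 h2 : O)
    (h20 : h2 ≠ 0)
    (hn : ∀ (q : Ideal O) [q.IsPrime], π ∉ q → IsIntegrallyClosed (Localization.AtPrime q))
    (hd : ∀ (q : Ideal O) [q.IsPrime], π ∉ q → IsDiscreteValuationRing (Localization.AtPrime q) →
      algebraMap O (Localization.AtPrime q) h2 ∣ algebraMap O (Localization.AtPrime q) h1) :
    ∃ N : ℕ, h2 ∣ h1 * π ^ N := by
  classical
  by_contra hcon
  push Not at hcon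
  -- stabilise
  let J : ℕ →o Ideal O := ⟨fun N => (Ideal.span {h2}).colon {h1 * π ^ N}, by
    intro N M hNM r hr
    rw [Submodule.mem_colon_singleton, smul_eq_mul, Ideal.mem_span_singleton] at hr ⊢
    obtain ⟨j, rfl⟩ := Nat.exists_eq_add_of_le hNM
    rw [pow_add, ← mul_assoc, ← mul_assoc]
    exact Dvd.dvd.mul_right (by rw [mul_assoc]; exact hr) _⟩
  obtain ⟨N, hN⟩ := monotone_stabilizes_iff_noetherian.2 ‹IsNoetherianRing O› J
  have memJ : ∀ N r, r ∈ J N ↔ h2 ∣ r * (h1 * π ^ N) := by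
    intro N r
    change r ∈ (Ideal.span {h2}).colon {h1 * π ^ N} ↔ _
    rw [Submodule.mem_colon_singleton, smul_eq_mul, Ideal.mem_span_singleton]
  have hsat : ∀ r, h2 ∣ π * r * (h1 * π ^ N) → h2 ∣ r * (h1 * π ^ N) := by
    intro r hr
    rw [← memJ, hN (N + 1) (Nat.le_succ N), memJ]
    convert hr using 1; ring
  -- associated prime of O/J
  have hne : (Ideal.Quotient.mk (Ideal.span {h2})) (h1 * π ^ N) ≠ 0 := by
    rw [Ne, Ideal.Quotient.eq_zero_iff_mem, Ideal.mem_span_singleton]; exact hcon N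
  have hassoc : ∃ c : O, (((Ideal.span {h2}).colon {c * (h1 * π ^ N)} : Ideal O)).IsPrime := by
    have hne' : (Ideal.Quotient.mk (J N)) 1 ≠ 0 := by
      rw [Ne, Ideal.Quotient.eq_zero_iff_mem, memJ, one_mul]; exact hcon N
    obtain ⟨P, hP, -⟩ := exists_le_isAssociatedPrime_of_isNoetherianRing (R := O) (M := O ⧸ J N) _ hne'
    rw [isAssociatedPrime_iff] at hP
    obtain ⟨hP, c, rfl⟩ := hP
    obtain ⟨c, rfl⟩ := Ideal.Quotient.mk_surjective c
    refine ⟨c, ?_⟩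
    convert hP using 1
    ext r
    rw [Submodule.mem_colon_singleton, smul_eq_mul, Ideal.mem_span_singleton,
      Submodule.mem_colon_singleton, Submodule.mem_bot, ← mul_assoc, ← memJ,
      ← Ideal.Quotient.eq_zero_iff_mem, Algebra.smul_def]
    rfl
  obtain ⟨c, hP⟩ := hassoc
  set d := c * (h1 * π ^ N) with hdd
  set P : Ideal O := (Ideal.span {h2}).colon {d} with hPP
  have memP : ∀ r, r ∈ P ↔ h2 ∣ r * d := by
    intro r
    rw [hPP, Submodule.mem_colon_singleton, smul_eq_mul, Ideal.mem_span_singleton]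
  have hπP : π ∉ P := by
    intro hmem
    rw [memP, hdd, ← mul_assoc] at hmem
    have := hsat _ hmem
    apply hP.ne_top
    rw [Ideal.eq_top_iff_one, memP, one_mul]; exact this
  let OP := Localization.AtPrime P
  have : IsIntegrallyClosed OP := hn P hπP
  have : IsNoetherianRing OP := IsLocalization.isNoetherianRing P.primeCompl OP inferInstance
  have hinj : Function.Injective (algebraMap O OP) :=
    IsLocalization.injective OP P.primeCompl_le_nonZeroDivisors
  have hnd : ∀ s r : O, s ∉ P → algebraMap O OP h2 ∣ algebraMap O OP r → (∃ t, t ∉ P ∧ h2 ∣ t * r) := by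
    rintro s r - ⟨w, hw⟩
    obtain ⟨⟨w', t⟩, ht⟩ := IsLocalization.surj P.primeCompl w
    refine ⟨t, t.2, w', ?_⟩
    apply hinj
    rw [map_mul, map_mul, hw, ← ht]; ring
  have hdvr : IsDiscreteValuationRing OP := by
    refine dvr_of_colon (a := algebraMap O OP h2) (b := algebraMap O OP d) ?_ ?_ ?_ ?_
    · exact fun h => h20 (hinj (by rw [h, map_zero]))
    · rw [IsLocalization.AtPrime.to_map_mem_maximal_iff OP P, memP]; exact dvd_mul_right _ _
    · rw [Ideal.mem_span_singleton]
      intro h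
      obtain ⟨t, ht, h3⟩ := hnd 1 d (fun h => hP.ne_top ((Ideal.eq_top_iff_one _).2 h)) h
      exact ht ((memP t).2 h3)
    · intro m hm
      obtain ⟨⟨r, t⟩, hr⟩ := IsLocalization.surj P.primeCompl m
      have : r ∈ P := by
        rw [← IsLocalization.AtPrime.to_map_mem_maximal_iff OP P, ← hr]
        exact Ideal.mul_mem_right _ _ hm
      obtain ⟨w, hw⟩ := (memP r).1 this
      obtain ⟨v, hv⟩ := (IsLocalization.map_units OP t).exists_right_inv
      refine ⟨algebraMap O OP w * v, ?_⟩
      have hw' : algebraMap O OP r * algebraMap O OP d = algebraMap O OP h2 * algebraMap O OP w := by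
        rw [← map_mul, hw, map_mul]
      simp only at hr
      linear_combination -v * hw' - v * algebraMap O OP d * hr + m * algebraMap O OP d * hv
  obtain ⟨t, ht, h3⟩ := hnd 1 h1 (fun h => hP.ne_top ((Ideal.eq_top_iff_one _).2 h)) (hd P hπP hdvr)
  apply ht
  rw [memP, hdd, show t * (c * (h1 * π ^ N)) = (t * h1) * (c * π ^ N) by ring]
  exact h3.mul_right _

/-- Lemma L -/
theorem isDomain_of_generic {O : Type u} [CommRing O] [IsLocalRing O] [IsNoetherianRing O] (π : O)
    (hπ : ∀ a, π * a = 0 → a = 0) (hrad : ∀ (a : O) (n : ℕ), π ∣ a ^ n → π ∣ a)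
    (hd : ∀ (q : Ideal O) [q.IsPrime], π ∉ q → IsDomain (Localization.AtPrime q)) : IsDomain O := by
  classical
  have hpow : ∀ n : ℕ, ∀ a, π ^ n * a = 0 → a = 0 := by
    intro n
    induction n with
    | zero => intro a h; simpa using h
    | succ n ih => intro a e; apply hπ; apply ih; rw [← e]; ring
  have : NoZeroDivisors O := ⟨by
    intro a b hab
    set J : Ideal O := (⊥ : Ideal O).colon {a} with hJ
    have memJ : ∀ r, r ∈ J ↔ r * a = 0 := by
      intro r; rw [hJ, Submodule.mem_colon_singleton, smul_eq_mul, Ideal.mem_bot]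
    set K : Ideal O := J.annihilator with hK
    have memK : ∀ r, r ∈ K ↔ ∀ j ∈ J, r * j = 0 := by
      intro r; rw [hK, Submodule.mem_annihilator]; rfl
    have hrad2 : π ∈ (J ⊔ K).radical := by
      rw [Ideal.radical_eq_sInf, Ideal.mem_sInf]
      rintro q ⟨hle, hq⟩
      by_contra hπq
      have hdom := hd q hπq
      by_cases ha : algebraMap O (Localization.AtPrime q) a = 0
      · obtain ⟨t, ht⟩ := (IsLocalization.map_eq_zero_iff q.primeCompl _ _).1 ha
        exact t.2 (hle (Ideal.mem_sup_left ((memJ _).2 ht)))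
      · have hex : ∀ j ∈ J, ∃ s, s ∉ q ∧ s * j = 0 := by
          intro j hj
          have e : algebraMap O (Localization.AtPrime q) j * algebraMap O _ a = 0 := by
            rw [← map_mul, (memJ j).1 hj, map_zero]
          have e2 := (mul_eq_zero.1 e).resolve_right ha
          obtain ⟨t, ht⟩ := (IsLocalization.map_eq_zero_iff q.primeCompl _ _).1 e2
          exact ⟨t, t.2, ht⟩
        obtain ⟨T, hT⟩ : J.FG := IsNoetherian.noetherian J
        have hTJ : ∀ j ∈ T, j ∈ J := fun j hj => hT ▸ Ideal.subset_span hj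
        choose! s hs1 hs2 using hex
        have hsK : ∏ j ∈ T, s j ∈ K := by
          rw [memK]
          have hle : J ≤ (⊥ : Ideal O).colon {∏ j ∈ T, s j} := by
            conv_lhs => rw [← hT]
            refine Ideal.span_le.2 fun j hj => ?_
            rw [SetLike.mem_coe, Submodule.mem_colon_singleton, smul_eq_mul, Ideal.mem_bot,
              ← Finset.mul_prod_erase _ _ hj, ← mul_assoc, mul_comm j, hs2 j (hTJ j hj), zero_mul]
          intro j hj
          have := hle hj
          rw [Submodule.mem_colon_singleton, smul_eq_mul, Ideal.mem_bot] at this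
          rw [mul_comm]; exact this
        obtain ⟨j, hj, hj2⟩ := hq.prod_mem_iff.1 (hle (Ideal.mem_sup_right hsK))
        exact hs1 j (hTJ j hj) hj2
    obtain ⟨n, hn⟩ := hrad2
    obtain ⟨e, he, f, hf, hef⟩ := Submodule.mem_sup.1 hn
    have hfe : f * e = 0 := (memK f).1 hf e he
    have hee : e * e = π ^ n * e := by rw [← hef]; linear_combination -hfe
    have hdvd : ∀ i ≤ n, π ^ i ∣ e := by
      intro i
      induction i with
      | zero => intro _; simp
      | succ i ih =>
        intro hi
        obtain ⟨c, hc⟩ := ih (by omega)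
        obtain ⟨j, rfl⟩ := Nat.exists_eq_add_of_lt (show i < n by omega)
        have : π ∣ c := by
          apply hrad c 2
          refine ⟨π ^ j * c, ?_⟩
          rw [← sub_eq_zero]
          apply hpow (2 * i)
          rw [hc] at hee
          linear_combination hee
        rw [hc, pow_succ]; exact mul_dvd_mul_left _ this
    obtain ⟨c, hc⟩ := hdvd n le_rfl
    have hcc : c * c = c := by
      rw [← sub_eq_zero]; apply hpow (2 * n)
      rw [hc] at hee
      linear_combination hee
    have hcu : c = 0 ∨ c = 1 := by
      rcases IsLocalRing.isUnit_or_isUnit_one_sub_self c with hu | hu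
      · right; apply hu.mul_left_cancel; rw [hcc, mul_one]
      · left; apply hu.mul_left_cancel; linear_combination -hcc
    rcases hcu with rfl | rfl
    · right
      have : f = π ^ n := by rw [← hef, hc]; ring
      apply hpow n
      rw [← this]
      exact (memK f).1 hf b ((memJ b).2 (by rw [mul_comm]; exact hab))
    · left
      apply hpow n
      have := (memJ e).1 he
      rw [hc, mul_one] at this
      exact this⟩
  exact NoZeroDivisors.to_isDomain O


lemma etale_quot {P E : Type*} [CommRing P] [CommRing E] [Algebra P E] [Algebra.Etale P E]
    (I : Ideal P) : Algebra.Etale (P ⧸ I) (E ⧸ I.map (algebraMap P E)) :=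
  Algebra.Etale.of_equiv (Algebra.TensorProduct.quotIdealMapEquivQuotTensor E I).symm

/-- localization commutes with quotients -/
lemma quot_loc {E O : Type*} [CommRing E] [CommRing O] [Algebra E O] (J q : Ideal E) [q.IsPrime]
    [IsLocalization.AtPrime O q] (hJ : J ≤ q) (f : (E ⧸ J) →+* (O ⧸ J.map (algebraMap E O)))
    (hf : f.comp (Ideal.Quotient.mk J) = (Ideal.Quotient.mk _).comp (algebraMap E O)) :
    ∃ _ : (q.map (Ideal.Quotient.mk J)).IsPrime,
      @IsLocalization.AtPrime _ _ (O ⧸ J.map (algebraMap E O)) _ f.toAlgebra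
        (q.map (Ideal.Quotient.mk J)) _ := by
  have hp : (q.map (Ideal.Quotient.mk J)).IsPrime :=
    Ideal.map_isPrime_of_surjective Ideal.Quotient.mk_surjective (by simpa using hJ)
  refine ⟨hp, ?_⟩
  letI := f.toAlgebra
  have h := IsLocalization.of_surjective (S := O) q.primeCompl (Ideal.Quotient.mk J)
    Ideal.Quotient.mk_surjective (Ideal.Quotient.mk (J.map (algebraMap E O)))
    Ideal.Quotient.mk_surjective (by rw [RingHom.algebraMap_toAlgebra, hf]) (by simp)
  have e : q.primeCompl.map (Ideal.Quotient.mk J) = (q.map (Ideal.Quotient.mk J)).primeCompl := by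
    have hc : (q.map (Ideal.Quotient.mk J)).comap (Ideal.Quotient.mk J) = q := by
      rw [Ideal.comap_map_of_surjective _ Ideal.Quotient.mk_surjective]
      simpa [← RingHom.ker_eq_comap_bot] using hJ
    ext z
    obtain ⟨z, rfl⟩ := Ideal.Quotient.mk_surjective z
    constructor
    · rintro ⟨y, hy, e⟩ hz
      rw [← e] at hz
      exact hy (by rw [← hc]; exact hz)
    · intro hz
      refine ⟨z, fun h => hz ?_, rfl⟩
      exact Ideal.mem_map_of_mem _ h
  rw [IsLocalization.AtPrime]
  rw [e] at h
  exact h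

lemma quot_local_normal {P E O : Type*} [CommRing P] [CommRing E] [Algebra P E] [Algebra.Etale P E]
    [CommRing O] [Algebra E O] [Algebra P O] [IsScalarTower P E O]
    (q : Ideal E) [q.IsPrime] [IsLocalization.AtPrime O q] (I : Ideal P) [IsDomain (P ⧸ I)]
    [IsIntegrallyClosed (P ⧸ I)] (hI : I.map (algebraMap P E) ≤ q) :
    (I.map (algebraMap P O)).IsPrime ∧
      ∀ r ∉ I, algebraMap P O r ∉ I.map (algebraMap P O) := by
  have := etale_quot (E := E) I
  set J := I.map (algebraMap P E) with hJ
  have hJO : I.map (algebraMap P O) = J.map (algebraMap E O) := by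
    rw [hJ, Ideal.map_map, ← IsScalarTower.algebraMap_eq]
  let f : (E ⧸ J) →+* (O ⧸ J.map (algebraMap E O)) :=
    Ideal.quotientMap _ (algebraMap E O) Ideal.le_comap_map
  obtain ⟨hp, hl⟩ := quot_loc (O := O) J q hI f (by ext; simp [f])
  letI := f.toAlgebra
  obtain ⟨h1, h2⟩ := etale_local_normal (P := P ⧸ I) (E := E ⧸ J) (O := O ⧸ J.map (algebraMap E O))
    (q.map (Ideal.Quotient.mk J))
  rw [hJO]
  refine ⟨(Ideal.Quotient.isDomain_iff_prime _).1 h1, fun r hr hrm => hr ?_⟩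
  letI : Algebra (P ⧸ I) (O ⧸ J.map (algebraMap E O)) :=
    (f.comp (algebraMap (P ⧸ I) (E ⧸ J))).toAlgebra
  haveI : IsScalarTower (P ⧸ I) (E ⧸ J) (O ⧸ J.map (algebraMap E O)) :=
    IsScalarTower.of_algebraMap_eq' rfl
  have : Module.Flat (E ⧸ J) (O ⧸ J.map (algebraMap E O)) :=
    IsLocalization.flat _ (q.map (Ideal.Quotient.mk J)).primeCompl
  have : Module.Flat (P ⧸ I) (O ⧸ J.map (algebraMap E O)) := Module.Flat.trans _ (E ⧸ J) _
  have hinj : Function.Injective (algebraMap (P ⧸ I) (O ⧸ J.map (algebraMap E O))) := by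
    rw [injective_iff_map_eq_zero]
    intro a ha
    by_contra hne
    have := Module.Flat.isSMulRegular_of_isRegular (R := P ⧸ I)
      (M := O ⧸ J.map (algebraMap E O)) (isRegular_of_ne_zero hne)
    have h0 : (1 : O ⧸ J.map (algebraMap E O)) = 0 := by
      apply this
      simp only [smul_zero]
      rw [Algebra.smul_def, ha, zero_mul]
    exact one_ne_zero h0
  rw [← Ideal.Quotient.eq_zero_iff_mem]
  apply hinj
  rw [map_zero]
  change f (algebraMap (P ⧸ I) (E ⧸ J) (Ideal.Quotient.mk I r)) = 0
  have : algebraMap (P ⧸ I) (E ⧸ J) (Ideal.Quotient.mk I r) = Ideal.Quotient.mk J (algebraMap P E r) := rfl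
  rw [this]
  change Ideal.Quotient.mk _ (algebraMap E O (algebraMap P E r)) = 0
  rw [Ideal.Quotient.eq_zero_iff_mem, ← IsScalarTower.algebraMap_apply]
  exact hrm


section std
open MvPolynomial

variable {K : Type u} [CommRing K] {n l : ℕ} {c : K}

lemma std_prod : (∏ i : Fin n, if (i : ℕ) < l then stdCoord K n l c i else 1) =
    algebraMap K (stdRing K n l c) c := by
  have h : Ideal.Quotient.mk (Ideal.span {(∏ i : Fin n, if (i : ℕ) < l then X i else 1) - C c})
      ((∏ i : Fin n, if (i : ℕ) < l then X i else 1) - C c) = 0 :=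
    Ideal.Quotient.eq_zero_iff_mem.2 (Ideal.subset_span rfl)
  rw [map_sub, map_prod, sub_eq_zero] at h
  refine Eq.trans ?_ h
  refine Finset.prod_congr rfl fun i _ => ?_
  split_ifs <;> simp [stdCoord]

/-- maps out of the standard ring -/
def stdLift {B : Type*} [CommRing B] (g : K →+* B) (y : Fin n → B)
    (h : (∏ i : Fin n, if (i : ℕ) < l then y i else 1) = g c) : stdRing K n l c →+* B :=
  Ideal.Quotient.lift _ (eval₂Hom g y) (by
    intro a ha
    obtain ⟨d, rfl⟩ := Ideal.mem_span_singleton.1 ha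
    rw [map_mul, map_sub, map_prod]
    have : (∏ i : Fin n, eval₂Hom g y (if (i : ℕ) < l then X i else 1)) = g c := by
      rw [← h]
      refine Finset.prod_congr rfl fun i _ => ?_
      split_ifs <;> simp
    rw [this]; simp)

@[simp] lemma stdLift_coord {B : Type*} [CommRing B] (g : K →+* B) (y : Fin n → B) (h) (i : Fin n) :
    stdLift (l := l) (c := c) g y h (stdCoord K n l c i) = y i := by
  simp [stdLift, stdCoord]

@[simp] lemma stdLift_algebraMap {B : Type*} [CommRing B] (g : K →+* B) (y : Fin n → B) (h) (r : K) :
    stdLift (l := l) (c := c) g y h (algebraMap K _ r) = g r := by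
  change eval₂Hom g y (C r) = g r
  simp

lemma std_hom_ext {B : Type*} [Semiring B] {f g : stdRing K n l c →+* B}
    (h1 : ∀ r, f (algebraMap K _ r) = g (algebraMap K _ r))
    (h2 : ∀ i, f (stdCoord K n l c i) = g (stdCoord K n l c i)) : f = g := by
  apply Ideal.Quotient.ringHom_ext
  apply MvPolynomial.ringHom_ext
  · exact h1
  · exact h2

/-- the ideal generated by an ideal of the base and some coordinates -/
def stdI (n l : ℕ) (c : K) (I : Ideal K) (S : Set (Fin n)) : Ideal (stdRing K n l c) :=
  I.map (algebraMap K _) ⊔ Ideal.span (stdCoord K n l c '' S)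

lemma stdI_quot (I : Ideal K) (S : Set (Fin n)) (hc : c ∈ I) (s : Fin n) (hs : s ∈ S)
    (hsl : (s : ℕ) < l) :
    ∃ φ : stdRing K n l c →+* MvPolynomial {j // j ∉ S} (K ⧸ I), Function.Surjective φ ∧
      RingHom.ker φ = stdI n l c I S ∧ (∀ j (hj : j ∉ S), φ (stdCoord K n l c j) = X ⟨j, hj⟩) ∧
      (∀ r, φ (algebraMap K _ r) = C (Ideal.Quotient.mk I r)) := by
  classical
  let y : Fin n → MvPolynomial {j // j ∉ S} (K ⧸ I) := fun j => if h : j ∉ S then X ⟨j, h⟩ else 0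
  have hy : (∏ i : Fin n, if (i : ℕ) < l then y i else 1) = (C.comp (Ideal.Quotient.mk I)) c := by
    rw [Finset.prod_eq_zero (Finset.mem_univ s) (by simp [hsl, y, hs]), RingHom.comp_apply,
      Ideal.Quotient.eq_zero_iff_mem.2 hc, map_zero]
  let φ := stdLift (l := l) (c := c) (C.comp (Ideal.Quotient.mk I)) y hy
  have h1 : ∀ j (hj : j ∉ S), φ (stdCoord K n l c j) = X ⟨j, hj⟩ := by
    intro j hj; simp only [φ, stdLift_coord, y, dif_pos hj]
  have h2 : ∀ r, φ (algebraMap K _ r) = C (Ideal.Quotient.mk I r) := by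
    intro r; simp only [φ, stdLift_algebraMap]; rfl
  refine ⟨φ, ?_, ?_, h1, h2⟩
  · rw [← RingHom.range_eq_top, eq_top_iff]
    rintro p -
    induction p using MvPolynomial.induction_on with
    | C a =>
      obtain ⟨a, rfl⟩ := Ideal.Quotient.mk_surjective a
      exact ⟨_, h2 a⟩
    | add p q hp hq => exact add_mem hp hq
    | mul_X p j hp => exact mul_mem hp ⟨_, h1 j.1 j.2⟩
  · apply le_antisymm
    · let g : K ⧸ I →+* stdRing K n l c ⧸ stdI n l c I S :=
        Ideal.Quotient.lift I ((Ideal.Quotient.mk _).comp (algebraMap K _)) (by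
          intro a ha
          rw [RingHom.comp_apply, Ideal.Quotient.eq_zero_iff_mem]
          exact Ideal.mem_sup_left (Ideal.mem_map_of_mem _ ha))
      let θ : MvPolynomial {j // j ∉ S} (K ⧸ I) →+* stdRing K n l c ⧸ stdI n l c I S :=
        eval₂Hom g fun j => Ideal.Quotient.mk _ (stdCoord K n l c j.1)
      have : θ.comp φ = Ideal.Quotient.mk _ := by
        refine std_hom_ext (K := K) (n := n) (l := l) (c := c) (f := θ.comp φ) ?_ ?_
        · intro r
          rw [RingHom.comp_apply, h2]
          simp only [θ, eval₂Hom_C, g]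
          rfl
        · intro j
          by_cases hj : j ∈ S
          · rw [RingHom.comp_apply]
            simp only [φ, stdLift_coord, y, hj, not_true, dite_false, map_zero]
            symm
            rw [Ideal.Quotient.eq_zero_iff_mem]
            exact Ideal.mem_sup_right (Ideal.subset_span ⟨j, hj, rfl⟩)
          · rw [RingHom.comp_apply, h1 j hj]
            simp [θ]
      intro a ha
      rw [← Ideal.Quotient.eq_zero_iff_mem, ← this, RingHom.comp_apply, (RingHom.mem_ker).1 ha,
        map_zero]
    · refine sup_le ?_ ?_
      · rw [Ideal.map_le_iff_le_comap]
        intro r hr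
        change φ _ = 0
        rw [h2, Ideal.Quotient.eq_zero_iff_mem.2 hr, map_zero]
      · rw [Ideal.span_le]
        rintro _ ⟨j, hj, rfl⟩
        change φ _ = 0
        simp [φ, y, hj]

lemma stdI_normal (I : Ideal K) (hI : I.IsMaximal) (S : Set (Fin n)) (hc : c ∈ I) (s : Fin n)
    (hs : s ∈ S) (hsl : (s : ℕ) < l) :
    (∃ _ : IsDomain (stdRing K n l c ⧸ stdI n l c I S),
      IsIntegrallyClosed (stdRing K n l c ⧸ stdI n l c I S)) ∧
    ∀ j ∉ S, stdCoord K n l c j ∉ stdI n l c I S := by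
  obtain ⟨φ, h1, h2, h3, h4⟩ := stdI_quot (l := l) I S hc s hs hsl
  letI := Ideal.Quotient.field I
  constructor
  · rw [← h2]
    let e := RingHom.quotientKerEquivOfSurjective h1
    have hd : IsDomain (stdRing K n l c ⧸ RingHom.ker φ) := e.toMulEquiv.isDomain _
    exact ⟨hd, IsIntegrallyClosed.of_equiv e.symm⟩
  · intro j hj hm
    rw [← h2, RingHom.mem_ker, h3 j hj] at hm
    exact X_ne_zero _ hm

/-- local rings of étale algebras over the standard ring -/
lemma std_local {E O : Type u} [CommRing E] [Algebra (stdRing K n l c) E]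
    [Algebra.Etale (stdRing K n l c) E] [CommRing O] [Algebra E O] [Algebra (stdRing K n l c) O]
    [IsScalarTower (stdRing K n l c) E O] (q : Ideal E) [q.IsPrime] [IsLocalization.AtPrime O q]
    (I : Ideal K) (hI : I.IsMaximal) (S : Set (Fin n)) (hc : c ∈ I) (s : Fin n)
    (hs : s ∈ S) (hsl : (s : ℕ) < l)
    (hIq : ∀ r ∈ I, algebraMap (stdRing K n l c) E (algebraMap K _ r) ∈ q)
    (hSq : ∀ j ∈ S, algebraMap (stdRing K n l c) E (stdCoord K n l c j) ∈ q) :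
    ((stdI n l c I S).map (algebraMap _ O)).IsPrime ∧
      ∀ j ∉ S, algebraMap _ O (stdCoord K n l c j) ∉ (stdI n l c I S).map (algebraMap _ O) := by
  obtain ⟨⟨h1, h2⟩, h3⟩ := stdI_normal (l := l) I hI S hc s hs hsl
  obtain ⟨h4, h5⟩ := quot_local_normal (O := O) q (stdI n l c I S) (by
    rw [stdI, Ideal.map_sup, Ideal.map_map]
    refine sup_le ?_ ?_
    · rw [Ideal.map_le_iff_le_comap]; intro r hr; exact hIq r hr
    · rw [Ideal.map_span, Ideal.span_le]
      rintro _ ⟨_, ⟨j, hj, rfl⟩, rfl⟩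
      exact hSq j hj)
  exact ⟨h4, fun j hj => h5 _ (h3 j hj)⟩

end std


open TensorProduct in
lemma flat_descent_source {C B E : Type*} [CommRing C] [CommRing B] [CommRing E] [Algebra C B]
    [Algebra B E] [Algebra C E] [IsScalarTower C B E] 
    [Module.FaithfullyFlat B E] [Module.Flat C E] : Module.Flat C B := by
  rw [Module.Flat.iff_lTensor_preserves_injective_linearMap]
  intro N N' _ _ _ _ f hf
  have h1 : Function.Injective (f.lTensor E) := Module.Flat.lTensor_preserves_injective_linearMap f hf
  have h2 : Function.Injective ((f.baseChange B).lTensor E) := by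
    have h3 : (f.baseChange E).toFun ∘ (AlgebraTensorModule.cancelBaseChange C B E E N) =
       (AlgebraTensorModule.cancelBaseChange C B E E N') ∘ ((f.baseChange B).lTensor E) := by
      funext x
      induction x with
      | zero => simp
      | add x y hx hy => simp_all
      | tmul a y =>
        induction y with
        | zero => simp
        | add x y hx hy => simp_all [TensorProduct.tmul_add]
        | tmul b n => simp
    have h4 : Function.Injective ((AlgebraTensorModule.cancelBaseChange C B E E N') ∘ ((f.baseChange B).lTensor E)) := by
      rw [← h3]
      exact Function.Injective.comp h1 (LinearEquiv.injective _)
    exact h4.of_comp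
  exact (Module.FaithfullyFlat.lTensor_injective_iff_injective B E _).1 h2
open KaehlerDifferential in
lemma formallyEtale_of_bij {K C O : Type*} [CommRing K] [CommRing C] [CommRing O] [Algebra K C] [Algebra C O] [Algebra K O]
   [IsScalarTower K C O] [Algebra.FormallySmooth K O] (h : Function.Bijective (mapBaseChange K C O)) : 
   Algebra.FormallyEtale C O := by
  have h1 : Subsingleton Ω[O⁄C] := by
    have := KaehlerDifferential.exact_mapBaseChange_map K C O
    refine ⟨fun x y => ?_⟩
    obtain ⟨x, rfl⟩ := KaehlerDifferential.map_surjective K C O x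
    obtain ⟨y, rfl⟩ := KaehlerDifferential.map_surjective K C O y
    obtain ⟨x, rfl⟩ := h.2 x
    obtain ⟨y, rfl⟩ := h.2 y
    rw [this.apply_apply_eq_zero, this.apply_apply_eq_zero]
  have h2 : Subsingleton (Algebra.H1Cotangent C O) := by
    have e1 := Algebra.H1Cotangent.exact_δ_mapBaseChange K C O
    have e2 := Algebra.H1Cotangent.exact_map_δ K C O
    refine subsingleton_of_forall_eq 0 fun x => ?_
    have : Algebra.H1Cotangent.δ K C O x = 0 := h.1 (by rw [e1.apply_apply_eq_zero, map_zero])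
    obtain ⟨y, rfl⟩ := (e2 x).1 this
    rw [Subsingleton.elim y 0, map_zero]
  have : Algebra.FormallyUnramified C O := ⟨h1⟩
  have : Algebra.FormallySmooth C O := (Algebra.formallySmooth_iff ..).2 ⟨inferInstance, h2⟩
  exact Algebra.FormallyEtale.of_formallyUnramified_and_formallySmooth
open KaehlerDifferential in
lemma mapBaseChange_bij {K O κ : Type*} [CommRing K]  [CommRing O]  [Algebra (MvPolynomial κ K) O] [Algebra K O]
   [IsScalarTower K (MvPolynomial κ K) O] (b : Module.Basis κ O Ω[O⁄K]) (hb : ∀ i, b i = D K O (algebraMap _ O (MvPolynomial.X i : MvPolynomial κ K))) : 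
   Function.Bijective (mapBaseChange K (MvPolynomial κ K) O) := by
  let e := ((mvPolynomialBasis K κ).baseChange O).equiv b (Equiv.refl _)
  have : mapBaseChange K (MvPolynomial κ K) O = e.toLinearMap := by
    apply ((mvPolynomialBasis K κ).baseChange O).ext
    intro i
    simp only [LinearEquiv.coe_coe, e]
    rw [Module.Basis.equiv_apply, Module.Basis.baseChange_apply]
    simp [hb, mvPolynomialBasis_apply]
  rw [this]; exact e.bijective

open TensorProduct in
lemma etale_descent_source {C B E : Type u} [CommRing C] [CommRing B] [CommRing E] [Algebra C B]
    [Algebra B E] [Algebra C E] [IsScalarTower C B E] [Algebra.FinitePresentation C B]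
    [Algebra.Etale B E] [Module.FaithfullyFlat B E] [Algebra.Etale C E] : Algebra.Etale C B := by
  have h1 : Module.Flat C E := inferInstance
  have hfl : Module.Flat C B := flat_descent_source (E := E)
  have hun : Algebra.FormallyUnramified C B := by
    constructor
    have : Subsingleton (E ⊗[B] Ω[B⁄C]) :=
      (KaehlerDifferential.tensorKaehlerEquivOfFormallyEtale C B E).subsingleton
    exact Module.FaithfullyFlat.lTensor_reflects_triviality B E _
  exact .of_formallyUnramified_of_flat

open KaehlerDifferential TensorProduct in
lemma smooth_descent_pt {K B E : Type u} [CommRing K] [CommRing B] [CommRing E] [Algebra K B]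
    [Algebra B E] [Algebra K E] [IsScalarTower K B E] [Algebra.FinitePresentation K B]
    [Algebra.Etale B E] (q : Ideal E) [q.IsPrime] (p : Ideal B) [p.IsPrime] (hp : q.comap (algebraMap B E) = p)
    [Algebra.IsSmoothAt K q] : Algebra.IsSmoothAt K p := by
  have : Algebra.FinitePresentation K E := .trans K B E
  let O := Localization.AtPrime q
  have : Algebra.FormallyEtale E O := .of_isLocalization q.primeCompl
  have : Algebra.FormallyEtale B O := .comp B E O
  have hspan : Submodule.span O (Set.range fun b : B => D K O (algebraMap B O b)) = ⊤ := by
    rw [eq_top_iff]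
    rintro x -
    obtain ⟨y, rfl⟩ := (tensorKaehlerEquivOfFormallyEtale K B O).surjective x
    induction y with
    | zero => simp
    | add y z hy hz => rw [map_add]; exact add_mem hy hz
    | tmul a y =>
      rw [tensorKaehlerEquivOfFormallyEtale_apply, mapBaseChange_tmul]
      refine Submodule.smul_mem _ _ ?_
      have hy : y ∈ Submodule.span B (Set.range (D K B)) := by simp [span_range_derivation]
      induction hy using Submodule.span_induction with
      | mem y h => obtain ⟨b, rfl⟩ := h; rw [map_D]; exact Submodule.subset_span ⟨b, rfl⟩
      | zero => simp
      | add y z _ _ hy hz => rw [map_add]; exact add_mem hy hz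
      | smul r y _ hy =>
        rw [map_smul, ← IsScalarTower.algebraMap_smul O r]
        exact Submodule.smul_mem _ _ hy
  have : Algebra.EssFiniteType K O := .comp K E O
  have : Module.FinitePresentation O Ω[O⁄K] := Module.finitePresentation_of_projective _ _
  obtain ⟨κ, a, b, hb⟩ := Module.exists_basis_of_span_of_flat _ hspan
  have : Finite κ := Module.Finite.finite_basis b
  let C := MvPolynomial κ K
  letI : Algebra C B := (MvPolynomial.aeval a).toAlgebra
  haveI : IsScalarTower K C B := .of_algebraMap_eq' (MvPolynomial.aeval a).comp_algebraMap.symm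
  letI : Algebra C E := ((algebraMap B E).comp (algebraMap C B)).toAlgebra
  haveI : IsScalarTower C B E := .of_algebraMap_eq' rfl
  haveI : IsScalarTower K C E := .to₁₂₄ K C B E
  have : Algebra.FinitePresentation C B := .of_restrict_scalars_finitePresentation K C B
  have : Algebra.FinitePresentation C E := .trans C B E
  haveI : IsScalarTower C E O := inferInstance
  haveI : IsScalarTower K C O := .to₁₂₄ K C E O
  have : Algebra.FormallyEtale C O := formallyEtale_of_bij (K := K) (mapBaseChange_bij b (by
    intro i
    rw [hb]
    congr 1
    rw [IsScalarTower.algebraMap_apply C E O, IsScalarTower.algebraMap_apply C B E]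
    change _ = algebraMap E O (algebraMap B E (MvPolynomial.aeval a (MvPolynomial.X i)))
    rw [MvPolynomial.aeval_X, ← IsScalarTower.algebraMap_apply]))
  have : Algebra.IsEtaleAt C q := this
  obtain ⟨g, hg, hE⟩ := Algebra.exists_etale_of_isEtaleAt (R := C) q
  let E1 := Localization.Away g
  have : Algebra.Etale E E1 := .of_isLocalizationAway g
  have : Algebra.Etale B E1 := .comp B E E1
  have hop := PrimeSpectrum.isOpenMap_comap_of_hasGoingDown_of_finitePresentation (R := B) (S := E1)
  have hmem : (⟨p, ‹_›⟩ : PrimeSpectrum B) ∈ Set.range (PrimeSpectrum.comap (algebraMap B E1)) := by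
    have : (⟨q, ‹_›⟩ : PrimeSpectrum E) ∈ Set.range (PrimeSpectrum.comap (algebraMap E E1)) := by
      rw [PrimeSpectrum.localization_away_comap_range E1 g]; exact hg
    obtain ⟨q1, h1⟩ := this
    refine ⟨q1, ?_⟩
    rw [IsScalarTower.algebraMap_eq B E E1, PrimeSpectrum.comap_comp_apply, h1]
    ext1; exact hp
  obtain ⟨_, ⟨f, rfl⟩, hf, hfs⟩ := PrimeSpectrum.isTopologicalBasis_basic_opens.exists_subset_of_mem_open
    hmem hop.isOpen_range
  let B1 := Localization.Away f
  let E2 := Localization.Away (algebraMap B E1 f)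
  letI : Algebra B1 E2 := (IsLocalization.Away.map B1 E2 (algebraMap B E1) f).toAlgebra
  have hBE : (algebraMap B1 E2).comp (algebraMap B B1) = algebraMap B E2 := by
    rw [RingHom.algebraMap_toAlgebra, IsLocalization.Away.map, IsLocalization.map_comp]; rfl
  haveI : IsScalarTower B B1 E2 := .of_algebraMap_eq' hBE.symm
  have : Algebra.Etale E1 E2 := .of_isLocalizationAway (algebraMap B E1 f)
  have : Algebra.Etale B E2 := .comp B E1 E2
  have : Algebra.Etale C E2 := .comp C E1 E2
  have : Algebra.Etale B B1 := .of_isLocalizationAway f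
  have : Algebra.Etale B1 E2 := {
    formallyEtale := Algebra.FormallyEtale.of_restrictScalars (R := B)
    finitePresentation := .of_restrict_scalars_finitePresentation B B1 E2 }
  haveI : IsScalarTower C B1 E2 := .of_algebraMap_eq' (by
    rw [IsScalarTower.algebraMap_eq C B B1, ← RingHom.comp_assoc, hBE]
    rw [IsScalarTower.algebraMap_eq C E1 E2, IsScalarTower.algebraMap_eq B E1 E2, RingHom.comp_assoc]
    congr 1)
  have : Module.FaithfullyFlat B1 E2 := by
    apply Module.FaithfullyFlat.of_comap_surjective
    intro P
    have h1 : PrimeSpectrum.comap (algebraMap B B1) P ∈ (PrimeSpectrum.basicOpen f : Set _) := by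
      rw [← PrimeSpectrum.localization_away_comap_range B1 f]; exact ⟨P, rfl⟩
    obtain ⟨Q1, hQ1⟩ := hfs h1
    have h2 : Q1 ∈ Set.range (PrimeSpectrum.comap (algebraMap E1 E2)) := by
      rw [PrimeSpectrum.localization_away_comap_range E2 (algebraMap B E1 f)]
      rw [← hQ1] at h1
      exact h1
    obtain ⟨Q2, hQ2⟩ := h2
    refine ⟨Q2, ?_⟩
    apply PrimeSpectrum.localization_comap_injective B1 (Submonoid.powers f)
    rw [← hQ1, ← hQ2, ← PrimeSpectrum.comap_comp_apply, ← PrimeSpectrum.comap_comp_apply, hBE]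
    rfl
  have : Algebra.FinitePresentation B B1 := inferInstance
  have : Algebra.FinitePresentation C B1 := .trans C B B1
  have : Algebra.Etale C B1 := etale_descent_source (E := E2)
  have : Algebra.Smooth K C := ⟨inferInstanceAs (Algebra.FormallySmooth K (MvPolynomial κ K)),
    inferInstanceAs (Algebra.FinitePresentation K (MvPolynomial κ K))⟩
  have : Algebra.Smooth K B1 := .comp K C B1
  have h := (Algebra.basicOpen_subset_smoothLocus_iff_smooth (R := K) (f := f)).2 this
  exact h hf


/-- intersections of the primes `(π, x_i)` -/
lemma inter_aux {O : Type*} [CommRing O] {ι : Type*} (π : O) (x : ι → O)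
    (hp : ∀ i, (Ideal.span {π, x i}).IsPrime)
    (hn : ∀ i j, i ≠ j → x j ∉ Ideal.span {π, x i}) (s : Finset ι) (a : O)
    (ha : ∀ i ∈ s, a ∈ Ideal.span {π, x i}) : ∃ t, π ∣ a - t * ∏ i ∈ s, x i := by
  classical
  induction s using Finset.induction_on with
  | empty => exact ⟨a, by simp⟩
  | insert j s hj ih =>
    obtain ⟨t, w, hw⟩ := ih fun i hi => ha i (Finset.mem_insert_of_mem hi)
    have h1 : t * ∏ i ∈ s, x i ∈ Ideal.span {π, x j} := by
      have h2 : a = π * w + t * ∏ i ∈ s, x i := by rw [← hw]; ring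
      have h3 := ha j (Finset.mem_insert_self _ _)
      rw [h2] at h3
      exact (Ideal.add_mem_iff_right _ (Ideal.mul_mem_right _ _ (Ideal.subset_span (by simp)))).1 h3
    have h4 : t ∈ Ideal.span {π, x j} := by
      refine ((hp j).mem_or_mem h1).resolve_right fun h => ?_
      obtain ⟨i, hi, hx⟩ := ((hp j).prod_mem_iff).1 h
      exact hn j i (fun e => hj (e ▸ hi)) hx
    obtain ⟨u, v, huv⟩ := Ideal.mem_span_pair.1 h4
    refine ⟨v, w + u * ∏ i ∈ s, x i, ?_⟩
    rw [Finset.prod_insert hj]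
    rw [← huv] at hw
    linear_combination hw

lemma inter_of {O : Type*} [CommRing O] {ι : Type*} [Fintype ι] (π : O) (x : ι → O)
    (hp : ∀ i, (Ideal.span {π, x i}).IsPrime)
    (hn : ∀ i j, i ≠ j → x j ∉ Ideal.span {π, x i}) (hd : π ∣ ∏ i, x i) (a : O)
    (ha : ∀ i, a ∈ Ideal.span {π, x i}) : π ∣ a := by
  obtain ⟨t, ht⟩ := inter_aux π x hp hn Finset.univ a fun i _ => ha i
  exact (dvd_sub_left (hd.mul_left t)).1 ht

lemma rad_of {O : Type*} [CommRing O] {ι : Type*} [Fintype ι] (π : O) (x : ι → O)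
    (hp : ∀ i, (Ideal.span {π, x i}).IsPrime)
    (hn : ∀ i j, i ≠ j → x j ∉ Ideal.span {π, x i}) (hd : π ∣ ∏ i, x i) (a : O) (n : ℕ)
    (ha : π ∣ a ^ n) : π ∣ a := by
  refine inter_of π x hp hn hd a fun i => (hp i).mem_of_pow_mem n ?_
  exact Ideal.mem_of_dvd _ ha (Ideal.subset_span (by simp))

section std
open MvPolynomial
variable {A : Type u} [CommRing A] {n l : ℕ} {c : A}

lemma std_nzd [IsDomain A] {π : A} (hπ : Prime π) (i0 : Fin n) (h0 : (i0 : ℕ) < l)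
    (a : stdRing A n l c) (h : algebraMap A _ π * a = 0) : a = 0 := by
  obtain ⟨a, rfl⟩ := Ideal.Quotient.mk_surjective a
  have h1 : (C π * a : MvPolynomial (Fin n) A) ∈ Ideal.span
      {(∏ i : Fin n, if (i : ℕ) < l then X i else 1) - C c} := by
    rw [← Ideal.Quotient.eq_zero_iff_mem, map_mul]
    exact h
  rw [Ideal.Quotient.eq_zero_iff_mem]
  obtain ⟨b, hb⟩ := Ideal.mem_span_singleton.1 h1
  have hC : Prime (C π : MvPolynomial (Fin n) A) := (MvPolynomial.prime_C_iff (Fin n)).2 hπ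
  rcases hC.dvd_or_dvd ⟨a, hb.symm⟩ with h2 | ⟨b', rfl⟩
  · exfalso
    have e0 := map_dvd (eval₂Hom (RingHom.id A) (fun _ : Fin n => (0 : A))) h2
    have e1 := map_dvd (eval₂Hom (RingHom.id A) (fun _ : Fin n => (1 : A))) h2
    simp only [map_sub, map_prod, coe_eval₂Hom, eval₂_C, RingHom.id_apply] at e0 e1
    rw [Finset.prod_eq_zero (Finset.mem_univ i0) (by simp [h0])] at e0
    rw [Finset.prod_eq_one (by intro i _; split_ifs <;> simp)] at e1
    refine hπ.not_unit (isUnit_of_dvd_one ?_)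
    have := dvd_sub e1 e0
    simpa using this
  · rw [Ideal.mem_span_singleton]
    refine ⟨b', ?_⟩
    apply mul_left_cancel₀ hC.ne_zero
    rw [hb]; ring

lemma std_zero (a : A) (h : a ∣ 1 - c) : Ideal.Quotient.mk (Ideal.span
      {(∏ i : Fin n, if (i : ℕ) < 0 then X i else 1) - C c}) (C (1 - c)) = 0 := by
  rw [Ideal.Quotient.eq_zero_iff_mem]
  apply Ideal.subset_span
  simp

lemma nzd_flat {S O : Type*} [CommRing S] [CommRing O] [Algebra S O] [Module.Flat S O] (π : S)
    (h : ∀ a, π * a = 0 → a = 0) (a : O) (ha : algebraMap S O π * a = 0) : a = 0 := by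
  have h1 : IsRegular π := (isLeftRegular_iff_isRegular).1 fun x y hxy => by
    have := h (x - y) (by rw [mul_sub]; exact sub_eq_zero.2 hxy)
    exact sub_eq_zero.1 this
  have := Module.Flat.isSMulRegular_of_isRegular (R := S) (M := O) h1
  apply this
  simp only [smul_zero]
  rw [Algebra.smul_def, ha]
end std


section drop

lemma loc_etale {S S2 : Type u} [CommRing S] [CommRing S2] (g : S) (g2 : S2)
    (α : S2 →+* Localization.Away g) (β : S →+* Localization.Away g2)
    (hα : IsUnit (α g2)) (hβ : IsUnit (β g))
    (h1 : (IsLocalization.Away.lift (S := Localization.Away g) g hβ).comp α = algebraMap _ _)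
    (h2 : (IsLocalization.Away.lift (S := Localization.Away g2) g2 hα).comp β = algebraMap _ _) :
    α.Etale := by
  set a := IsLocalization.Away.lift (S := Localization.Away g2) g2 hα with ha
  set b := IsLocalization.Away.lift (S := Localization.Away g) g hβ with hb
  have ha' : a.comp (algebraMap _ _) = α := IsLocalization.Away.lift_comp g2 hα
  have hb' : b.comp (algebraMap _ _) = β := IsLocalization.Away.lift_comp g hβ
  have e1 : a.comp b = RingHom.id _ := by
    apply IsLocalization.ringHom_ext (Submonoid.powers g)
    rw [RingHom.comp_assoc, hb', h2, RingHom.id_comp]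
  have e2 : b.comp a = RingHom.id _ := by
    apply IsLocalization.ringHom_ext (Submonoid.powers g2)
    rw [RingHom.comp_assoc, ha', h1, RingHom.id_comp]
  rw [← ha']
  refine RingHom.Etale.stableUnderComposition (algebraMap S2 (Localization.Away g2)) a ?_ ?_
  · refine RingHom.etale_algebraMap.2 ?_
    exact Algebra.Etale.of_isLocalizationAway g2
  · apply RingHom.Etale.of_bijective
    exact (RingEquiv.ofRingHom a b e1 e2).bijective

lemma etale_lift {S E : Type u} [CommRing S] [CommRing E] (g : S) (θ : S →+* E) (hθ : θ.Etale)
    (hg : IsUnit (θ g)) : (IsLocalization.Away.lift (S := Localization.Away g) g hg).Etale := by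
  letI := θ.toAlgebra
  letI := (IsLocalization.Away.lift (S := Localization.Away g) g hg).toAlgebra
  haveI : IsScalarTower S (Localization.Away g) E := IsScalarTower.of_algebraMap_eq' 
    (IsLocalization.Away.lift_comp g hg).symm
  haveI : Algebra.Etale S E := hθ
  haveI : Algebra.Etale S (Localization.Away g) := Algebra.Etale.of_isLocalizationAway g
  haveI : Algebra.FormallyEtale (Localization.Away g) E := Algebra.FormallyEtale.of_restrictScalars (R := S)
  haveI : Algebra.FinitePresentation (Localization.Away g) E :=
    Algebra.FinitePresentation.of_restrict_scalars_finitePresentation S _ _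
  exact (⟨inferInstance, inferInstance⟩ : Algebra.Etale (Localization.Away g) E)

variable {K : Type u} [CommRing K] {n l : ℕ} {c : K}

lemma std_drop {E : Type u} [CommRing E] (θ : stdRing K n l c →+* E) (hθ : θ.Etale)
    (l' : ℕ) (σ : Equiv.Perm (Fin n)) (a0 : Fin n) (h0 : (a0 : ℕ) < l')
    (hσ : ∀ a : Fin n, (a : ℕ) < l' → (σ a : ℕ) < l)
    (hu : ∀ a : Fin n, (σ a : ℕ) < l → ¬ (a : ℕ) < l' → IsUnit (θ (stdCoord K n l c (σ a)))) :
    ∃ θ2 : stdRing K n l' c →+* E, θ2.Etale ∧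
      (∀ r, θ2 (algebraMap K _ r) = θ (algebraMap K _ r)) ∧
      ∀ a : Fin n, ∃ u, IsUnit u ∧ θ2 (stdCoord K n l' c a) = θ (stdCoord K n l c (σ a)) * u := by
  classical
  let g : stdRing K n l c := ∏ a : Fin n, if (σ a : ℕ) < l ∧ ¬ (a : ℕ) < l' then stdCoord K n l c (σ a) else 1
  let g2 : stdRing K n l' c := ∏ a : Fin n, if (σ a : ℕ) < l ∧ ¬ (a : ℕ) < l' then stdCoord K n l' c a else 1
  let ag := algebraMap (stdRing K n l c) (Localization.Away g)
  let ag2 := algebraMap (stdRing K n l' c) (Localization.Away g2)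
  obtain ⟨gi, hgi⟩ : ∃ gi, ag2 g2 * gi = 1 :=
    (IsLocalization.Away.algebraMap_isUnit (S := Localization.Away g2) g2).exists_right_inv
  have key : ∀ {B : Type u} [CommRing B] (y : Fin n → B), (∏ a : Fin n, if (σ a : ℕ) < l then y a else 1)
      = (∏ a : Fin n, if (σ a : ℕ) < l ∧ ¬ (a : ℕ) < l' then y a else 1) *
        ∏ a : Fin n, if (a : ℕ) < l' then y a else 1 := by
    intro B _ y
    rw [← Finset.prod_mul_distrib]
    refine Finset.prod_congr rfl fun a _ => ?_
    have := hσ a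
    split_ifs <;> simp_all
  have hone : ∀ {B : Type u} [CommRing B] (y : Fin n → B) (t : B), 
      (∏ a : Fin n, if (a : ℕ) < l' then y a * (if a = a0 then t else 1) else 1)
      = (∏ a : Fin n, if (a : ℕ) < l' then y a else 1) * t := by
    intro B _ y t
    have : t = ∏ a : Fin n, if a = a0 then t else 1 := by simp
    conv_rhs => rw [this]
    rw [← Finset.prod_mul_distrib]
    refine Finset.prod_congr rfl fun a _ => ?_
    split_ifs <;> simp_all
  have hprodS : (∏ a : Fin n, if (σ a : ℕ) < l then stdCoord K n l c (σ a) else 1) =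
      algebraMap K (stdRing K n l c) c := by
    rw [← std_prod]
    exact Equiv.prod_comp σ (fun i => if (i : ℕ) < l then stdCoord K n l c i else 1)
  let α : stdRing K n l' c →+* Localization.Away g := stdLift (ag.comp (algebraMap K _))
    (fun a => ag (stdCoord K n l c (σ a)) * (if a = a0 then ag g else 1)) (by
      rw [hone, RingHom.comp_apply, ← hprodS, key, mul_comm, map_mul, map_prod]
      congr 1
      rw [map_prod]
      refine Finset.prod_congr rfl fun a _ => ?_
      split_ifs <;> simp)
  let β : stdRing K n l c →+* Localization.Away g2 := stdLift (ag2.comp (algebraMap K _))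
    (fun i => ag2 (stdCoord K n l' c (σ.symm i)) * (if σ.symm i = a0 then gi else 1)) (by
      refine (Equiv.prod_comp σ (fun i => if (i : ℕ) < l then ag2 (stdCoord K n l' c (σ.symm i)) * (if σ.symm i = a0 then gi else 1) else 1)).symm.trans ?_
      simp only [Equiv.symm_apply_apply]
      rw [key, hone]
      rw [RingHom.comp_apply, ← std_prod, map_prod]
      have e1 : (∏ a : Fin n, if (σ a : ℕ) < l ∧ ¬ (a : ℕ) < l' then
          ag2 (stdCoord K n l' c a) * (if a = a0 then gi else 1) else 1) = ag2 g2 := by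
        rw [map_prod]
        refine Finset.prod_congr rfl fun a _ => ?_
        by_cases ha : a = a0
        · subst ha; simp [h0]
        · split_ifs <;> simp_all
      rw [e1, mul_comm, mul_assoc, mul_comm gi, hgi, mul_one]
      refine Finset.prod_congr rfl fun a _ => ?_
      split_ifs <;> simp)
  have hαg : α g2 = ag g := by
    simp only [g2, g, map_prod]
    refine Finset.prod_congr rfl fun a _ => ?_
    by_cases ha : a = a0
    · subst ha; simp [h0]
    · split_ifs
      · simp [α, ha]
      · simp
  have hβg : β g = ag2 g2 := by
    simp only [g2, g, map_prod]
    refine Finset.prod_congr rfl fun a _ => ?_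
    by_cases ha : a = a0
    · subst ha; simp [h0]
    · split_ifs
      · simp [β, ha]
      · simp
  have hα : IsUnit (α g2) := by
    rw [hαg]; exact IsLocalization.Away.algebraMap_isUnit (S := Localization.Away g) g
  have hβ : IsUnit (β g) := by
    rw [hβg]; exact IsLocalization.Away.algebraMap_isUnit (S := Localization.Away g2) g2
  have hαe : α.Etale := by
    refine loc_etale g g2 α β hα hβ ?_ ?_
    · refine std_hom_ext (K := K) (n := n) (l := l') (c := c) ?_ ?_
      · intro r
        rw [RingHom.comp_apply]
        simp only [α, stdLift_algebraMap, RingHom.comp_apply, ag, IsLocalization.Away.lift_eq]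
        simp [β, ag2]
      · intro a
        rw [RingHom.comp_apply]
        simp only [α, stdLift_coord, ag, map_mul, IsLocalization.Away.lift_eq]
        by_cases ha : a = a0
        · rw [if_pos ha, IsLocalization.Away.lift_eq, hβg]
          simp only [β, stdLift_coord, Equiv.symm_apply_apply, if_pos ha]
          rw [mul_assoc, mul_comm gi, hgi, mul_one]
        · rw [if_neg ha]; simp [β, ha, ag2]
    · refine std_hom_ext (K := K) (n := n) (l := l) (c := c) ?_ ?_
      · intro r
        rw [RingHom.comp_apply]
        simp only [β, stdLift_algebraMap, RingHom.comp_apply, ag2, IsLocalization.Away.lift_eq]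
        simp [α, ag]
      · intro i
        rw [RingHom.comp_apply]
        simp only [β, stdLift_coord, ag2, map_mul, IsLocalization.Away.lift_eq]
        by_cases ha : σ.symm i = a0
        · rw [if_pos ha]
          have h3 := congrArg (IsLocalization.Away.lift (S := Localization.Away g2) g2 hα) hgi
          simp only [ag2, map_mul, IsLocalization.Away.lift_eq, map_one, hαg] at h3
          simp only [α, stdLift_coord, if_pos ha, Equiv.apply_symm_apply]
          rw [mul_assoc, h3, mul_one]
        · rw [if_neg ha]; simp [α, ha, ag]
  have hg : IsUnit (θ g) := by
    simp only [g, map_prod]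
    apply IsUnit.prod_univ_iff.2
    intro a
    split_ifs with h
    · exact hu a h.1 h.2
    · simp
  refine ⟨(IsLocalization.Away.lift (S := Localization.Away g) g hg).comp α,
    RingHom.Etale.stableUnderComposition _ _ hαe (etale_lift g θ hθ hg), ?_, ?_⟩
  · intro r
    rw [RingHom.comp_apply]
    simp only [α, stdLift_algebraMap, RingHom.comp_apply, ag, IsLocalization.Away.lift_eq]
  · intro a
    refine ⟨if a = a0 then θ g else 1, by split_ifs <;> simp [hg], ?_⟩
    rw [RingHom.comp_apply]
    simp only [α, stdLift_coord, ag, map_mul, IsLocalization.Away.lift_eq]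
    split_ifs <;> simp [IsLocalization.Away.lift_eq]

/-- the standard ring with `l = 1` is smooth -/
lemma std_one_smooth (h : 1 ≤ n) : Algebra.Smooth K (stdRing K n 1 c) := by
  obtain ⟨n, rfl⟩ : ∃ k, n = k + 1 := ⟨n - 1, by omega⟩
  let y : Fin (n+1) → MvPolynomial (Fin n) K := Fin.cases (MvPolynomial.C c) (fun i => MvPolynomial.X i)
  let f : stdRing K (n+1) 1 c →+* MvPolynomial (Fin n) K := stdLift MvPolynomial.C y (by
    rw [Fin.prod_univ_succ]; simp [y])
  let fa : stdRing K (n+1) 1 c →ₐ[K] MvPolynomial (Fin n) K := { f with commutes' := fun r => stdLift_algebraMap _ _ _ r }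
  let g : MvPolynomial (Fin n) K →ₐ[K] stdRing K (n+1) 1 c :=
    MvPolynomial.aeval fun i => stdCoord K (n+1) 1 c i.succ
  have h1 : fa.comp g = AlgHom.id K _ := by
    apply MvPolynomial.algHom_ext
    intro i
    change f (g _) = _
    simp [g, f, y]
  have h2 : g.comp fa = AlgHom.id K _ := by
    apply AlgHom.coe_ringHom_injective
    refine std_hom_ext (K := K) (n := n+1) (l := 1) (c := c) ?_ ?_
    · intro r; simp
    · intro i
      change g (f _) = stdCoord _ _ _ _ _
      refine Fin.cases ?_ ?_ i
      · have := std_prod (K := K) (n := n+1) (l := 1) (c := c)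
        rw [Fin.prod_univ_succ] at this
        simp only [Fin.val_zero, zero_lt_one, if_true, Fin.val_succ, add_lt_iff_neg_right, not_lt_zero, if_false, Finset.prod_const_one, mul_one] at this
        simp [f, y, this]
      · intro i; simp [f, y, g]
  haveI : Algebra.Smooth K (MvPolynomial (Fin n) K) := ⟨inferInstance, inferInstance⟩
  exact Algebra.Smooth.of_equiv (AlgEquiv.ofAlgHom g fa h2 h1)

lemma std_zero_smooth (hc : c = 1) : Algebra.Smooth K (stdRing K n 0 c) := by
  let f : stdRing K n 0 c →+* MvPolynomial (Fin n) K := stdLift MvPolynomial.C (fun i => MvPolynomial.X i) (by simp [hc])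
  let fa : stdRing K n 0 c →ₐ[K] MvPolynomial (Fin n) K := { f with commutes' := fun r => stdLift_algebraMap _ _ _ r }
  let g : MvPolynomial (Fin n) K →ₐ[K] stdRing K n 0 c :=
    MvPolynomial.aeval fun i => stdCoord K n 0 c i
  have h1 : fa.comp g = AlgHom.id K _ := by
    apply MvPolynomial.algHom_ext
    intro i
    change f (g _) = _
    simp [g, f]
  have h2 : g.comp fa = AlgHom.id K _ := by
    apply AlgHom.coe_ringHom_injective
    refine std_hom_ext (K := K) (n := n) (l := 0) (c := c) ?_ ?_
    · intro r; simp
    · intro i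
      change g (f _) = stdCoord _ _ _ _ _
      simp [f, g]
  haveI : Algebra.Smooth K (MvPolynomial (Fin n) K) := ⟨inferInstance, inferInstance⟩
  exact Algebra.Smooth.of_equiv (AlgEquiv.ofAlgHom g fa h2 h1)

instance std_fp : Algebra.FinitePresentation K (stdRing K n l c) :=
  Algebra.FinitePresentation.quotient ⟨{(∏ i : Fin n, if (i : ℕ) < l then MvPolynomial.X i else 1) - MvPolynomial.C c}, by simp⟩

lemma std_fp_E (l : ℕ) (E : Type u) [CommRing E] [Algebra K E] [Algebra (stdRing K n l c) E]
    [IsScalarTower K (stdRing K n l c) E] [Algebra.Etale (stdRing K n l c) E] :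
    Algebra.FinitePresentation K E := .trans K (stdRing K n l c) E

lemma std_smoothAt {E : Type u} [CommRing E] [Algebra K E] [Algebra (stdRing K n l c) E]
    [IsScalarTower K (stdRing K n l c) E] [Algebra.Etale (stdRing K n l c) E]
    (q : Ideal E) [q.IsPrime] (i0 : Fin n) (hi0 : (i0 : ℕ) < l)
    (hq : ∀ i : Fin n, (i : ℕ) < l → i ≠ i0 → algebraMap _ E (stdCoord K n l c i) ∉ q) :
    Algebra.IsSmoothAt K q := by
  classical
  let h : E := ∏ i : Fin n, if (i : ℕ) < l ∧ i ≠ i0 then algebraMap _ E (stdCoord K n l c i) else 1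
  have hh : h ∉ q := by
    intro hm
    obtain ⟨i, -, hi⟩ := (Ideal.IsPrime.prod_mem_iff).1 hm
    split_ifs at hi with h1
    · exact hq i h1.1 h1.2 hi
    · exact (Ideal.ne_top_iff_one q).1 (Ideal.IsPrime.ne_top') hi
  let z : Fin n := ⟨0, i0.pos⟩
  let θ : stdRing K n l c →+* Localization.Away h := (algebraMap E _).comp (algebraMap _ E)
  have hθ : θ.Etale := RingHom.Etale.stableUnderComposition _ _
    (RingHom.etale_algebraMap.2 inferInstance)
    (RingHom.etale_algebraMap.2 (Algebra.Etale.of_isLocalizationAway h))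
  obtain ⟨θ2, h1, h2, -⟩ := std_drop (K := K) (n := n) (l := l) (c := c) θ hθ 1 (Equiv.swap z i0) z (by simp [z]) (by
      intro a ha
      have : a = z := Fin.ext (by simp only [z]; omega)
      subst this; simpa using hi0) (by
      intro a ha hna
      have hne : Equiv.swap z i0 a ≠ i0 := by
        intro e
        have : a = z := by
          rw [← Equiv.swap_apply_left z i0] at e
          exact (Equiv.swap z i0).injective e
        exact hna (by rw [this]; simp [z])
      have hu := IsLocalization.Away.algebraMap_isUnit (S := Localization.Away h) h
      refine isUnit_of_dvd_unit ?_ hu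
      refine map_dvd (algebraMap E (Localization.Away h)) ?_
      have := Finset.dvd_prod_of_mem (fun i : Fin n => if (i : ℕ) < l ∧ i ≠ i0 then algebraMap _ E (stdCoord K n l c i) else 1) (Finset.mem_univ (Equiv.swap z i0 a))
      rwa [if_pos ⟨ha, hne⟩] at this)
  have hn : 1 ≤ n := i0.pos
  letI := θ2.toAlgebra
  haveI : Algebra.Etale (stdRing K n 1 c) (Localization.Away h) := h1
  haveI := std_one_smooth (K := K) (c := c) hn
  haveI : IsScalarTower K (stdRing K n 1 c) (Localization.Away h) := by
    refine IsScalarTower.of_algebraMap_eq (R := K) (S := stdRing K n 1 c) (A := Localization.Away h) fun r => ?_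
    change _ = θ2 _
    rw [h2]
    simp only [θ, RingHom.comp_apply]
    rw [← IsScalarTower.algebraMap_apply K (stdRing K n l c) E, ← IsScalarTower.algebraMap_apply K E]
  have hsm : Algebra.Smooth K (Localization.Away h) := Algebra.Smooth.comp K (stdRing K n 1 c) _
  haveI := std_fp_E (K := K) (n := n) (c := c) l E
  exact Algebra.basicOpen_subset_smoothLocus_iff_smooth.2 hsm (show (⟨q, inferInstance⟩ : PrimeSpectrum E) ∈ _ from hh)

lemma std_smoothAt_zero (hc : c = 1) {E : Type u} [CommRing E] [Algebra K E] [Algebra (stdRing K n 0 c) E]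
    [IsScalarTower K (stdRing K n 0 c) E] [Algebra.Etale (stdRing K n 0 c) E]
    (q : Ideal E) [q.IsPrime] : Algebra.IsSmoothAt K q := by
  haveI := std_zero_smooth (K := K) (n := n) hc
  haveI : Algebra.Smooth K E := Algebra.Smooth.comp K (stdRing K n 0 c) _
  change Algebra.FormallySmooth K (Localization.AtPrime q)
  haveI : Algebra.FormallySmooth E (Localization.AtPrime q) :=
    Algebra.FormallySmooth.of_isLocalization q.primeCompl
  exact Algebra.FormallySmooth.comp K E _
end drop


/-- `LModel` without the unit condition -/
structure PModel {O : Type*} [CommRing O] (π : O) {ι : Type*} [Fintype ι] (x : ι → O) :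
    Prop where
  nzd : ∀ a, π * a = 0 → a = 0
  dvd : π ∣ ∏ i, x i
  prime : ∀ i, (Ideal.span {π, x i}).IsPrime
  notMem : ∀ i j, i ≠ j → x j ∉ Ideal.span {π, x i}
  prime2 : ∀ i j, i ≠ j → (Ideal.span {π, x i, x j}).IsPrime
  notMem2 : ∀ i j r, i ≠ j → r ≠ i → r ≠ j → x r ∉ Ideal.span {π, x i, x j}

lemma PModel.toL {O : Type*} [CommRing O] {π : O} {ι : Type*} [Fintype ι] {x : ι → O}
    (h : PModel π x) (k : ℕ) (hk : 0 < k) (hu : ∃ u, IsUnit u ∧ ∏ i, x i = π ^ k * u) :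
    LModel π x k :=
  ⟨h.nzd, hk, hu, h.prime, h.notMem, inter_of π x h.prime h.notMem h.dvd, h.prime2, h.notMem2⟩

lemma PModel.dom {O : Type u} [CommRing O] [IsLocalRing O] [IsNoetherianRing O] {π : O}
    {ι : Type*} [Fintype ι] {x : ι → O}
    (h : PModel π x)
    (hd : ∀ (q : Ideal O) [q.IsPrime], π ∉ q → IsDomain (Localization.AtPrime q)) : IsDomain O :=
  isDomain_of_generic π h.nzd (rad_of π x h.prime h.notMem h.dvd) hd

section smooth

lemma loc_away_prime {B O : Type*} [CommRing B] [CommRing O] [Algebra B O] (f : B) (q : Ideal B)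
    [q.IsPrime] [IsLocalization.AtPrime O q] (hf : f ∉ q) [Algebra (Localization.Away f) O]
    [IsScalarTower B (Localization.Away f) O] :
    ∃ _ : (Ideal.map (algebraMap B (Localization.Away f)) q).IsPrime,
      IsLocalization.AtPrime O (Ideal.map (algebraMap B (Localization.Away f)) q) := by
  have hdis := (Ideal.disjoint_powers_iff_notMem_of_isPrime _).mpr hf
  have : (Ideal.map (algebraMap B (Localization.Away f)) q).IsPrime :=
    IsLocalization.isPrime_of_isPrime_disjoint (.powers f) _ _ ‹_› hdis
  refine ⟨this, ?_⟩
  set Q := Ideal.map (algebraMap B (Localization.Away f)) q with hQ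
  have hl : IsLocalization.AtPrime (Localization.AtPrime Q) (Q.comap (algebraMap B (Localization.Away f))) :=
    IsLocalization.isLocalization_isLocalization_atPrime_isLocalization (.powers f) _ Q
  have hc : Q.comap (algebraMap B (Localization.Away f)) = q :=
    IsLocalization.comap_map_of_isPrime_disjoint (.powers f) _ ‹_› hdis
  have hl2 : IsLocalization q.primeCompl (Localization.AtPrime Q) := by
    convert! hl
    exact hc.symm
  let e : Localization.AtPrime Q ≃ₐ[B] O := IsLocalization.algEquiv q.primeCompl _ _
  have he : (e.toRingEquiv : Localization.AtPrime Q →+* O).comp (algebraMap (Localization.Away f) _) =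
      algebraMap _ _ := by
    apply IsLocalization.ringHom_ext (Submonoid.powers f)
    ext b
    simp only [RingHom.comp_apply]
    rw [← IsScalarTower.algebraMap_apply, ← IsScalarTower.algebraMap_apply]
    exact e.commutes b
  exact IsLocalization.isLocalization_of_algEquiv Q.primeCompl
    (AlgEquiv.ofRingEquiv (f := e.toRingEquiv) fun r => RingHom.congr_fun he r)

lemma smooth_PModel {A E O : Type u} [CommRing A] [IsDomain A] [IsDiscreteValuationRing A]
    [CommRing E] [Algebra A E] [Algebra.FinitePresentation A E] [CommRing O] [Algebra E O] (q : Ideal E)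
    [q.IsPrime] [IsLocalization.AtPrime O q] [Algebra.IsSmoothAt A q] (ϖ : A) (hϖ : Irreducible ϖ)
    (hq : algebraMap A E ϖ ∈ q) :
    PModel (algebraMap E O (algebraMap A E ϖ)) (fun _ : Unit => algebraMap E O (algebraMap A E ϖ)) := by
  obtain ⟨f, hf, n, alg, tow, hst⟩ :=
    Algebra.IsSmoothAt.exists_isStandardEtale_mvPolynomial (R := A) (p := q)
  let ψ : Localization.Away f →+* O := IsLocalization.Away.lift f
    (IsLocalization.map_units O (⟨f, hf⟩ : q.primeCompl))
  letI := ψ.toAlgebra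
  haveI : IsScalarTower E (Localization.Away f) O := IsScalarTower.of_algebraMap_eq'
    (IsLocalization.Away.lift_comp f _).symm
  obtain ⟨hp', hl'⟩ := loc_away_prime (O := O) f q hf
  letI : Algebra (MvPolynomial (Fin n) A) O := (ψ.comp (algebraMap _ _)).toAlgebra
  haveI : IsScalarTower (MvPolynomial (Fin n) A) (Localization.Away f) O :=
    IsScalarTower.of_algebraMap_eq' rfl
  have e : algebraMap (MvPolynomial (Fin n) A) O (MvPolynomial.C ϖ) = algebraMap E O (algebraMap A E ϖ) := by
    rw [IsScalarTower.algebraMap_apply _ (Localization.Away f) O]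
    change algebraMap _ _ (algebraMap (MvPolynomial (Fin n) A) (Localization.Away f) (algebraMap A _ ϖ)) = _
    rw [← IsScalarTower.algebraMap_apply A, IsScalarTower.algebraMap_apply A E,
      ← IsScalarTower.algebraMap_apply E]
  have hC : Prime (MvPolynomial.C ϖ : MvPolynomial (Fin n) A) :=
    (MvPolynomial.prime_C_iff (Fin n)).2 hϖ.prime
  haveI : Module.Flat (MvPolynomial (Fin n) A) O := by
    haveI : Module.Flat (Localization.Away f) O := IsLocalization.flat _ (Ideal.map (algebraMap E (Localization.Away f)) q).primeCompl
    haveI : Module.Flat (MvPolynomial (Fin n) A) (Localization.Away f) := inferInstance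
    exact Module.Flat.trans _ (Localization.Away f) _
  have hnz : ∀ a, algebraMap E O (algebraMap A E ϖ) * a = 0 → a = 0 := by
    intro a ha
    rw [← e] at ha
    refine nzd_flat _ (fun b hb => ?_) a ha
    exact (mul_eq_zero.1 hb).resolve_left hC.ne_zero
  have hmax : (Ideal.span {ϖ}).IsMaximal := by
    rw [← (IsDiscreteValuationRing.irreducible_iff_uniformizer ϖ).1 hϖ]; infer_instance
  letI := Ideal.Quotient.field (Ideal.span {ϖ})
  let I : Ideal (MvPolynomial (Fin n) A) := Ideal.map MvPolynomial.C (Ideal.span {ϖ})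
  let eq : MvPolynomial (Fin n) (A ⧸ Ideal.span {ϖ}) ≃ₐ[A] MvPolynomial (Fin n) A ⧸ I :=
    MvPolynomial.quotientEquivQuotientMvPolynomial _
  haveI : IsDomain (MvPolynomial (Fin n) A ⧸ I) := eq.symm.toRingEquiv.toMulEquiv.isDomain _
  haveI : IsIntegrallyClosed (MvPolynomial (Fin n) A ⧸ I) := IsIntegrallyClosed.of_equiv eq.toRingEquiv
  have hI : I = Ideal.span {MvPolynomial.C ϖ} := by simp [I, Ideal.map_span]
  obtain ⟨hpr, -⟩ := quot_local_normal (O := O) (Ideal.map (algebraMap E (Localization.Away f)) q) I (by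
    rw [hI, Ideal.map_span, Set.image_singleton, Ideal.span_singleton_le_iff_mem]
    change algebraMap (MvPolynomial (Fin n) A) (Localization.Away f) (algebraMap A _ ϖ) ∈ _
    rw [← IsScalarTower.algebraMap_apply A, IsScalarTower.algebraMap_apply A E]
    exact Ideal.mem_map_of_mem _ hq)
  rw [hI, Ideal.map_span, Set.image_singleton, e] at hpr
  refine ⟨hnz, by simp, fun i => by simpa using hpr, fun i j h => (h rfl).elim,
    fun i j h => (h rfl).elim, fun i j r h => (h rfl).elim⟩
end smooth


lemma prod_subtype_aux {O : Type*} [CommMonoid O] {n : ℕ} (p : Fin n → Prop) [DecidablePred p] (x : Fin n → O) :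
    (∏ i : {i : Fin n // p i}, x i) = ∏ i : Fin n, if p i then x i else 1 := by
  rw [Finset.prod_ite, Finset.prod_const_one, mul_one]
  exact (Finset.prod_subtype _ (by simp) x).symm

section chart
variable {A : Type u} [CommRing A] [IsDomain A] [IsDiscreteValuationRing A] {n l : ℕ} {c : A}
  {E : Type u} [CommRing E] [Algebra A E] [Algebra (stdRing A n l c) E]
  [IsScalarTower A (stdRing A n l c) E] [Algebra.Etale (stdRing A n l c) E]
  {O : Type u} [CommRing O] [Algebra E O]

open Classical in
lemma std_prod_E (q : Ideal E) [q.IsPrime] [IsLocalization.AtPrime O q] :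
    ∃ u : O, IsUnit u ∧ (∏ i : {i : Fin n // (i : ℕ) < l ∧ algebraMap _ E (stdCoord A n l c i) ∈ q},
      algebraMap E O (algebraMap _ E (stdCoord A n l c i))) * u = algebraMap E O (algebraMap A E c) := by
  set x : Fin n → O := fun i => algebraMap E O (algebraMap _ E (stdCoord A n l c i)) with hx
  refine ⟨∏ i : Fin n, if (i : ℕ) < l ∧ algebraMap _ E (stdCoord A n l c i) ∉ q then x i else 1, ?_, ?_⟩
  · rw [IsUnit.prod_univ_iff]
    intro i
    split_ifs with h
    · exact IsLocalization.map_units O (⟨_, h.2⟩ : q.primeCompl)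
    · exact isUnit_one
  · rw [IsScalarTower.algebraMap_apply A (stdRing A n l c) E, ← std_prod, map_prod, map_prod]
    have h1 : (∏ i : {i : Fin n // (i : ℕ) < l ∧ algebraMap _ E (stdCoord A n l c i) ∈ q}, x i) =
        ∏ i : Fin n, if (i : ℕ) < l ∧ algebraMap _ E (stdCoord A n l c i) ∈ q then x i else 1 := by
      exact prod_subtype_aux _ x
    change (∏ i : {i : Fin n // (i : ℕ) < l ∧ algebraMap _ E (stdCoord A n l c i) ∈ q}, x i) * _ = _
    rw [h1, ← Finset.prod_mul_distrib]
    refine Finset.prod_congr rfl fun i _ => ?_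
    by_cases h2 : (i : ℕ) < l <;> by_cases h3 : algebraMap _ E (stdCoord A n l c i) ∈ q <;>
      simp [h2, h3, hx]

open Classical in
lemma std_PModel (q : Ideal E) [q.IsPrime] [IsLocalization.AtPrime O q] (ϖ : A)
    (hϖ : Irreducible ϖ) (hq : algebraMap A E ϖ ∈ q)
    (hc : c ∈ Ideal.span {ϖ})
    (hnz : ∀ a, algebraMap E O (algebraMap A E ϖ) * a = 0 → a = 0) :
    PModel (algebraMap E O (algebraMap A E ϖ))
      (fun i : {i : Fin n // (i : ℕ) < l ∧ algebraMap _ E (stdCoord A n l c i) ∈ q} =>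
        algebraMap E O (algebraMap _ E (stdCoord A n l c i))) := by
  letI : Algebra (stdRing A n l c) O := ((algebraMap E O).comp (algebraMap _ E)).toAlgebra
  haveI : IsScalarTower (stdRing A n l c) E O := IsScalarTower.of_algebraMap_eq' rfl
  have hmax : (Ideal.span {ϖ}).IsMaximal := by
    rw [← (IsDiscreteValuationRing.irreducible_iff_uniformizer ϖ).1 hϖ]; infer_instance
  have hIq : ∀ r ∈ Ideal.span {ϖ}, algebraMap (stdRing A n l c) E (algebraMap A _ r) ∈ q := by
    intro r hr
    rw [← IsScalarTower.algebraMap_apply]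
    obtain ⟨t, rfl⟩ := Ideal.mem_span_singleton.1 hr
    rw [map_mul]
    exact Ideal.mul_mem_right _ _ hq
  have hmap : ∀ S : Set (Fin n), (stdI n l c (Ideal.span {ϖ}) S).map (algebraMap _ O) =
      Ideal.span ({algebraMap E O (algebraMap A E ϖ)} ∪ (fun i => algebraMap E O (algebraMap _ E (stdCoord A n l c i))) '' S) := by
    intro S
    rw [stdI, Ideal.map_sup, Ideal.map_map, Ideal.map_span, Ideal.map_span, ← Ideal.span_union,
      Set.image_singleton, Set.image_image, RingHom.comp_apply]
    have : algebraMap (stdRing A n l c) O (algebraMap A _ ϖ) = algebraMap E O (algebraMap A E ϖ) := by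
      rw [IsScalarTower.algebraMap_apply A (stdRing A n l c) E]; rfl
    rw [this]; rfl
  obtain ⟨u, hu, hu2⟩ := std_prod_E (A := A) (n := n) (l := l) (c := c) (O := O) q
  refine ⟨hnz, ?_, ?_, ?_, ?_, ?_⟩
  · obtain ⟨t, rfl⟩ := Ideal.mem_span_singleton.1 hc
    rw [← hu.dvd_mul_right, hu2, map_mul, map_mul]
    exact dvd_mul_right _ _
  · intro i
    have := (std_local (O := O) q (Ideal.span {ϖ}) hmax {i.1} hc i.1 rfl i.2.1 hIq (by
      rintro _ rfl; exact i.2.2)).1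
    rw [hmap] at this
    simpa [Set.pair_comm] using this
  · intro i j hij
    have := (std_local (O := O) q (Ideal.span {ϖ}) hmax {i.1} hc i.1 rfl i.2.1 hIq (by
      rintro _ rfl; exact i.2.2)).2 j.1 (fun h => hij (Subtype.ext (Set.mem_singleton_iff.1 h).symm))
    rw [hmap] at this
    change algebraMap E O (algebraMap _ E (stdCoord A n l c j)) ∉ _ at this
    simpa [Set.pair_comm] using this
  · intro i j hij
    have := (std_local (O := O) q (Ideal.span {ϖ}) hmax {i.1, j.1} hc i.1 (by simp) i.2.1 hIq (by
      rintro _ (rfl | rfl)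
      exacts [i.2.2, j.2.2])).1
    rw [hmap, Set.image_pair] at this
    convert! this using 2
  · intro i j r hij hri hrj
    have := (std_local (O := O) q (Ideal.span {ϖ}) hmax {i.1, j.1} hc i.1 (by simp) i.2.1 hIq (by
      rintro _ (rfl | rfl)
      exacts [i.2.2, j.2.2])).2 r.1 (by
        rintro (h | h)
        exacts [hri (Subtype.ext h), hrj (Subtype.ext h)])
    rw [hmap, Set.image_pair] at this
    convert! this using 2

theorem chart_LModel (hln : l ≤ n) [IsNoetherianRing E] (q : Ideal E) [q.IsPrime] [IsLocalization.AtPrime O q] (ϖ : A)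
    (hϖ : Irreducible ϖ) (hq : algebraMap A E ϖ ∈ q)
    (hnz : ∀ a, algebraMap E O (algebraMap A E ϖ) * a = 0 → a = 0)
    (hgen : ∀ (P : Ideal O) [P.IsPrime], algebraMap E O (algebraMap A E ϖ) ∉ P →
      IsDomain (Localization.AtPrime P)) :
    IsDomain O ∧ ∃ (ι : Type) (_ : Fintype ι) (_ : Nonempty ι) (x : ι → O) (k : ℕ),
      LModel (algebraMap E O (algebraMap A E ϖ)) x k ∧
      ∀ i j, i ≠ j → elemOrd A c k ∧ ∃ i' j' : Fin n, i' ≠ j' ∧ (i' : ℕ) < l ∧ (j' : ℕ) < l ∧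
        algebraMap _ E (stdCoord A n l c i') ∈ q ∧ algebraMap _ E (stdCoord A n l c j') ∈ q ∧
        x i = algebraMap E O (algebraMap _ E (stdCoord A n l c i')) ∧
        x j = algebraMap E O (algebraMap _ E (stdCoord A n l c j')) := by
  classical
  have hloc : IsLocalRing O := IsLocalization.AtPrime.isLocalRing O q
  have hno : IsNoetherianRing O := IsLocalization.isNoetherianRing q.primeCompl O inferInstance
  haveI := std_fp_E (K := A) (n := n) (c := c) l E
  have hsm : Algebra.IsSmoothAt A q → IsDomain O ∧ ∃ (ι : Type) (_ : Fintype ι) (_ : Nonempty ι) (x : ι → O) (k : ℕ),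
      LModel (algebraMap E O (algebraMap A E ϖ)) x k ∧
      ∀ i j, i ≠ j → elemOrd A c k ∧ ∃ i' j' : Fin n, i' ≠ j' ∧ (i' : ℕ) < l ∧ (j' : ℕ) < l ∧
        algebraMap _ E (stdCoord A n l c i') ∈ q ∧ algebraMap _ E (stdCoord A n l c j') ∈ q ∧
        x i = algebraMap E O (algebraMap _ E (stdCoord A n l c i')) ∧
        x j = algebraMap E O (algebraMap _ E (stdCoord A n l c j')) := by
    intro h
    have hP := smooth_PModel (O := O) q ϖ hϖ hq
    exact ⟨hP.dom hgen, Unit, inferInstance, inferInstance, _, 1, hP.toL 1 one_pos ⟨1, isUnit_one, by simp⟩,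
      fun i j h => (h rfl).elim⟩
  have hpow : ∀ N : ℕ, algebraMap E O (algebraMap A E ϖ) ^ N ≠ 0 := by
    intro N
    induction N with
    | zero => simp
    | succ N ih => intro h; rw [pow_succ'] at h; exact ih (hnz _ h)
  by_cases hl : l = 0
  · subst hl
    by_cases hc : c = 1
    · exact hsm (std_smoothAt_zero (K := A) (n := n) (c := c) hc q)
    · exfalso
      have h1 : algebraMap E O (algebraMap A E (1 - c)) = 0 := by
        have := std_prod (K := A) (n := n) (l := 0) (c := c)
        simp only [not_lt_zero, if_false, Finset.prod_const_one] at this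
        rw [IsScalarTower.algebraMap_apply A (stdRing A n 0 c) E, map_sub, ← this]
        simp
      obtain ⟨k, hk⟩ := IsDiscreteValuationRing.associated_pow_irreducible (sub_ne_zero.2 (Ne.symm hc)) hϖ
      have h2 := map_dvd ((algebraMap E O).comp (algebraMap A E)) hk.dvd
      rw [RingHom.comp_apply, h1, zero_dvd_iff, map_pow] at h2
      exact hpow _ h2
  · by_cases hJ : ∃ i j : Fin n, i ≠ j ∧ (i : ℕ) < l ∧ (j : ℕ) < l ∧ 
      algebraMap _ E (stdCoord A n l c i) ∈ q ∧ algebraMap _ E (stdCoord A n l c j) ∈ q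
    · have hcE : algebraMap A E c ∈ q := by
        obtain ⟨i, j, -, hi, -, hiq, -⟩ := hJ
        rw [IsScalarTower.algebraMap_apply A (stdRing A n l c) E, ← std_prod, map_prod]
        refine Ideal.mem_of_dvd q (Finset.dvd_prod_of_mem _ (Finset.mem_univ i)) ?_
        rwa [if_pos hi]
      have hcu : ¬ IsUnit c := fun h => Ideal.IsPrime.ne_top' (Ideal.eq_top_of_isUnit_mem q hcE (h.map _))
      have hcm : c ∈ Ideal.span {ϖ} := by
        rw [← (IsDiscreteValuationRing.irreducible_iff_uniformizer ϖ).1 hϖ]; exact hcu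
      have hP := std_PModel (n := n) (l := l) (c := c) (O := O) q ϖ hϖ hq hcm hnz
      have hdom := hP.dom hgen
      obtain ⟨u, hu, hu2⟩ := std_prod_E (A := A) (n := n) (l := l) (c := c) (O := O) q
      have hc0 : c ≠ 0 := by
        intro h0
        have hz : algebraMap E O (algebraMap A E c) = 0 := by
          have := congrArg (fun t => algebraMap E O (algebraMap A E t)) h0
          simpa using this
        have h3 := (mul_eq_zero.1 (hu2.trans hz)).resolve_right hu.ne_zero
        obtain ⟨r, -, hr⟩ := Finset.prod_eq_zero_iff.1 h3
        obtain ⟨i, j, hij, hi, hj, hiq, hjq⟩ := hJ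
        obtain ⟨t, ht⟩ : ∃ t : {i : Fin n // (i : ℕ) < l ∧ algebraMap _ E (stdCoord A n l c i) ∈ q}, t ≠ r := by
          by_cases h : r = ⟨i, hi, hiq⟩
          · exact ⟨⟨j, hj, hjq⟩, fun e => hij (by rw [h] at e; exact (congrArg Subtype.val e).symm)⟩
          · exact ⟨_, Ne.symm h⟩
        apply hP.notMem t r ht
        simp only [hr]
        exact Ideal.zero_mem _
      obtain ⟨k, hk⟩ := IsDiscreteValuationRing.associated_pow_irreducible hc0 hϖ
      refine ⟨hdom, _, inferInstance, ?_, _, k, hP.toL k ?_ ?_, ?_⟩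
      · obtain ⟨i, j, -, hi, -, hiq, -⟩ := hJ
        exact ⟨⟨i, hi, hiq⟩⟩
      · rcases Nat.eq_zero_or_pos k with h | h
        · subst h; rw [pow_zero] at hk; exact (hcu (associated_one_iff_isUnit.1 hk)).elim
        · exact h
      · obtain ⟨v, hv⟩ := hk.symm
        obtain ⟨u, rfl⟩ := hu
        refine ⟨algebraMap E O (algebraMap A E v) * ↑u⁻¹, ?_, ?_⟩
        · exact ((v.isUnit.map (algebraMap A E)).map (algebraMap E O)).mul u⁻¹.isUnit
        · rw [← mul_assoc, ← map_pow, ← map_pow, ← map_mul, ← map_mul, hv, ← hu2]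
          simp
      · intro i j hij
        exact ⟨elemOrd_assoc hk.symm (elemOrd_dvr_pow hϖ k), i.1, j.1, fun e => hij (Subtype.ext e),
          i.2.1, j.2.1, i.2.2, j.2.2, rfl, rfl⟩
    · push Not at hJ
      by_cases h0 : ∃ i : Fin n, (i : ℕ) < l ∧ algebraMap _ E (stdCoord A n l c i) ∈ q
      · obtain ⟨i, hi, hiq⟩ := h0
        exact hsm (std_smoothAt (l := l) q i hi fun j hj hji => hJ i j (Ne.symm hji) hi hj hiq)
      · push Not at h0
        exact hsm (std_smoothAt (l := l) q ⟨0, by omega⟩ (by simp; omega) fun j hj _ => h0 j hj)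

end chart

/-- `ϖ` is a nonzerodivisor or nilpotent -/
lemma std_dichotomy {A : Type u} [CommRing A] [IsDomain A] [IsDiscreteValuationRing A] {n l : ℕ} (c : A)
  {E : Type u} [CommRing E] [Algebra A E] [Algebra (stdRing A n l c) E]
  [IsScalarTower A (stdRing A n l c) E] [Algebra.Etale (stdRing A n l c) E] (hln : l ≤ n) (ϖ : A) (hϖ : Irreducible ϖ) :
    (∀ a : E, algebraMap A E ϖ * a = 0 → a = 0) ∨ ∃ k : ℕ, algebraMap A E ϖ ^ k = 0 := by
  by_cases hl : l = 0
  · subst hl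
    by_cases hc : c = 1
    · left
      haveI := std_zero_smooth (K := A) (n := n) hc
      haveI : Algebra.Smooth A E := Algebra.Smooth.comp A (stdRing A n 0 c) _
      haveI : Module.Flat A E := inferInstance
      exact nzd_flat ϖ fun b hb => (mul_eq_zero.1 hb).resolve_left hϖ.ne_zero
    · right
      have h1 : (algebraMap A E (1 - c)) = 0 := by
        have := std_prod (K := A) (n := n) (l := 0) (c := c)
        simp only [not_lt_zero, if_false, Finset.prod_const_one] at this
        rw [IsScalarTower.algebraMap_apply A (stdRing A n 0 c) E, map_sub, ← this]
        simp
      obtain ⟨k, hk⟩ := IsDiscreteValuationRing.associated_pow_irreducible (sub_ne_zero.2 (Ne.symm hc)) hϖ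
      have h2 := map_dvd (algebraMap A E) hk.dvd
      rw [h1, zero_dvd_iff, map_pow] at h2
      exact ⟨k, h2⟩
  · left
    haveI : Module.Flat (stdRing A n l c) E := inferInstance
    rw [IsScalarTower.algebraMap_apply A (stdRing A n l c) E]
    refine nzd_flat _ ?_
    exact std_nzd hϖ.prime ⟨0, by omega⟩ (by simp; omega)



section scheme

/-- structure map of the standard ring, bundled -/
abbrev stdA (K : CommRingCat.{u}) (n l : ℕ) (c : K) : K ⟶ CommRingCat.of (stdRing K n l c) :=
  CommRingCat.ofHom (algebraMap K (stdRing K n l c))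

def stdBC {K K' : CommRingCat.{u}} (ψ : K ⟶ K') (n l : ℕ) (c : K) :
    CommRingCat.of (stdRing K n l c) ⟶ CommRingCat.of (stdRing K' n l (ψ c)) :=
  CommRingCat.ofHom (stdLift ((algebraMap K' _).comp ψ.hom) (stdCoord K' n l (ψ c)) (std_prod))

lemma stdBC_coord {K K' : CommRingCat.{u}} (ψ : K ⟶ K') (n l : ℕ) (c : K) (i) :
    (stdBC ψ n l c).hom (stdCoord K n l c i) = stdCoord K' n l (ψ c) i :=
  stdLift_coord (K := K) (l := l) (c := c) _ _ (std_prod (K := K')) _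

lemma std_isPushout {K K' : CommRingCat.{u}} (ψ : K ⟶ K') (n l : ℕ) (c : K) :
    IsPushout (stdA K n l c) ψ (stdBC ψ n l c) (stdA K' n l (ψ c)) := by
  have hp : ∀ t : PushoutCocone (stdA K n l c) ψ, (∏ i : Fin n, if (i : ℕ) < l then
      t.inl.hom (stdCoord K n l c i) else 1) = t.inr.hom (ψ c) := by
    intro t
    have h := congrArg t.inl.hom (std_prod (K := K) (n := n) (l := l) (c := c))
    rw [map_prod] at h
    have h2 : t.inl.hom (algebraMap K _ c) = t.inr.hom (ψ c) :=
      congrArg (fun e => e.hom c) t.condition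
    refine Eq.trans (Finset.prod_congr rfl fun i _ => ?_) (h.trans h2)
    split_ifs <;> simp
  refine ⟨⟨?_⟩, ⟨PushoutCocone.isColimitAux' _ fun t => ⟨CommRingCat.ofHom
    (stdLift t.inr.hom (fun i => t.inl.hom (stdCoord K n l c i)) (hp t)), ?_, ?_, ?_⟩⟩⟩
  · ext r
    exact stdLift_algebraMap (K := K) (l := l) (c := c) ((algebraMap K' _).comp ψ.hom) _ (std_prod (K := K')) r
  · apply CommRingCat.hom_ext
    refine std_hom_ext (K := K) (n := n) (l := l) (c := c)
      (f := (RingHom.comp _ (stdBC ψ n l c).hom)) (g := t.inl.hom) ?_ ?_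
    · intro r
      have h2 : t.inl.hom (algebraMap K _ r) = t.inr.hom (ψ r) :=
        congrArg (fun e => e.hom r) t.condition
      rw [h2]
      have h3 : (stdBC ψ n l c).hom (algebraMap K _ r) = algebraMap K' _ (ψ r) :=
        stdLift_algebraMap (K := K) (l := l) (c := c) _ _ (std_prod (K := K')) _
      rw [RingHom.comp_apply, h3]
      exact stdLift_algebraMap _ _ _ _
    · intro i
      rw [RingHom.comp_apply, stdBC_coord]
      exact stdLift_coord _ _ _ _
  · ext r
    exact stdLift_algebraMap (K := K') (l := l) (c := ψ c) _ _ (hp t) _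
  · intro m h1 h2
    apply CommRingCat.hom_ext
    refine std_hom_ext (K := K') (n := n) (l := l) (c := ψ c)
      (f := m.hom) ?_ ?_
    · intro r
      refine Eq.trans (congrArg (fun e => e.hom r) h2) ?_
      exact (stdLift_algebraMap _ _ (hp t) _).symm
    · intro i
      refine Eq.trans ?_ (stdLift_coord _ _ (hp t) _).symm
      rw [← stdBC_coord ψ n l c i]
      exact congrArg (fun e => e.hom (stdCoord K n l c i)) h1

/-- base change of an affine chart -/
lemma chart_bc {K K' : CommRingCat.{u}} (ψ : K ⟶ K') (n l : ℕ) (c : K) {E : CommRingCat.{u}}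
    (θ : CommRingCat.of (stdRing K n l c) ⟶ E) (hθ : Etale (Spec.map θ)) :
    ∃ (E' : CommRingCat.{u}) (j : E ⟶ E') (θ' : CommRingCat.of (stdRing K' n l (ψ c)) ⟶ E'),
      Etale (Spec.map θ') ∧ IsPushout (stdA K n l c ≫ θ) ψ j (stdA K' n l (ψ c) ≫ θ') ∧
      ∀ i, θ'.hom (stdCoord K' n l (ψ c) i) = j.hom (θ.hom (stdCoord K n l c i)) := by
  have h1 := std_isPushout ψ n l c
  have h2 := IsPushout.of_hasPushout θ (stdBC ψ n l c)
  refine ⟨_, _, pushout.inr θ (stdBC ψ n l c), ?_, h1.paste_horiz h2, ?_⟩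
  · exact MorphismProperty.of_isPullback (P := @Etale) (isPullback_SpecMap_of_isPushout _ _ _ _ h2) hθ
  · intro i
    rw [← stdBC_coord ψ n l c i]
    exact (congrArg (fun e => e.hom (stdCoord K n l c i)) h2.w).symm

/-- affine charts at a point -/
structure Ch {K : CommRingCat.{u}} {Y : Scheme.{u}} (f : Y ⟶ Spec K) (y : Y) (n l : ℕ) (c : K) where
  E : CommRingCat.{u}
  g : Spec E ⟶ Y
  q : Spec E
  θ : CommRingCat.of (stdRing K n l c) ⟶ E
  g_et : Etale g
  θ_et : Etale (Spec.map θ)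
  hq : g q = y
  comm : Spec.map (stdA K n l c ≫ θ) = g ≫ f

/-- coordinate on a chart -/
def Ch.co {K : CommRingCat.{u}} {Y : Scheme.{u}} {f : Y ⟶ Spec K} {y : Y} {n l : ℕ} {c : K}
    (C : Ch f y n l c) (i : Fin n) : C.E := C.θ.hom (stdCoord K n l c i)

lemma isPullback_point {W X Y Z : Scheme.{u}} {a : W ⟶ X} {b : W ⟶ Y} {f : X ⟶ Z} {g : Y ⟶ Z}
    (h : IsPullback a b f g) (x : X) (y : Y) (e : f x = g y) : ∃ w, a w = x ∧ b w = y := by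
  obtain ⟨z, hz1, hz2⟩ := Scheme.Pullback.exists_preimage_pullback x y e
  refine ⟨h.isoPullback.inv z, ?_, ?_⟩
  · rw [← Scheme.Hom.comp_apply, h.isoPullback_inv_fst, hz1]
  · rw [← Scheme.Hom.comp_apply, h.isoPullback_inv_snd, hz2]

lemma Ch.baseChange {K K' : CommRingCat.{u}} {Y Y' : Scheme.{u}} {f : Y ⟶ Spec K} {y : Y} {n l : ℕ}
    {c : K} (C : Ch f y n l c) (ψ : K ⟶ K') {p : Y' ⟶ Y} {f' : Y' ⟶ Spec K'}
    (hp : IsPullback p f' f (Spec.map ψ)) (y' : Y') (hy : p y' = y) :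
    ∃ C' : Ch f' y' n l (ψ c), ∃ j : C.E ⟶ C'.E, C.q = Spec.map j C'.q ∧
      Spec.map j ≫ C.g = C'.g ≫ p ∧ ∀ i, C'.co i = j.hom (C.co i) := by
  obtain ⟨E', j, θ', h1, h2, h3⟩ := chart_bc ψ n l c C.θ C.θ_et
  have h4 := isPullback_SpecMap_of_isPushout _ _ _ _ h2
  rw [C.comm] at h4
  have h5 := IsPullback.of_bot' h4 hp
  obtain ⟨q', hq1, hq2⟩ := isPullback_point h5 C.q y' (by rw [C.hq, hy])
  refine ⟨⟨E', _, q', θ', ?_, h1, hq2, ?_⟩, j, hq1.symm, ?_, h3⟩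
  · exact MorphismProperty.of_isPullback (P := @Etale) h5 C.g_et
  · rw [hp.lift_snd]
  · rw [hp.lift_fst]

lemma Ch.ofScheme {K : CommRingCat.{u}} {Y : Scheme.{u}} (n l : ℕ)
    (c : K) {S : Scheme.{u}} (e : Spec K ⟶ S) {f : Y ⟶ S} {U : Scheme.{u}} (gX : U ⟶ Y) (hX : Etale gX)
    (gT : U ⟶ Spec (CommRingCat.of (stdRing K n l c))) (hT : Etale gT) (x' : U)
    (comm : gT ≫ Spec.map (stdA K n l c) ≫ e = gX ≫ f) : 
    ∃ (E : CommRingCat.{u}) (g : Spec E ⟶ Y) (q : Spec E) (θ : CommRingCat.of (stdRing K n l c) ⟶ E),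
    Etale g ∧ Etale (Spec.map θ) ∧ g q = gX x' ∧ Spec.map (stdA K n l c ≫ θ) ≫ e = g ≫ f ∧ 
      Spec.map θ q = gT x' := by
  obtain ⟨V, hV, hx, -⟩ := exists_isAffineOpen_mem_and_subset (X := U) (U := ⊤) (x := x') trivial
  obtain ⟨q, hq⟩ : x' ∈ Set.range hV.fromSpec := by rw [hV.range_fromSpec]; exact hx
  refine ⟨Γ(U, V), hV.fromSpec ≫ gX, q, Spec.preimage (hV.fromSpec ≫ gT), inferInstance, ?_, ?_, ?_, ?_⟩
  · rw [Spec.map_preimage]; infer_instance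
  · rw [Scheme.Hom.comp_apply, hq]
  · rw [Spec.map_comp, Spec.map_preimage, Category.assoc, Category.assoc, Category.assoc, ← comm]
  · rw [Spec.map_preimage, Scheme.Hom.comp_apply, hq]

end scheme


section hensel
open IsLocalRing

lemma hensel_section {R R' : Type u} [CommRing R] [HenselianLocalRing R]
    [IsSepClosed (ResidueField R)] [CommRing R'] [Algebra R R'] [Algebra.Etale R R']
    (P : Ideal R') [P.IsPrime] (hP : P.comap (algebraMap R R') = maximalIdeal R) :
    ∃ σ : R' →ₐ[R] R, (maximalIdeal R).comap σ.toRingHom = P := by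
  let L := Localization.AtPrime P
  haveI : IsLocalHom (algebraMap R L) := by
    constructor
    intro a ha
    by_contra h
    have h1 : a ∈ P.comap (algebraMap R R') := by rw [hP]; exact h
    rw [IsScalarTower.algebraMap_apply R R' L] at ha
    exact (IsLocalization.AtPrime.isUnit_to_map_iff L P _).1 ha h1
  haveI : Algebra.FormallyUnramified R L := by
    haveI : Algebra.FormallyUnramified R' L := .of_isLocalization P.primeCompl
    exact .comp R R' L
  haveI : Algebra.EssFiniteType R L := by
    haveI : Algebra.EssFiniteType R' L := .of_isLocalization _ P.primeCompl
    exact .comp R R' L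
  have hb : Function.Bijective (algebraMap (ResidueField R) (ResidueField L)) :=
    IsSepClosed.algebraMap_bijective _ _
  haveI : Algebra.IsEtaleAt R P := by
    haveI : Algebra.FormallyEtale R' L := .of_isLocalization P.primeCompl
    exact Algebra.FormallyEtale.comp R R' L
  obtain ⟨f, hf, hse⟩ := Algebra.IsEtaleAt.exists_isStandardEtale (R := R) P
  obtain ⟨Q⟩ := hse.nonempty_standardEtalePresentation
  -- the map to the residue field
  let ρ0 : R' →ₐ[R] ResidueField L := IsScalarTower.toAlgHom R R' (ResidueField L)
  have hρ0 : ∀ r : R', ρ0 r = 0 ↔ r ∈ P := by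
    intro r
    change residue L (algebraMap R' L r) = 0 ↔ _
    rw [residue_eq_zero_iff, mem_maximalIdeal, mem_nonunits_iff,
      IsLocalization.AtPrime.isUnit_to_map_iff L P, Ideal.mem_primeCompl_iff, not_not]
  let ρ : Localization.Away f →ₐ[R] ResidueField L :=
    IsLocalization.liftAlgHom (M := Submonoid.powers f) (f := ρ0) (by
      rintro ⟨_, k, rfl⟩
      rw [map_pow]
      refine IsUnit.pow _ (isUnit_iff_ne_zero.2 fun h => hf ((hρ0 f).1 h)))
  have hρ : ∀ r, ρ (algebraMap _ _ r) = ρ0 r := fun r => IsLocalization.lift_eq _ _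
  obtain ⟨a0, ha0⟩ := hb.2 (ρ Q.x)
  have hx := Q.hasMap.map ρ
  have hx' := hx.isUnit_derivative_f
  have hae : ∀ p : Polynomial R, algebraMap (ResidueField R) (ResidueField L) (Polynomial.aeval a0 p) =
      Polynomial.aeval (ρ Q.x) p := by
    intro p
    rw [← ha0, Polynomial.aeval_algebraMap_apply]
  have H : ∀ f : Polynomial R, f.Monic → ∀ a₀ : ResidueField R, Polynomial.aeval a₀ f = 0 →
      Polynomial.aeval a₀ (Polynomial.derivative f) ≠ 0 → ∃ a : R, f.IsRoot a ∧ residue R a = a₀ :=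
    ((HenselianLocalRing.TFAE R).out 0 1).1 ‹HenselianLocalRing R›
  obtain ⟨a, ha, haa⟩ := H Q.f Q.monic_f a0
    (hb.1 (by rw [hae, map_zero]; exact hx.1)) (fun h => hx'.ne_zero (by rw [← hae, h, map_zero]))
  have hres : algebraMap R (ResidueField L) a = ρ Q.x := by
    rw [← ha0, ← haa]; rfl
  have hm : Q.P.HasMap a := by
    refine ⟨by simpa [Polynomial.IsRoot.def, Polynomial.aeval_def, Polynomial.eval₂_id] using ha, ?_⟩
    by_contra h
    have h1 : algebraMap R (ResidueField L) (Polynomial.aeval a Q.g) = 0 := by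
      rw [IsScalarTower.algebraMap_apply R (ResidueField R)]
      have : algebraMap R (ResidueField R) (Polynomial.aeval a Q.g) = 0 :=
        (residue_eq_zero_iff _).2 h
      rw [this, map_zero]
    rw [← Polynomial.aeval_algebraMap_apply, hres] at h1
    exact hx.2.ne_zero h1
  let τ : Localization.Away f →ₐ[R] R := (Q.P.lift a hm).comp Q.equivRing.toAlgHom
  have hτ : (Algebra.ofId R (ResidueField L)).comp τ = ρ := by
    apply Q.hom_ext
    change algebraMap R (ResidueField L) (Q.P.lift a hm (Q.equivRing Q.x)) = _
    rw [Q.equivRing_x, Q.P.lift_X, hres]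
  refine ⟨τ.comp (IsScalarTower.toAlgHom R R' _), ?_⟩
  ext r
  rw [← hρ0, ← hρ, ← hτ]
  change τ (algebraMap R' _ r) ∈ maximalIdeal R ↔ algebraMap R (ResidueField L) (τ (algebraMap R' _ r)) = 0
  rw [IsScalarTower.algebraMap_apply R (ResidueField R), map_eq_zero_iff _ hb.1]
  exact (residue_eq_zero_iff _).symm

/-- charts over a strictly henselian base -/
lemma chart_henselian (R : CommRingCat.{u}) (hsh : StrictlyHenselianLocal R) {X : Scheme.{u}}
    (f : X ⟶ Spec R) (x : X) (hx : f x = closedPt R hsh.toIsLocalRing) (D : ChartData f x) :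
    ∃ (n l : ℕ) (_ : l ≤ n) (b : R), Nonempty (Ch f x n l b) := by
  obtain ⟨E, g, q, θ, g_et, θ_et, hq, comm, -⟩ := Ch.ofScheme D.n D.l D.b D.etS (f := f) D.gX D.gX_etale D.gT
    D.gT_etale D.x' D.comm
  obtain ⟨ε, hε⟩ : ∃ ε : R ⟶ D.R, Spec.map ε = D.etS := ⟨_, Spec.map_preimage _⟩
  let s' := Spec.map (stdA D.R D.n D.l D.b ≫ θ) q
  have hs' : Spec.map ε s' = closedPt R hsh.toIsLocalRing := by
    have hgx : g q = x := hq.trans D.hx'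
    have h1 : Spec.map ε s' = f (g q) := by
      rw [← Scheme.Hom.comp_apply, ← Scheme.Hom.comp_apply, ← comm, hε]
    exact h1.trans (hgx ▸ hx)
  haveI := hsh.henselian
  haveI := hsh.sepClosedResidue
  have hεe : Etale (Spec.map ε) := by rw [hε]; exact D.etS_etale
  letI : Algebra R D.R := ε.hom.toAlgebra
  haveI : Algebra.Etale R D.R := (HasRingHomProperty.Spec_iff (P := @Etale)).1 hεe
  haveI : s'.asIdeal.IsPrime := s'.2
  obtain ⟨σ, hσ⟩ := hensel_section (R := R) (R' := D.R) s'.asIdeal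
    (congrArg PrimeSpectrum.asIdeal hs')
  let σ' : D.R ⟶ R := CommRingCat.ofHom σ.toRingHom
  have hσ' : ε ≫ σ' = 𝟙 R := by
    ext r
    exact σ.commutes r
  have hσe : Etale (Spec.map σ') := by
    have : Etale (Spec.map σ' ≫ Spec.map ε) := by
      rw [← Spec.map_comp, hσ', Spec.map_id]; infer_instance
    exact Etale.of_comp (Spec.map σ') (Spec.map ε)
  obtain ⟨E', j, θ', h1, h2, h3⟩ := chart_bc σ' D.n D.l D.b θ θ_et
  have h4 := isPullback_SpecMap_of_isPushout _ _ _ _ h2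
  obtain ⟨q', hq1, hq2⟩ := isPullback_point h4 q (closedPt R hsh.toIsLocalRing) (by
    apply PrimeSpectrum.ext; exact hσ.symm)
  refine ⟨D.n, D.l, D.hln, σ' D.b, ⟨⟨E', Spec.map j ≫ g, q', θ', ?_, h1, ?_, ?_⟩⟩⟩
  · have : Etale (Spec.map j) := MorphismProperty.of_isPullback (P := @Etale) h4.flip hσe
    infer_instance
  · rw [Scheme.Hom.comp_apply, hq1, hq, D.hx']
  · rw [Category.assoc, ← comm, ← Category.assoc, h4.w, Category.assoc, ← hε, ← Spec.map_comp, hσ',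
      Spec.map_id, Category.comp_id]

end hensel


section stalks
open IsLocalRing

lemma loc_tower {B S T : Type*} [CommRing B] [CommRing S] [CommRing T] [Algebra B S] [Algebra B T]
    [Algebra S T] [IsScalarTower B S T] [IsLocalRing T] (p q : Ideal B) [p.IsPrime] [q.IsPrime]
    [IsLocalization.AtPrime S p] [IsLocalization.AtPrime T q] :
    IsLocalization.AtPrime T ((maximalIdeal T).comap (algebraMap S T)) := by
  have hle : p.primeCompl ≤ q.primeCompl := by
    intro r hr
    have h1 := (IsLocalization.AtPrime.isUnit_to_map_iff S p r).2 hr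
    have h2 := h1.map (algebraMap S T)
    rw [← IsScalarTower.algebraMap_apply] at h2
    exact (IsLocalization.AtPrime.isUnit_to_map_iff T q r).1 h2
  have := IsLocalization.isLocalization_of_submonoid_le S T p.primeCompl q.primeCompl hle
  refine @IsLocalization.isLocalization_of_is_exists_mul_mem _ _ _ _ _ _ _ this ?_ ?_
  · rintro _ ⟨r, hr, rfl⟩ h
    have h2 := (IsLocalization.AtPrime.isUnit_to_map_iff T q r).2 hr
    rw [SetLike.mem_coe, Ideal.mem_comap, ← IsScalarTower.algebraMap_apply] at h
    exact h h2
  · rintro ⟨x, hx⟩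
    obtain ⟨⟨y, s⟩, e⟩ := IsLocalization.surj p.primeCompl x
    refine ⟨algebraMap B S s, y, ?_, by rw [mul_comm, ← e]⟩
    have hx' : IsUnit (algebraMap S T x) := by
      by_contra h; exact hx h
    have h3 := congrArg (algebraMap S T) e
    rw [map_mul, ← IsScalarTower.algebraMap_apply, ← IsScalarTower.algebraMap_apply] at h3
    refine (IsLocalization.AtPrime.isUnit_to_map_iff T q y).1 ?_
    dsimp only at h3
    rw [← h3]
    exact hx'.mul ((IsLocalization.AtPrime.isUnit_to_map_iff T q _).2 (hle s.2))

/-- a prime ideal as a point. -/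
def pt (R : CommRingCat.{u}) (P : Ideal R) [h : P.IsPrime] : Spec R := (⟨P, h⟩ : PrimeSpectrum R)

/-- the prime of the local ring at `y` given by a generization `z`. -/
def genPrime {X : Scheme.{u}} {z y : X} (h : z ⤳ y) : Ideal (X.presheaf.stalk y) :=
  (maximalIdeal (X.presheaf.stalk z)).comap (X.presheaf.stalkSpecializes h).hom

instance genPrime_isPrime {X : Scheme.{u}} {z y : X} (h : z ⤳ y) : (genPrime h).IsPrime := by
  unfold genPrime; infer_instance

lemma stalk_loc {X : Scheme.{u}} {z y : X} (h : z ⤳ y) :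
    @IsLocalization.AtPrime (X.presheaf.stalk y) _ (X.presheaf.stalk z) _
      (X.presheaf.stalkSpecializes h).hom.toAlgebra (genPrime h) _ := by
  obtain ⟨W, hW, hyW, -⟩ := exists_isAffineOpen_mem_and_subset (X := X) (x := y) (U := ⊤) trivial
  have hzW : z ∈ W := h.mem_open W.2 hyW
  letI := (X.presheaf.stalkSpecializes h).hom.toAlgebra
  letI a1 : Algebra Γ(X, W) (X.presheaf.stalk y) := (X.presheaf.germ W y hyW).hom.toAlgebra
  letI a2 : Algebra Γ(X, W) (X.presheaf.stalk z) := (X.presheaf.germ W z hzW).hom.toAlgebra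
  haveI l1 : IsLocalization.AtPrime (X.presheaf.stalk y) (hW.primeIdealOf ⟨y, hyW⟩).asIdeal :=
    hW.isLocalization_stalk ⟨y, hyW⟩
  haveI l2 : IsLocalization.AtPrime (X.presheaf.stalk z) (hW.primeIdealOf ⟨z, hzW⟩).asIdeal :=
    hW.isLocalization_stalk ⟨z, hzW⟩
  haveI : IsScalarTower Γ(X, W) (X.presheaf.stalk y) (X.presheaf.stalk z) := by
    refine IsScalarTower.of_algebraMap_eq (R := Γ(X, W)) fun r => ?_
    exact (TopCat.Presheaf.germ_stalkSpecializes_apply X.presheaf _ _ _).symm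
  exact loc_tower (B := Γ(X, W)) (hW.primeIdealOf ⟨y, hyW⟩).asIdeal (hW.primeIdealOf ⟨z, hzW⟩).asIdeal

lemma genPrime_pt {X : Scheme.{u}} {z y : X} (h : z ⤳ y) :
    X.fromSpecStalk y (pt _ (genPrime h)) = z := by
  have h1 := Scheme.SpecMap_stalkSpecializes_fromSpecStalk h
  have h2 := congrArg (fun g : Spec (X.presheaf.stalk z) ⟶ X => g (closedPoint _)) h1
  exact h2.trans Scheme.fromSpecStalk_closedPoint

lemma exists_genPrime {X : Scheme.{u}} {y : X} (P : Ideal (X.presheaf.stalk y)) [hP : P.IsPrime] :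
    ∃ (z : X) (h : z ⤳ y), genPrime h = P ∧ X.fromSpecStalk y (pt _ P) = z := by
  have h : X.fromSpecStalk y (pt _ P) ⤳ y := by
    have : X.fromSpecStalk y (pt _ P) ∈ Set.range (X.fromSpecStalk y) := ⟨_, rfl⟩
    rwa [Scheme.range_fromSpecStalk] at this
  refine ⟨_, h, ?_, rfl⟩
  have h1 := genPrime_pt h
  have h2 := (X.fromSpecStalk y).isEmbedding.injective h1
  exact congrArg PrimeSpectrum.asIdeal h2

lemma genPrime_le {X : Scheme.{u}} {z z' y : X} (h : z ⤳ y) (h' : z' ⤳ y) :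
    genPrime h ≤ genPrime h' ↔ z ⤳ z' := by
  have := (X.fromSpecStalk y).isEmbedding.specializes_iff (x := pt _ (genPrime h))
    (y := pt _ (genPrime h'))
  rw [genPrime_pt, genPrime_pt] at this
  rw [this]
  exact PrimeSpectrum.le_iff_specializes (⟨genPrime h, inferInstance⟩ : PrimeSpectrum _)
    (⟨genPrime h', inferInstance⟩ : PrimeSpectrum _)

/-- the map from the base ring to a local ring. -/
def gm {A : CommRingCat.{u}} {Y : Scheme.{u}} (F : Y ⟶ Spec A) (y : Y) : A ⟶ Y.presheaf.stalk y :=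
  Spec.preimage (Y.fromSpecStalk y ≫ F)

lemma gm_map {A : CommRingCat.{u}} {Y : Scheme.{u}} (F : Y ⟶ Spec A) (y : Y) :
    Spec.map (gm F y) = Y.fromSpecStalk y ≫ F := Spec.map_preimage _

lemma gm_spec {A : CommRingCat.{u}} {Y : Scheme.{u}} (F : Y ⟶ Spec A) {z y : Y} (h : z ⤳ y) :
    gm F y ≫ Y.presheaf.stalkSpecializes h = gm F z := by
  apply Spec.map_injective
  rw [Spec.map_comp, gm_map, gm_map, Scheme.SpecMap_stalkSpecializes_fromSpecStalk_assoc]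

lemma gm_comp {A : CommRingCat.{u}} {Y W : Scheme.{u}} (F : Y ⟶ Spec A) (g : W ⟶ Y) (w : W) :
    gm F (g w) ≫ g.stalkMap w = gm (g ≫ F) w := by
  apply Spec.map_injective
  rw [Spec.map_comp, gm_map, gm_map, Scheme.SpecMap_stalkMap_fromSpecStalk_assoc]

/-- the localization map to the stalk of an affine scheme. -/
def toSt {E : CommRingCat.{u}} (q : Spec E) : E ⟶ (Spec E).presheaf.stalk q :=
  (Scheme.ΓSpecIso E).inv ≫ (Spec E).presheaf.germ ⊤ q trivial

lemma toSt_loc {E : CommRingCat.{u}} (q : Spec E) :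
    haveI : q.asIdeal.IsPrime := q.2
    @IsLocalization.AtPrime E _ ((Spec E).presheaf.stalk q) _ (toSt q).hom.toAlgebra q.asIdeal _ :=
  StructureSheaf.IsLocalization.to_stalk (R := E) q

lemma gm_Spec {A E : CommRingCat.{u}} (φ : A ⟶ E) (q : Spec E) :
    gm (Spec.map φ) q = φ ≫ toSt q := by
  apply Spec.map_injective
  rw [Spec.map_comp, gm_map, Spec.fromSpecStalk_eq]
  rfl

lemma gm_germ {A : CommRingCat.{u}} {Y : Scheme.{u}} (F : Y ⟶ Spec A) (y : Y) :
    gm F y = (Scheme.ΓSpecIso A).inv ≫ F.appTop ≫ Y.presheaf.germ ⊤ y trivial := by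
  apply Spec.map_injective
  rw [gm_map]
  have h := Scheme.fromSpecStalk_toSpecΓ Y y
  have h2 := Scheme.toSpecΓ_naturality F
  rw [Spec.map_comp, Spec.map_comp, Category.assoc, ← Scheme.fromSpecStalk_toSpecΓ_assoc,
    ← Scheme.toSpecΓ_naturality_assoc]
  simp

lemma mem_genPrime {A : CommRingCat.{u}} {Y : Scheme.{u}} (F : Y ⟶ Spec A) {z y : Y} (h : z ⤳ y)
    (a : A) : gm F y a ∈ genPrime h ↔ a ∈ (F z).asIdeal := by
  have h1 : F z = Spec.map (gm F y) (pt _ (genPrime h)) := by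
    rw [gm_map, Scheme.Hom.comp_apply, genPrime_pt]
  rw [h1]
  rfl

lemma isUnit_gm {A : CommRingCat.{u}} {Y : Scheme.{u}} (F : Y ⟶ Spec A) (y : Y)
    (a : A) : IsUnit (gm F y a) ↔ a ∉ (F y).asIdeal := by
  rw [← mem_genPrime F (specializes_refl y) a]
  have : genPrime (specializes_refl y) = maximalIdeal _ := by
    unfold genPrime
    rw [TopCat.Presheaf.stalkSpecializes_refl]
    exact Ideal.comap_id _
  rw [this, mem_maximalIdeal, mem_nonunits_iff, not_not]

instance stalk_noeth {Y : Scheme.{u}} [IsLocallyNoetherian Y] (y : Y) :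
    IsNoetherianRing (Y.presheaf.stalk y) := inferInstance

/-- smooth schemes over a factorial base are normal -/
lemma stalk_normal {A : CommRingCat.{u}} [IsDomain A] [UniqueFactorizationMonoid A]
    {Y : Scheme.{u}} (F : Y ⟶ Spec A) (y : Y) (h : SmoothAtPt F y) :
    ∃ _ : IsDomain (Y.presheaf.stalk y), IsIntegrallyClosed (Y.presheaf.stalk y) := by
  obtain ⟨U, hyU, hU⟩ := h
  obtain ⟨W, hW, hyW, hWU⟩ := exists_isAffineOpen_mem_and_subset (X := Y) (x := y) (U := U) hyU
  have h1 : Smooth (hW.fromSpec ≫ F) := by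
    have hWU' : W ≤ U := hWU
    have : hW.fromSpec ≫ F = (hW.isoSpec.inv ≫ Y.homOfLE hWU') ≫ U.ι ≫ F := by
      rw [Category.assoc, Scheme.homOfLE_ι_assoc, ← Category.assoc]; rfl
    rw [this]
    haveI : Smooth (U.ι ≫ F) := hU
    exact MorphismProperty.comp_mem _ _ _ inferInstance this
  obtain ⟨φ, hφ⟩ : ∃ φ : A ⟶ Γ(Y, W), Spec.map φ = hW.fromSpec ≫ F := ⟨_, Spec.map_preimage _⟩
  rw [← hφ] at h1
  letI : Algebra A Γ(Y, W) := φ.hom.toAlgebra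
  haveI : Algebra.Smooth A Γ(Y, W) := (HasRingHomProperty.Spec_iff (P := @Smooth)).1 h1
  letI a1 : Algebra Γ(Y, W) (Y.presheaf.stalk y) := (Y.presheaf.germ W y hyW).hom.toAlgebra
  haveI l1 : IsLocalization.AtPrime (Y.presheaf.stalk y) (hW.primeIdealOf ⟨y, hyW⟩).asIdeal :=
    hW.isLocalization_stalk ⟨y, hyW⟩
  exact smooth_local_normal (A := A) (B := Γ(Y, W)) (hW.primeIdealOf ⟨y, hyW⟩).asIdeal

end stalks


section chartstalk
open IsLocalRing

lemma stalkMap_ff {X Y : Scheme.{u}} (g : X ⟶ Y) [Flat g] (w : X) :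
    @Module.FaithfullyFlat (Y.presheaf.stalk (g w)) (X.presheaf.stalk w) _ _
      (g.stalkMap w).hom.toAlgebra.toModule := by
  letI := (g.stalkMap w).hom.toAlgebra
  haveI : Module.Flat (Y.presheaf.stalk (g w)) (X.presheaf.stalk w) := Flat.stalkMap g w
  haveI : IsLocalHom (algebraMap (Y.presheaf.stalk (g w)) (X.presheaf.stalk w)) :=
    inferInstanceAs (IsLocalHom (g.stalkMap w).hom)
  exact Module.FaithfullyFlat.of_flat_of_isLocalHom

lemma stalkMap_inj {X Y : Scheme.{u}} (g : X ⟶ Y) [Flat g] (w : X) :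
    Function.Injective (g.stalkMap w).hom := by
  letI := (g.stalkMap w).hom.toAlgebra
  haveI := stalkMap_ff g w
  exact FaithfulSMul.algebraMap_injective (Y.presheaf.stalk (g w)) (X.presheaf.stalk w)

variable {K : CommRingCat.{u}} {Y : Scheme.{u}} {F : Y ⟶ Spec K} {y : Y} {n l : ℕ} {c : K}

/-- the structure map of a chart -/
def Ch.a (C : Ch F y n l c) : K ⟶ C.E := stdA K n l c ≫ C.θ

lemma Ch.comm' (C : Ch F y n l c) : C.g ≫ F = Spec.map C.a := C.comm.symm

lemma Ch.flat (C : Ch F y n l c) : Flat C.g := by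
  haveI := C.g_et
  infer_instance

lemma Ch.gm_st (C : Ch F y n l c) (w : Spec C.E) (r : K) :
    (C.g.stalkMap w).hom (gm F (C.g w) r) = (toSt w).hom (C.a r) := by
  have h1 := gm_comp F C.g w
  rw [C.comm', gm_Spec] at h1
  exact congrArg (fun φ => φ.hom r) h1

lemma toSt_flat {E : CommRingCat.{u}} (q : Spec E) : 
    @Module.Flat E ((Spec E).presheaf.stalk q) _ _ (toSt q).hom.toAlgebra.toModule := by
  letI := (toSt q).hom.toAlgebra
  haveI : q.asIdeal.IsPrime := q.2
  haveI := toSt_loc q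
  exact IsLocalization.flat _ q.asIdeal.primeCompl

lemma Ch.nil_of (C : Ch F y n l c) (w : Spec C.E) (r : K) (k : ℕ) (h : C.a r ^ k = 0) :
    (gm F (C.g w) r) ^ k = 0 := by
  haveI := C.flat
  apply stalkMap_inj C.g w
  rw [map_pow, C.gm_st, ← map_pow, h, map_zero, map_zero]

lemma Ch.nzd_of (C : Ch F y n l c) (w : Spec C.E) (r : K) (h : ∀ a : C.E, C.a r * a = 0 → a = 0)
    (a : Y.presheaf.stalk (C.g w)) (ha : gm F (C.g w) r * a = 0) : a = 0 := by
  haveI := C.flat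
  apply stalkMap_inj C.g w
  rw [map_zero]
  letI := (toSt w).hom.toAlgebra
  haveI := toSt_flat w
  refine nzd_flat (S := C.E) (C.a r) h _ ?_
  have := congrArg (C.g.stalkMap w).hom ha
  rw [map_mul, C.gm_st, map_zero] at this
  exact this

lemma Ch.dichotomy {K : CommRingCat.{u}} [IsDomain K] [IsDiscreteValuationRing K]
    {Y : Scheme.{u}} {F : Y ⟶ Spec K} {y : Y} {n l : ℕ} {c : K}
    (C : Ch F y n l c) (hln : l ≤ n) (ϖ : K) (hϖ : Irreducible ϖ) :
    (∀ a : C.E, C.a ϖ * a = 0 → a = 0) ∨ ∃ k : ℕ, C.a ϖ ^ k = 0 := by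
  letI : Algebra (stdRing K n l c) C.E := C.θ.hom.toAlgebra
  letI : Algebra K C.E := C.a.hom.toAlgebra
  haveI : IsScalarTower K (stdRing K n l c) C.E := by
    refine IsScalarTower.of_algebraMap_eq (R := K) (S := stdRing K n l c) (A := C.E) fun r => rfl
  haveI : Algebra.Etale (stdRing K n l c) C.E := (HasRingHomProperty.Spec_iff (P := @Etale)).1 C.θ_et
  exact std_dichotomy (A := K) (n := n) (l := l) c (E := C.E) hln ϖ hϖ

end chartstalk

section tlevel
open IsLocalRing

/-- Standing assumptions over a trait. -/
structure TS {A : CommRingCat.{u}} [IsDomain A] [IsDiscreteValuationRing A] {Y : Scheme.{u}}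
    (F : Y ⟶ Spec A) (ϖ : A) : Prop where
  irr : Irreducible ϖ
  noeth : IsLocallyNoetherian Y
  proper : IsProper F
  charts : ∀ y, ϖ ∈ (F y).asIdeal → ∃ (n l : ℕ) (_ : l ≤ n) (c : A), Nonempty (Ch F y n l c)
  sm : ∀ y, ϖ ∉ (F y).asIdeal → SmoothAtPt F y
  conn : GeomConnFibers F

variable {A : CommRingCat.{u}} [IsDomain A] [IsDiscreteValuationRing A] {Y : Scheme.{u}}
    {F : Y ⟶ Spec A} {ϖ : A}

lemma dvr_pt (hϖ : Irreducible ϖ) (p : Spec A) (h : ϖ ∈ p.asIdeal) : p = closedPt A inferInstance := by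
  haveI := p.2
  apply PrimeSpectrum.ext
  change _ = maximalIdeal A
  refine (IsLocalRing.eq_maximalIdeal ?_)
  refine Ideal.IsPrime.isMaximal p.2 fun h0 => ?_
  have h1 : ϖ ∈ (⊥ : Ideal A) := h0 ▸ h
  exact hϖ.ne_zero h1

lemma dvr_pt' (hϖ : Irreducible ϖ) : ϖ ∈ (closedPt A inferInstance : Spec A).asIdeal := hϖ.not_isUnit

lemma TS.gm_nil_open (k : ℕ) : IsOpen {y : Y | (gm F y ϖ) ^ k = 0} := by
  rw [isOpen_iff_mem_nhds]
  intro y hy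
  have h1 : Y.presheaf.germ ⊤ y trivial ((((Scheme.ΓSpecIso A).inv ≫ F.appTop) ϖ) ^ k) =
      Y.presheaf.germ ⊤ y trivial 0 := by
    rw [map_zero, map_pow, ← hy, gm_germ]; rfl
  obtain ⟨W, hW, i1, i2, e⟩ := Y.presheaf.germ_eq y _ _ _ _ h1
  refine Filter.mem_of_superset (W.2.mem_nhds hW) fun z hz => ?_
  have h2 := congrArg (Y.presheaf.germ W z hz) e
  rw [TopCat.Presheaf.germ_res_apply, TopCat.Presheaf.germ_res_apply, map_zero, map_pow] at h2
  change _ ^ k = 0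
  rw [gm_germ]; exact h2

lemma TS.clopen (H : TS F ϖ) : IsClopen {y : Y | ∃ k, (gm F y ϖ) ^ k = 0} := by
  refine ⟨⟨?_⟩, ?_⟩
  · rw [isOpen_iff_mem_nhds]
    intro y hy
    by_cases hF : ϖ ∈ (F y).asIdeal
    · obtain ⟨n, l, hln, c, ⟨C⟩⟩ := H.charts y hF
      haveI := C.g_et
      have ho : IsOpen (Set.range C.g) := C.g.isOpenMap.isOpen_range
      refine Filter.mem_of_superset (ho.mem_nhds ⟨C.q, C.hq⟩) ?_
      rintro _ ⟨w, rfl⟩ ⟨k, hk⟩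
      rcases C.dichotomy hln ϖ H.irr with h | ⟨k', h⟩
      · have h2 : ∀ j, (gm F (C.g w) ϖ) ^ j = 0 → False := by
          intro j
          induction j with
          | zero => intro h; rw [pow_zero] at h; exact one_ne_zero h
          | succ j ih => intro h'; rw [pow_succ'] at h'; exact ih (C.nzd_of w ϖ h _ h')
        exact h2 k hk
      · refine hy ⟨k', ?_⟩
        have := C.nil_of C.q ϖ k' h
        rwa [C.hq] at this
    · have ho : IsOpen (F ⁻¹' (PrimeSpectrum.basicOpen ϖ : Set (PrimeSpectrum A))) :=
        (PrimeSpectrum.basicOpen ϖ).2.preimage F.continuous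
      refine Filter.mem_of_superset (ho.mem_nhds hF) ?_
      rintro z hz ⟨k, hk⟩
      have h1 := ((isUnit_gm F z ϖ).2 hz).pow k
      rw [hk] at h1
      exact not_isUnit_zero h1
  · rw [Set.setOf_exists]
    exact isOpen_iUnion fun k => TS.gm_nil_open k

lemma range_fst_pullback {X S T : Scheme.{u}} (f : X ⟶ S) (g : T ⟶ S) :
    Set.range (pullback.fst f g) = f ⁻¹' (Set.range g) := by
  ext x
  constructor
  · rintro ⟨w, rfl⟩
    refine ⟨pullback.snd f g w, ?_⟩
    rw [← Scheme.Hom.comp_apply, ← Scheme.Hom.comp_apply, pullback.condition]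
  · rintro ⟨t, ht⟩
    obtain ⟨w, h1, -⟩ := isPullback_point (IsPullback.of_hasPullback f g) x t ht.symm
    exact ⟨w, h1⟩

lemma TS.preconn {S X : Scheme.{u}} (f : X ⟶ S) (H : GeomConnFibers f) (K : Type u) [Field K]
    (g : Spec (CommRingCat.of K) ⟶ S) : _root_.IsConnected (f ⁻¹' (Set.range g)) := by
  let L := AlgebraicClosure K
  let g' := Spec.map (CommRingCat.ofHom (algebraMap K L)) ≫ g
  have h1 : Set.range g' = Set.range g := by
    refine (Set.range_subset_iff.2 ?_).antisymm (Set.range_subset_iff.2 ?_)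
    · intro x; exact ⟨_, rfl⟩
    · intro x
      let x0 : Spec (CommRingCat.of L) := (⊥ : PrimeSpectrum L)
      refine ⟨x0, ?_⟩
      rw [Scheme.Hom.comp_apply]
      congr 1
      exact @Subsingleton.elim (PrimeSpectrum K) _ _ _
  rw [← h1, ← range_fst_pullback]
  haveI := H L g'
  exact isConnected_range (pullback.fst f g').continuous

lemma TS.nzd (H : TS F ϖ) (y : Y) (a : Y.presheaf.stalk y) (ha : gm F y ϖ * a = 0) : a = 0 := by
  by_cases hF : ϖ ∈ (F y).asIdeal
  swap
  · exact ((isUnit_gm F y ϖ).2 hF).mul_right_eq_zero.1 ha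
  obtain ⟨n, l, hln, c, ⟨C⟩⟩ := H.charts y hF
  rcases C.dichotomy hln ϖ H.irr with h | ⟨k, h⟩
  · have := C.nzd_of C.q ϖ h
    rw [C.hq] at this
    exact this a ha
  exfalso
  have hk := C.nil_of C.q ϖ k h
  rw [C.hq] at hk
  -- connectedness of the closed fibre
  have hc := TS.preconn F H.conn (ResidueField A) (Spec.map (CommRingCat.ofHom (residue A)))
  have hr : F ⁻¹' (Set.range (Spec.map (CommRingCat.ofHom (residue A)))) =
      {y | ϖ ∈ (F y).asIdeal} := by
    ext z
    constructor
    · rintro ⟨t, ht⟩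
      change ϖ ∈ (F z).asIdeal
      rw [← ht]
      change residue A ϖ ∈ t.asIdeal
      rw [(residue_eq_zero_iff ϖ).2 H.irr.not_isUnit]
      exact zero_mem _
    · intro hz
      refine ⟨(⊥ : PrimeSpectrum (ResidueField A)), ?_⟩
      refine Eq.trans ?_ (dvr_pt H.irr _ hz).symm
      exact dvr_pt H.irr _ (by
        change residue A ϖ ∈ (⊥ : Ideal _)
        exact (residue_eq_zero_iff ϖ).2 H.irr.not_isUnit)
  rw [hr] at hc
  have hN : {y : Y | ϖ ∈ (F y).asIdeal} ⊆ {y : Y | ∃ k, (gm F y ϖ) ^ k = 0} :=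
    hc.isPreconnected.subset_isClopen H.clopen ⟨y, hF, k, hk⟩
  have hN2 : {y : Y | ϖ ∉ (F y).asIdeal} = {y : Y | ∃ k, (gm F y ϖ) ^ k = 0}ᶜ := by
    ext z
    constructor
    · rintro hz ⟨k, hk⟩
      have h1 := ((isUnit_gm F z ϖ).2 hz).pow k
      rw [hk] at h1
      exact not_isUnit_zero h1
    · intro hz hz'; exact hz (hN hz')
  have hcl : IsClosed {y : Y | ϖ ∉ (F y).asIdeal} := by
    rw [hN2]; exact H.clopen.compl.1
  haveI := H.proper
  have him := F.isClosedMap _ hcl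
  -- generic fibre is nonempty
  obtain ⟨z, t, hz⟩ := (TS.preconn F H.conn (FractionRing A)
    (Spec.map (CommRingCat.ofHom (algebraMap A (FractionRing A))))).nonempty
  have hz0 : (F z).asIdeal = ⊥ := by
    rw [← hz]
    change t.asIdeal.comap (algebraMap A (FractionRing A)) = ⊥
    haveI := t.2
    have : t.asIdeal = ⊥ := Ideal.eq_bot_of_prime (K := FractionRing A) _
    rw [this]
    exact RingHom.ker_eq_bot_iff_eq_zero _ |>.2 fun x hx => (IsFractionRing.injective A (FractionRing A)) (by rw [hx, map_zero])
  have hz1 : ϖ ∉ (F z).asIdeal := by rw [hz0]; exact H.irr.ne_zero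
  have h3 : F z ⤳ (closedPt A inferInstance : Spec A) := by
    refine (PrimeSpectrum.le_iff_specializes _ _).1 ?_
    change (F z).asIdeal ≤ _
    rw [hz0]; exact bot_le
  obtain ⟨z', hz', e⟩ := h3.mem_closed him ⟨z, hz1, rfl⟩
  apply hz'
  rw [e]
  exact dvr_pt' H.irr

end tlevel


section lmodel2

variable {O O' : Type*} [CommRing O] [CommRing O'] [Algebra O O'] [Module.FaithfullyFlat O O']
  {π : O} {ι : Type*} [Fintype ι] {x : ι → O'} {k : ℕ}

lemma LModel.exists_le (h : LModel (algebraMap O O' π) x k) (Q : Ideal O') [Q.IsPrime]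
    (hQ : algebraMap O O' π ∈ Q) : ∃ i, Ideal.span {algebraMap O O' π, x i} ≤ Q := by
  obtain ⟨u, hu, e⟩ := h.unit
  have h1 : ∏ i, x i ∈ Q := by
    rw [e]
    exact Ideal.mul_mem_right _ _ (Ideal.pow_mem_of_mem _ hQ _ h.kpos)
  obtain ⟨i, -, hi⟩ := (Ideal.IsPrime.prod_mem_iff).1 h1
  refine ⟨i, Ideal.span_le.2 ?_⟩
  rintro a (rfl | rfl)
  · exact hQ
  · exact hi

lemma ff_dvd {a b : O} (h : algebraMap O O' a ∣ algebraMap O O' b) : a ∣ b := by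
  rw [← Ideal.mem_span_singleton] at h ⊢
  have h1 := Ideal.comap_map_eq_self_of_faithfullyFlat (A := O) (B := O') (Ideal.span {a})
  rw [← h1, Ideal.mem_comap, Ideal.map_span, Set.image_singleton]
  exact h

lemma LModel.rad (h : LModel (algebraMap O O' π) x k) (a : O) (n : ℕ) (ha : π ∣ a ^ n) : π ∣ a := by
  apply ff_dvd (O' := O')
  apply h.inter
  intro i
  haveI := h.prime i
  refine Ideal.IsPrime.mem_of_pow_mem (h.prime i) n ?_
  rw [← map_pow]
  obtain ⟨r, hr⟩ := ha
  rw [hr, map_mul]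
  exact Ideal.mul_mem_right _ _ (Ideal.subset_span (by simp))

/-- the prime downstairs -/
def dpr (O : Type*) {O' : Type*} [CommRing O] [CommRing O'] [Algebra O O'] (π : O)
  {ι : Type*} (x : ι → O') (i : ι) : Ideal O :=
  (Ideal.span {algebraMap O O' π, x i}).comap (algebraMap O O')

lemma LModel.dpr_prime (h : LModel (algebraMap O O' π) x k) (i : ι) : (dpr O π x i).IsPrime := by
  haveI := h.prime i
  unfold dpr
  infer_instance

lemma mem_dpr (i : ι) : π ∈ dpr O π x i :=
  Ideal.subset_span (by simp)

lemma LModel.dpr_min (h : LModel (algebraMap O O' π) x k) (i : ι) (P : Ideal O) [P.IsPrime] (hP : π ∈ P)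
    (hle : P ≤ dpr O π x i) : P = dpr O π x i := by
  haveI := h.prime i
  refine hle.antisymm ?_
  haveI : (Ideal.span {algebraMap O O' π, x i}).LiesOver (dpr O π x i) := ⟨rfl⟩
  haveI : (dpr O π x i).IsPrime := h.dpr_prime i
  obtain ⟨Q, hQ, hQp, hlo⟩ := Ideal.exists_ideal_le_liesOver_of_le (p := P) (q := dpr O π x i) (Ideal.span {algebraMap O O' π, x i}) hle
  have hπQ : algebraMap O O' π ∈ Q := by
    have := hlo.over
    rw [this] at hP
    exact hP
  obtain ⟨j, hj⟩ := h.exists_le Q hπQ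
  have hji : j = i := by
    by_contra hne
    exact h.notMem i j (fun e => hne e.symm) (hQ (hj (Ideal.subset_span (by simp))))
  subst hji
  intro a ha
  rw [hlo.over]
  exact hj ha

lemma LModel.dpr_minimal (h : LModel (algebraMap O O' π) x k) (i : ι) :
    dpr O π x i ∈ (Ideal.span {π}).minimalPrimes := by
  refine ⟨⟨h.dpr_prime i, ?_⟩, ?_⟩
  · rw [Ideal.span_singleton_le_iff_mem]; exact mem_dpr i
  · rintro P ⟨hP, h1⟩ h2
    haveI := hP
    exact (h.dpr_min i P ((Ideal.span_singleton_le_iff_mem _).1 h1) h2).ge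

lemma LModel.eq_dpr (h : LModel (algebraMap O O' π) x k) (P : Ideal O) [P.IsPrime] (hP : π ∈ P)
    (hmin : ∀ Q : Ideal O, Q.IsPrime → π ∈ Q → Q ≤ P → Q = P) : ∃ i, P = dpr O π x i := by
  obtain ⟨Q, hQ⟩ := PrimeSpectrum.comap_surjective_of_faithfullyFlat (A := O) (B := O') ⟨P, inferInstance⟩
  have hQ' : Q.asIdeal.comap (algebraMap O O') = P := congrArg PrimeSpectrum.asIdeal hQ
  haveI := Q.2
  obtain ⟨i, hi⟩ := h.exists_le Q.asIdeal (by
    have : π ∈ Q.asIdeal.comap (algebraMap O O') := hQ' ▸ hP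
    exact this)
  refine ⟨i, (hmin _ (h.dpr_prime i) (mem_dpr i) ?_).symm⟩
  rw [← hQ']
  exact Ideal.comap_mono hi

end lmodel2


section tlevel2
open IsLocalRing

lemma SmoothAtPt.comp_etale {X Y S : Scheme.{u}} {F : Y ⟶ S} (g : X ⟶ Y) [Etale g] (w : X)
    (h : SmoothAtPt F (g w)) : SmoothAtPt (g ≫ F) w := by
  obtain ⟨U, hw, hU⟩ := h
  refine ⟨g ⁻¹ᵁ U, hw, ?_⟩
  have e : (g ⁻¹ᵁ U).ι ≫ g ≫ F = (g ∣_ U) ≫ U.ι ≫ F := by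
    rw [morphismRestrict_ι_assoc]
  haveI : Smooth (U.ι ≫ F) := hU
  haveI : Etale (g ∣_ U) := inferInstance
  change Smooth _
  rw [e]
  infer_instance

variable {A : CommRingCat.{u}} [IsDomain A] [IsDiscreteValuationRing A] {Y : Scheme.{u}}
    {F : Y ⟶ Spec A} {ϖ : A}

/-- maximal points of the closed fibre -/
def FGen {A : CommRingCat.{u}} {Y : Scheme.{u}} (F : Y ⟶ Spec A) (ϖ : A) (z : Y) : Prop :=
  ϖ ∈ (F z).asIdeal ∧ ∀ z', z' ⤳ z → ϖ ∈ (F z').asIdeal → z ⤳ z'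

theorem TS.model (H : TS F ϖ) {y : Y} {n l : ℕ} {c : A} (C : Ch F y n l c) (hln : l ≤ n)
    (hy : ϖ ∈ (F (C.g C.q)).asIdeal) :
    letI := (C.g.stalkMap C.q).hom.toAlgebra
    IsDomain (Y.presheaf.stalk (C.g C.q)) ∧
    ∃ (ι : Type) (_ : Fintype ι) (_ : Nonempty ι) (x : ι → (Spec C.E).presheaf.stalk C.q) (k : ℕ),
      LModel (algebraMap (Y.presheaf.stalk (C.g C.q)) ((Spec C.E).presheaf.stalk C.q)
        (gm F (C.g C.q) ϖ)) x k ∧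
      ∀ i j, i ≠ j → elemOrd A c k ∧ ∃ i' j' : Fin n, i' ≠ j' ∧ (i' : ℕ) < l ∧ (j' : ℕ) < l ∧
        C.co i' ∈ C.q.asIdeal ∧ C.co j' ∈ C.q.asIdeal ∧
        x i = (toSt C.q).hom (C.co i') ∧ x j = (toSt C.q).hom (C.co j') := by
  letI i0 := (C.g.stalkMap C.q).hom.toAlgebra
  haveI := C.flat
  haveI := C.g_et
  letI : Algebra (stdRing A n l c) C.E := C.θ.hom.toAlgebra
  letI : Algebra A C.E := C.a.hom.toAlgebra
  haveI : IsScalarTower A (stdRing A n l c) C.E := by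
    refine IsScalarTower.of_algebraMap_eq (R := A) (S := stdRing A n l c) (A := C.E) fun r => rfl
  haveI : Algebra.Etale (stdRing A n l c) C.E := (HasRingHomProperty.Spec_iff (P := @Etale)).1 C.θ_et
  letI i1 : Algebra C.E ((Spec C.E).presheaf.stalk C.q) := (toSt C.q).hom.toAlgebra
  haveI : C.q.asIdeal.IsPrime := C.q.2
  haveI : IsLocalization.AtPrime ((Spec C.E).presheaf.stalk C.q) C.q.asIdeal := toSt_loc C.q
  haveI := std_fp_E (K := A) (n := n) (c := c) l C.E
  haveI : IsNoetherianRing C.E := Algebra.FiniteType.isNoetherianRing A C.E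
  have e : algebraMap (Y.presheaf.stalk (C.g C.q)) ((Spec C.E).presheaf.stalk C.q)
      (gm F (C.g C.q) ϖ) = algebraMap C.E _ (algebraMap A C.E ϖ) := C.gm_st C.q ϖ
  have hnz : ∀ a, algebraMap C.E ((Spec C.E).presheaf.stalk C.q) (algebraMap A C.E ϖ) * a = 0 → a = 0 := by
    intro a ha
    haveI := stalkMap_ff C.g C.q
    rw [← e] at ha
    exact nzd_flat (S := Y.presheaf.stalk (C.g C.q)) _ (H.nzd _) a ha
  have hq : algebraMap A C.E ϖ ∈ C.q.asIdeal := by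
    have h1 : F (C.g C.q) = Spec.map C.a C.q := by
      rw [← C.comm', Scheme.Hom.comp_apply]
    rw [h1] at hy
    exact hy
  obtain ⟨hd, hL⟩ := chart_LModel (A := A) (n := n) (l := l) (c := c) (E := C.E)
    (O := (Spec C.E).presheaf.stalk C.q) hln C.q.asIdeal ϖ H.irr hq hnz (by
      intro P hP hPϖ
      obtain ⟨w, hw, hwP, -⟩ := exists_genPrime P
      have h1 : ϖ ∉ ((C.g ≫ F) w).asIdeal := by
        rw [C.comm', ← mem_genPrime (Spec.map C.a) hw ϖ, hwP, gm_Spec]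
        exact hPϖ
      have h2 : SmoothAtPt (C.g ≫ F) w := by
        refine SmoothAtPt.comp_etale C.g w (H.sm _ ?_)
        rw [← Scheme.Hom.comp_apply]; exact h1
      obtain ⟨h3, -⟩ := stalk_normal _ w h2
      subst hwP
      letI := ((Spec C.E).presheaf.stalkSpecializes hw).hom.toAlgebra
      haveI := stalk_loc hw
      exact (IsLocalization.algEquiv (genPrime hw).primeCompl (Localization.AtPrime (genPrime hw))
        ((Spec C.E).presheaf.stalk w)).toMulEquiv.isDomain _)
  refine ⟨?_, ?_⟩
  · exact (stalkMap_inj C.g C.q).isDomain _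
  · rw [e]
    exact hL

lemma TS.model' (H : TS F ϖ) {y : Y} (hy : ϖ ∈ (F y).asIdeal) : IsDomain (Y.presheaf.stalk y) := by
  obtain ⟨n, l, hln, c, ⟨C⟩⟩ := H.charts y hy
  have h1 := (H.model C hln (by rw [C.hq]; exact hy)).1
  rwa [C.hq] at h1

lemma TS.dom (H : TS F ϖ) (y : Y) : IsDomain (Y.presheaf.stalk y) := by
  by_cases h : ϖ ∈ (F y).asIdeal
  · exact H.model' h
  · exact (stalk_normal F y (H.sm y h)).1

lemma TS.rad (H : TS F ϖ) {y : Y} (hy : ϖ ∈ (F y).asIdeal) (a : Y.presheaf.stalk y) (n : ℕ)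
    (h : gm F y ϖ ∣ a ^ n) : gm F y ϖ ∣ a := by
  obtain ⟨n', l, hln, c, ⟨C⟩⟩ := H.charts y hy
  obtain ⟨E, g, q, θ, g_et, θ_et, rfl, comm⟩ := C
  obtain ⟨-, ι, _, _, x, k, h1, -⟩ := H.model (⟨E, g, q, θ, g_et, θ_et, rfl, comm⟩ : Ch F (g q) n' l c) hln hy
  letI := (g.stalkMap q).hom.toAlgebra
  haveI : Flat g := inferInstance
  haveI := stalkMap_ff g q
  exact h1.rad a n h

lemma FGen.minimal {z y : Y} (h : FGen F ϖ z) (hz : z ⤳ y) :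
    gm F y ϖ ∈ genPrime hz ∧ ∀ Q : Ideal (Y.presheaf.stalk y), Q.IsPrime → gm F y ϖ ∈ Q → Q ≤ genPrime hz →
      Q = genPrime hz := by
  refine ⟨(mem_genPrime F hz ϖ).2 h.1, fun Q hQ h1 h2 => h2.antisymm ?_⟩
  obtain ⟨z', hz', rfl, -⟩ := exists_genPrime Q
  rw [genPrime_le] at h2 ⊢
  exact h.2 z' h2 ((mem_genPrime F hz' ϖ).1 h1)

lemma FGen.of_minimal {z y : Y} (hz : z ⤳ y) 
   (h : gm F y ϖ ∈ genPrime hz) (h' : ∀ Q : Ideal (Y.presheaf.stalk y), Q.IsPrime → gm F y ϖ ∈ Q → Q ≤ genPrime hz →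
      Q = genPrime hz) : FGen F ϖ z := by
  refine ⟨(mem_genPrime F hz ϖ).1 h, fun z' hz' hw => ?_⟩
  have := h' (genPrime (hz'.trans hz)) inferInstance ((mem_genPrime F _ ϖ).2 hw) ((genPrime_le _ _).2 hz')
  exact (genPrime_le hz (hz'.trans hz)).1 this.ge

lemma FGen.ordGe (H : TS F ϖ) {z y : Y} (h : FGen F ϖ z) (hz : z ⤳ y) (hy : ϖ ∈ (F y).asIdeal) :
    ∀ a ∈ genPrime hz, OrdGe (gm F y ϖ) (genPrime hz) 1 a := by
  refine ordGe_one_of_minimal ⟨⟨inferInstance, ?_⟩, ?_⟩ (H.rad hy)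
  · rw [Ideal.span_singleton_le_iff_mem]; exact (h.minimal hz).1
  · rintro P ⟨hP, h1⟩ h2
    exact ((h.minimal hz).2 P hP ((Ideal.span_singleton_le_iff_mem _).1 h1) h2).ge

lemma FGen.dvr (H : TS F ϖ) {z : Y} (h : FGen F ϖ z) :
    ∃ _ : IsDomain (Y.presheaf.stalk z), IsDiscreteValuationRing (Y.presheaf.stalk z) ∧
      Irreducible (gm F z ϖ) := by
  have hz := specializes_refl z
  letI := (Y.presheaf.stalkSpecializes hz).hom.toAlgebra
  haveI := stalk_loc hz
  haveI := H.noeth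
  have := dvr_of_minimal (π := gm F z ϖ) (z := genPrime hz) (H.nzd z) (h.minimal hz).1
    (h.ordGe H hz h.1) (Y.presheaf.stalk z)
  have e : algebraMap (Y.presheaf.stalk z) (Y.presheaf.stalk z) (gm F z ϖ) = gm F z ϖ :=
    congrArg (fun φ => φ.hom ϖ) (gm_spec F hz)
  rwa [e] at this

/-- order from exact order -/
lemma FGen.elemOrd (H : TS F ϖ) {z y : Y} (h : FGen F ϖ z) (hz : z ⤳ y) (hy : ϖ ∈ (F y).asIdeal)
    {a : Y.presheaf.stalk y} {n : ℕ} (ha : OrdEx (gm F y ϖ) (genPrime hz) n a) :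
    elemOrd (Y.presheaf.stalk z) ((Y.presheaf.stalkSpecializes hz).hom a) n := by
  letI := (Y.presheaf.stalkSpecializes hz).hom.toAlgebra
  haveI := stalk_loc hz
  haveI := H.noeth
  exact elemOrd_of_ordEx (π := gm F y ϖ) (H.nzd y) (h.minimal hz).1 (h.ordGe H hz hy) (Y.presheaf.stalk z) ha

/-- exact order exists -/
lemma FGen.ordEx (H : TS F ϖ) {z y : Y} (h : FGen F ϖ z) (hz : z ⤳ y)
    {a : Y.presheaf.stalk y} (ha : a ≠ 0) : ∃ n, OrdEx (gm F y ϖ) (genPrime hz) n a := by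
  haveI := H.dom y
  obtain ⟨_, hd, hirr⟩ := h.dvr H
  letI := (Y.presheaf.stalkSpecializes hz).hom.toAlgebra
  haveI := stalk_loc hz
  have hinj : Function.Injective (algebraMap (Y.presheaf.stalk y) (Y.presheaf.stalk z)) :=
    IsLocalization.injective _ (genPrime hz).primeCompl_le_nonZeroDivisors
  have ha' : algebraMap (Y.presheaf.stalk y) (Y.presheaf.stalk z) a ≠ 0 := fun e =>
    ha (hinj (by rw [e, map_zero]))
  obtain ⟨n, u, hu⟩ := IsDiscreteValuationRing.associated_pow_irreducible ha' hirr
  obtain ⟨⟨t, s⟩, e⟩ := IsLocalization.surj (genPrime hz).primeCompl (↑u⁻¹ : Y.presheaf.stalk z)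
  have e1 : gm F z ϖ = algebraMap (Y.presheaf.stalk y) (Y.presheaf.stalk z) (gm F y ϖ) :=
    (congrArg (fun φ => φ.hom ϖ) (gm_spec F hz)).symm
  refine ⟨n, s, t, s.2, ?_, ?_⟩
  · have h1 : IsUnit (algebraMap (Y.presheaf.stalk y) (Y.presheaf.stalk z) t) := by
      rw [← e]
      exact (Units.isUnit _).mul (IsLocalization.map_units _ s)
    exact (IsLocalization.AtPrime.isUnit_to_map_iff (Y.presheaf.stalk z) (genPrime hz) t).1 h1
  · apply hinj
    rw [map_mul, map_mul, map_pow, ← e1, ← hu, ← e]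
    dsimp only
    linear_combination (-(algebraMap (Y.presheaf.stalk y) (Y.presheaf.stalk z) s *
      algebraMap (Y.presheaf.stalk y) (Y.presheaf.stalk z) a)) * u.mul_inv

end tlevel2


section germs

lemma germ_zero_open {Y : Scheme.{u}} (V : Y.Opens) (h : Γ(Y, V)) :
    IsOpen {z : Y | ∃ hz : z ∈ V, Y.presheaf.germ V z hz h = 0} := by
  rw [isOpen_iff_forall_mem_open]
  rintro z ⟨hz, h0⟩
  obtain ⟨W, hW, i1, i2, e⟩ := Y.presheaf.germ_eq z hz hz h 0 (by rw [h0, map_zero])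
  refine ⟨W, ?_, W.2, hW⟩
  intro z' hz'
  refine ⟨i1.le hz', ?_⟩
  rw [← TopCat.Presheaf.germ_res_apply Y.presheaf i1 z' hz', e, map_zero, map_zero]

lemma germ_nonzero_open {Y : Scheme.{u}} [IsLocallyNoetherian Y]
    (hd : ∀ y : Y, IsDomain (Y.presheaf.stalk y)) (V : Y.Opens) (h : Γ(Y, V)) :
    IsOpen {z : Y | ∃ hz : z ∈ V, Y.presheaf.germ V z hz h ≠ 0} := by
  rw [isOpen_iff_forall_mem_open]
  rintro z ⟨hz, h0⟩
  obtain ⟨W, hWa, hzW, hWV⟩ := exists_isAffineOpen_mem_and_subset (X := Y) (x := z) (U := V) hz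
  haveI : IsNoetherianRing Γ(Y, W) := IsLocallyNoetherian.component_noetherian ⟨W, hWa⟩
  let h' : Γ(Y, W) := Y.presheaf.map (homOfLE hWV).op h
  have hg : ∀ z' (hz' : z' ∈ W), Y.presheaf.germ W z' hz' h' = Y.presheaf.germ V z' (hWV hz') h :=
    fun z' hz' => TopCat.Presheaf.germ_res_apply Y.presheaf (homOfLE hWV) z' hz' h
  have hloc : ∀ z' (hz' : z' ∈ W) (a : Γ(Y, W)), Y.presheaf.germ W z' hz' a = 0 ↔
      ∃ s, s ∉ (hWa.primeIdealOf ⟨z', hz'⟩).asIdeal ∧ s * a = 0 := by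
    intro z' hz' a
    letI := TopCat.Presheaf.algebra_section_stalk Y.presheaf (⟨z', hz'⟩ : W)
    haveI := hWa.isLocalization_stalk ⟨z', hz'⟩
    have := IsLocalization.map_eq_zero_iff (hWa.primeIdealOf ⟨z', hz'⟩).asIdeal.primeCompl (Y.presheaf.stalk z') a
    refine Iff.trans this ⟨?_, ?_⟩
    · rintro ⟨⟨s, hs⟩, e⟩; exact ⟨s, hs, e⟩
    · rintro ⟨s, hs, e⟩; exact ⟨⟨s, hs⟩, e⟩
  set p := hWa.primeIdealOf ⟨z, hzW⟩ with hp
  let I : Ideal Γ(Y, W) := Ideal.span {h'} |>.annihilator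
  have hI : ∀ a, a ∈ I ↔ a * h' = 0 := by
    intro a
    rw [show I = _ from rfl, Submodule.mem_annihilator_span_singleton]; rfl
  have hfg : I.FG := IsNoetherian.noetherian I
  obtain ⟨S, hS⟩ := hfg
  have key : ∀ a ∈ I, ∃ s, s ∉ p.asIdeal ∧ s * a = 0 := by
    intro a ha
    rw [← hloc z hzW]
    haveI := hd z
    have := congrArg (Y.presheaf.germ W z hzW) ((hI a).1 ha)
    rw [map_mul, map_zero, hg] at this
    exact (mul_eq_zero.1 this).resolve_right h0
  haveI : p.asIdeal.IsPrime := p.2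
  have : ∃ s, s ∉ p.asIdeal ∧ ∀ a ∈ S, s * a = 0 := by
    classical
    have hS' : ∀ a ∈ S, a ∈ I := fun a ha => hS ▸ Submodule.subset_span ha
    clear hS
    induction S using Finset.induction_on with
    | empty => exact ⟨1, fun h => p.2.ne_top ((Ideal.eq_top_iff_one _).2 h), by simp⟩
    | insert a T haT ih =>
      obtain ⟨s, hs, h1⟩ := ih (fun a ha => hS' a (Finset.mem_insert_of_mem ha))
      obtain ⟨t, ht, h2⟩ := key a (hS' a (Finset.mem_insert_self _ _))
      refine ⟨s * t, fun h => (p.2.mem_or_mem h).elim hs ht, ?_⟩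
      intro b hb
      rcases Finset.mem_insert.1 hb with rfl | hb
      · rw [mul_assoc, h2, mul_zero]
      · rw [mul_comm s t, mul_assoc, h1 b hb, mul_zero]
  obtain ⟨s, hs, h1⟩ := this
  have h2 : ∀ a ∈ I, s * a = 0 := by
    intro a ha
    have : I ≤ (Ideal.span {s}).annihilator := by
      rw [← hS, Submodule.span_le]
      intro b hb
      change b ∈ (Submodule.span _ _).annihilator
      rw [Submodule.mem_annihilator_span_singleton]
      rw [smul_eq_mul, mul_comm]; exact h1 b hb
    have h3 := this ha
    change a ∈ (Submodule.span _ _).annihilator at h3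
    rw [Submodule.mem_annihilator_span_singleton] at h3
    rw [mul_comm]; exact h3
  have hbo : ∀ z' (hz' : z' ∈ W) (t : Γ(Y, W)), z' ∈ Y.basicOpen t ↔ t ∉ (hWa.primeIdealOf ⟨z', hz'⟩).asIdeal := by
    intro z' hz' t
    have := hWa.fromSpec_preimage_basicOpen t
    have h4 : hWa.fromSpec (hWa.primeIdealOf ⟨z', hz'⟩) = z' := hWa.fromSpec_primeIdealOf ⟨z', hz'⟩
    have h5 : (hWa.primeIdealOf ⟨z', hz'⟩) ∈ hWa.fromSpec ⁻¹ᵁ Y.basicOpen t ↔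
        (hWa.primeIdealOf ⟨z', hz'⟩) ∈ PrimeSpectrum.basicOpen t := by rw [this]; rfl
    have h6 : (hWa.primeIdealOf ⟨z', hz'⟩) ∈ hWa.fromSpec ⁻¹ᵁ Y.basicOpen t ↔ z' ∈ Y.basicOpen t := by
      change hWa.fromSpec (hWa.primeIdealOf ⟨z', hz'⟩) ∈ Y.basicOpen t ↔ _
      rw [h4]
    rw [← h6, h5]; rfl
  refine ⟨Y.basicOpen s, ?_, (Y.basicOpen s).2, (hbo z hzW s).2 hs⟩
  intro z' hz'
  have hz'W := Y.basicOpen_le s hz'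
  refine ⟨hWV hz'W, fun h0 => ?_⟩
  rw [← hg z' hz'W, hloc] at h0
  obtain ⟨t, ht, e⟩ := h0
  have e2 := h2 t ((hI t).2 e)
  have := (hbo z' hz'W s).1 hz'
  have h7 : s * t ∈ (hWa.primeIdealOf ⟨z', hz'W⟩).asIdeal := e2 ▸ Ideal.zero_mem _
  exact ((hWa.primeIdealOf ⟨z', hz'W⟩).2.mem_or_mem h7).elim this ht

lemma germ_ne_zero {Y : Scheme.{u}} [IsLocallyNoetherian Y]
    (hd : ∀ y : Y, IsDomain (Y.presheaf.stalk y)) (V : Y.Opens) (h : Γ(Y, V))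
    (hh : h ∈ nonZeroDivisors Γ(Y, V)) (y : Y) (hy : y ∈ V) : Y.presheaf.germ V y hy h ≠ 0 := by
  intro h0
  let N : Y.Opens := ⟨_, germ_zero_open V h⟩
  let M : Y.Opens := ⟨_, germ_nonzero_open hd V h⟩
  have hyN : y ∈ N := ⟨hy, h0⟩
  have hV : V = N ⊔ M := by
    ext z
    constructor
    · intro hz
      by_cases h1 : Y.presheaf.germ V z hz h = 0
      · exact Or.inl ⟨hz, h1⟩
      · exact Or.inr ⟨hz, h1⟩
    · rintro (⟨hz, -⟩ | ⟨hz, -⟩) <;> exact hz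
  have hdis : ∀ z, ¬ z ∈ N ⊓ M := by
    rintro z ⟨⟨h1, h2⟩, ⟨h3, h4⟩⟩; exact h4 h2
  have hemp : N ⊓ M = ⊥ := by
    ext z; exact ⟨fun hz => (hdis z hz).elim, fun hz => hz.elim⟩
  haveI hsub : Subsingleton Γ(Y, N ⊓ M) := by
    rw [hemp]; infer_instance
  obtain ⟨e, he1, he2⟩ : ∃ e : Γ(Y, N ⊔ M), Y.presheaf.map (homOfLE (le_sup_left : N ≤ N ⊔ M)).op e = 1 ∧
      Y.presheaf.map (homOfLE (le_sup_right : M ≤ N ⊔ M)).op e = 0 := by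
    refine ⟨(Y.sheaf.objSupIsoProdEqLocus N M).inv ⟨(1, 0), ?_⟩, ?_, ?_⟩
    · exact @Subsingleton.elim _ hsub _ _
    · exact TopCat.Sheaf.objSupIsoProdEqLocus_inv_fst Y.sheaf N M _
    · exact TopCat.Sheaf.objSupIsoProdEqLocus_inv_snd Y.sheaf N M _
  obtain ⟨e', he1', he2'⟩ : ∃ e : Γ(Y, V), (∀ z (hz : z ∈ N), Y.presheaf.germ V z hz.1 e = 1) ∧
      (∀ z (hz : z ∈ M), Y.presheaf.germ V z hz.1 e = 0) := by
    refine ⟨Y.presheaf.map (homOfLE hV.le).op e, ?_, ?_⟩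
    · intro z hz
      rw [TopCat.Presheaf.germ_res_apply,
        ← TopCat.Presheaf.germ_res_apply Y.presheaf (homOfLE (le_sup_left : N ≤ N ⊔ M)) z hz, he1, map_one]
    · intro z hz
      rw [TopCat.Presheaf.germ_res_apply,
        ← TopCat.Presheaf.germ_res_apply Y.presheaf (homOfLE (le_sup_right : M ≤ N ⊔ M)) z hz, he2, map_zero]
  have hz : e' * h = 0 := by
    refine TopCat.Presheaf.section_ext Y.sheaf V _ _ fun z hz => ?_
    change Y.presheaf.germ V z hz (e' * h) = Y.presheaf.germ V z hz 0
    rw [map_mul, map_zero]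
    by_cases h1 : Y.presheaf.germ V z hz h = 0
    · rw [h1, mul_zero]
    · rw [he2' z ⟨hz, h1⟩, zero_mul]
  have h1 : e' = 0 := mem_nonZeroDivisors_iff.1 hh |>.2 _ hz
  have h2 := he1' y hyN
  rw [h1, map_zero] at h2
  haveI := hd y
  exact zero_ne_one h2

end germs


section tdvd
variable {A : CommRingCat.{u}} [IsDomain A] [IsDiscreteValuationRing A] {Y : Scheme.{u}}
    {F : Y ⟶ Spec A} {ϖ : A}

lemma TS.hart (H : TS F ϖ) (y : Y) (h1 h2 : Y.presheaf.stalk y) (h20 : h2 ≠ 0)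
    (h : ∀ z (hz : z ⤳ y), ϖ ∉ (F z).asIdeal → ∀ (_ : IsDomain (Y.presheaf.stalk z)),
      IsDiscreteValuationRing (Y.presheaf.stalk z) →
      (Y.presheaf.stalkSpecializes hz).hom h2 ∣ (Y.presheaf.stalkSpecializes hz).hom h1) :
    ∃ N, h2 ∣ h1 * (gm F y ϖ) ^ N := by
  haveI := H.noeth
  haveI := H.dom y
  refine hartogs (gm F y ϖ) h1 h2 h20 ?_ ?_
  · intro q _ hq
    obtain ⟨z, hz, rfl, -⟩ := exists_genPrime q
    rw [mem_genPrime] at hq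
    letI := (Y.presheaf.stalkSpecializes hz).hom.toAlgebra
    haveI := stalk_loc hz
    obtain ⟨_, hn⟩ := stalk_normal F z (H.sm z hq)
    exact IsIntegrallyClosed.of_equiv
      (IsLocalization.algEquiv (genPrime hz).primeCompl (Y.presheaf.stalk z) (Localization.AtPrime (genPrime hz))).toRingEquiv
  · intro q _ hq hdv
    obtain ⟨z, hz, rfl, -⟩ := exists_genPrime q
    rw [mem_genPrime] at hq
    letI := (Y.presheaf.stalkSpecializes hz).hom.toAlgebra
    haveI := stalk_loc hz
    let e := (IsLocalization.algEquiv (genPrime hz).primeCompl (Y.presheaf.stalk z) (Localization.AtPrime (genPrime hz)))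
    haveI := H.dom z
    have hdv' : IsDiscreteValuationRing (Y.presheaf.stalk z) :=
      IsDiscreteValuationRing.RingEquivClass.isDiscreteValuationRing e.symm
    have := map_dvd e (h z hz hq inferInstance hdv')
    have e1 : ∀ a, e ((Y.presheaf.stalkSpecializes hz).hom a) = algebraMap _ _ a := fun a => e.commutes a
    rwa [e1, e1] at this

lemma OrdEx.pow_self {O : Type*} [CommRing O] (π : O) (p : Ideal O) [p.IsPrime] (n : ℕ) :
    OrdEx π p n (π ^ n) :=
  ⟨1, 1, fun h => Ideal.IsPrime.ne_top ‹_› ((Ideal.eq_top_iff_one _).2 h),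
    fun h => Ideal.IsPrime.ne_top ‹_› ((Ideal.eq_top_iff_one _).2 h), by ring⟩

theorem TS.core_dvd (H : TS F ϖ) {y : Y} {n l : ℕ} {c : A} (C : Ch F y n l c) (hln : l ≤ n)
    (hy : ϖ ∈ (F y).asIdeal) (D : Y → ℤ) (hD : IsCartierDiv D)
    (hD0 : ∀ z, ϖ ∉ (F z).asIdeal → D z = 0) (z₁ z₂ : Y) (h₁ : z₁ ⤳ y) (h₂ : z₂ ⤳ y)
    (hg₁ : FGen F ϖ z₁) (hg₂ : FGen F ϖ z₂) (k : ℕ) (hk : elemOrd A c k) :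
    (k : ℤ) ∣ D z₁ - D z₂ := by
  haveI := H.noeth
  haveI := H.dom y
  obtain ⟨V, hyV, s1, s2, hs1, hs2, hcut⟩ := hD y
  set b1 := Y.presheaf.germ V y hyV s1 with hb1
  set b2 := Y.presheaf.germ V y hyV s2 with hb2
  have hb10 : b1 ≠ 0 := germ_ne_zero H.dom V s1 hs1 y hyV
  have hb20 : b2 ≠ 0 := germ_ne_zero H.dom V s2 hs2 y hyV
  have hsp : ∀ z (hz : z ⤳ y) s, (Y.presheaf.stalkSpecializes hz).hom (Y.presheaf.germ V y hyV s) =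
      Y.presheaf.germ V z (hz.mem_open V.2 hyV) s := fun z hz s =>
    TopCat.Presheaf.germ_stalkSpecializes_apply Y.presheaf hyV hz s
  have hass : ∀ z (hz : z ⤳ y), ϖ ∉ (F z).asIdeal → ∀ (_ : IsDomain (Y.presheaf.stalk z)),
      IsDiscreteValuationRing (Y.presheaf.stalk z) →
      Associated ((Y.presheaf.stalkSpecializes hz).hom b1) ((Y.presheaf.stalkSpecializes hz).hom b2) := by
    intro z hz hϖ _ hdv
    have hzV := hz.mem_open V.2 hyV
    rw [hb1, hb2, hsp, hsp]
    refine assoc_of_elemOrd (germ_ne_zero H.dom V s1 hs1 z hzV) (germ_ne_zero H.dom V s2 hs2 z hzV) ?_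
    intro m₁ m₂ e1 e2
    have := hcut z hzV (IsDiscreteValuationRing.ringKrullDim_eq_one _) m₁ m₂ e1 e2
    rw [hD0 z hϖ] at this
    omega
  obtain ⟨N, a, ha⟩ := H.hart y b1 b2 hb20 (fun z hz h1 h2 h3 => (hass z hz h1 h2 h3).symm.dvd)
  obtain ⟨N', a', ha'⟩ := H.hart y b2 b1 hb10 (fun z hz h1 h2 h3 => (hass z hz h1 h2 h3).dvd)
  have haa : a * a' = (gm F y ϖ) ^ (N + N') := by
    apply mul_left_cancel₀ hb20
    rw [pow_add]
    linear_combination (-a') * ha - gm F y ϖ ^ N * ha'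
  have ha0 : a ≠ 0 := by
    rintro rfl
    rw [mul_zero] at ha
    have hϖ0 : gm F y ϖ ≠ 0 := by
      intro e
      exact one_ne_zero (H.nzd y 1 (by rw [e, zero_mul]))
    exact (mul_ne_zero hb10 (pow_ne_zero _ hϖ0)) ha
  -- orders of `a` at the maximal points
  have hord : ∀ z (hz : z ⤳ y), FGen F ϖ z → ∃ α, OrdEx (gm F y ϖ) (genPrime hz) α a ∧ D z = (α : ℤ) - N := by
    intro z hz hg
    obtain ⟨α, hα⟩ := hg.ordEx H hz ha0
    obtain ⟨n1, hn1⟩ := hg.ordEx H hz hb10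
    obtain ⟨n2, hn2⟩ := hg.ordEx H hz hb20
    refine ⟨α, hα, ?_⟩
    have e1 := hg.elemOrd H hz hy (OrdEx.mul inferInstance hn1 (OrdEx.pow_self _ _ N))
    rw [ha] at e1
    have e2 := elemOrd_unique e1 (hg.elemOrd H hz hy (OrdEx.mul inferInstance hn2 hα))
    obtain ⟨_, hdv, -⟩ := hg.dvr H
    have e3 := hg.elemOrd H hz hy hn1
    have e4 := hg.elemOrd H hz hy hn2
    rw [hb1, hsp] at e3
    rw [hb2, hsp] at e4
    have := hcut z (hz.mem_open V.2 hyV) (IsDiscreteValuationRing.ringKrullDim_eq_one _) n1 n2 e3 e4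
    omega
  clear_value b1 b2
  clear hcut hass ha ha' hb1 hb2 hsp
  obtain ⟨E, g, q, θ, g_et, θ_et, rfl, comm⟩ := C
  obtain ⟨-, ι, _, _, x, k', hL, hx⟩ := H.model (⟨E, g, q, θ, g_et, θ_et, rfl, comm⟩ : Ch F (g q) n l c) hln hy
  letI := (g.stalkMap q).hom.toAlgebra
  haveI : Flat g := inferInstance
  haveI := stalkMap_ff g q
  have hi : ∀ i, ∃ z, ∃ hz : z ⤳ g q, genPrime hz = dpr (Y.presheaf.stalk (g q)) (gm F (g q) ϖ) x i ∧ FGen F ϖ z := by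
    intro i
    haveI := hL.dpr_prime i
    obtain ⟨z, hz, e, -⟩ := exists_genPrime (dpr (Y.presheaf.stalk (g q)) (gm F (g q) ϖ) x i)
    refine ⟨z, hz, e, FGen.of_minimal hz ?_ ?_⟩
    · rw [e]; exact mem_dpr i
    · intro Q hQ h1 h2
      rw [e] at h2 ⊢
      exact hL.dpr_min i Q h1 h2
  choose z hz hzd hzg using hi
  choose α hα hDα using fun i => hord (z i) (hz i) (hzg i)
  have hdv := hL.core_dvd (algebraMap _ _ a) (algebraMap _ _ a') (N + N')
    (by rw [← map_mul, haa, map_pow]) α (by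
      intro i
      obtain ⟨s, t, hs, ht, e⟩ := hα i
      rw [hzd] at hs ht
      refine ⟨algebraMap _ _ s, algebraMap _ _ t, hs, ht, ?_⟩
      rw [← map_mul, e, map_mul, map_pow])
  have huniq : ∀ z' (hz' : z' ⤳ g q), FGen F ϖ z' → ∃ i, z' = z i := by
    intro z' hz' hg
    obtain ⟨i, hi⟩ := hL.eq_dpr (genPrime hz') (hg.minimal hz').1 (hg.minimal hz').2
    refine ⟨i, ?_⟩
    rw [← hzd i] at hi
    exact (((genPrime_le _ _).1 hi.le).antisymm ((genPrime_le _ _).1 hi.ge)).eq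
  obtain ⟨i, rfl⟩ := huniq z₁ h₁ hg₁
  obtain ⟨j, rfl⟩ := huniq z₂ h₂ hg₂
  by_cases hij : i = j
  · subst hij; simp
  · obtain ⟨hk', -⟩ := hx i j hij
    rw [elemOrd_unique hk hk', hDα i, hDα j]
    have := hdv i j
    rwa [sub_sub_sub_cancel_right]

end tdvd


section texists

lemma genPrime_comap {X Y : Scheme.{u}} (g : X ⟶ Y) {w q : X} (h : w ⤳ q) :
    (genPrime h).comap (g.stalkMap q).hom = genPrime (h.map g.continuous) := by
  have e := Scheme.Hom.stalkSpecializes_stalkMap g w q h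
  unfold genPrime
  rw [Ideal.comap_comap, ← CommRingCat.hom_comp, ← e, CommRingCat.hom_comp, ← Ideal.comap_comap]
  congr 1
  exact IsLocalRing.maximalIdeal_comap _

lemma mem_genPrime_toSt {E : CommRingCat.{u}} {w q : Spec E} (h : w ⤳ q) (a : E) :
    (toSt q).hom a ∈ genPrime h ↔ a ∈ w.asIdeal := by
  have h1 := mem_genPrime (Spec.map (𝟙 E)) h a
  rw [gm_Spec] at h1
  refine Iff.trans ?_ (h1.trans ?_)
  · rfl
  · rw [Spec.map_id]; rfl

lemma comp_iff {Z : Type*} [TopologicalSpace Z] [QuasiSober Z] (z : Z) :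
    closure {z} ∈ irreducibleComponents Z ↔ ∀ z', z' ⤳ z → z ⤳ z' := by
  constructor
  · intro h z' hz'
    rw [specializes_iff_mem_closure]
    have : closure {z'} ≤ closure {z} := h.2 isIrreducible_singleton.closure (by
      exact hz'.closure_subset)
    exact this (subset_closure rfl)
  · intro h
    refine ⟨isIrreducible_singleton.closure, ?_⟩
    intro C hC hle
    obtain ⟨z', hz'⟩ := QuasiSober.sober hC.closure isClosed_closure
    have h1 : z' ⤳ z := by
      rw [specializes_iff_mem_closure, hz'.def]
      exact subset_closure (hle (subset_closure rfl))
    have h2 := h z' h1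
    refine subset_closure.trans ?_
    rw [← hz'.def]
    exact h2.closure_subset

variable {A : CommRingCat.{u}} [IsDomain A] [IsDiscreteValuationRing A] {Y : Scheme.{u}}
    {F : Y ⟶ Spec A} {ϖ : A}

lemma TS.fgen_finite (H : TS F ϖ) : {z | FGen F ϖ z}.Finite := by
  haveI := H.noeth
  haveI := H.proper
  haveI : CompactSpace Y := by
    have := (quasiCompact_iff_compactSpace (f := F)).1 inferInstance
    exact this
  haveI : IsNoetherian Y := {}
  let Z : Set Y := {z | ϖ ∈ (F z).asIdeal}
  have hZ : IsClosed Z := by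
    have : IsClosed (PrimeSpectrum.zeroLocus ({ϖ} : Set A)) := PrimeSpectrum.isClosed_zeroLocus _
    have h2 := this.preimage F.continuous
    convert h2 using 1
    ext z
    change ϖ ∈ (F z).asIdeal ↔ {ϖ} ⊆ ((F z).asIdeal : Set A)
    simp
  haveI : QuasiSober Z := hZ.isClosedEmbedding_subtypeVal.quasiSober
  haveI : TopologicalSpace.NoetherianSpace Z := Topology.IsInducing.subtypeVal.noetherianSpace
  have hf := genericPoints.finite (TopologicalSpace.NoetherianSpace.finite_irreducibleComponents (α := Z))
  refine (hf.image Subtype.val).subset ?_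
  intro z hz
  refine ⟨⟨z, hz.1⟩, ?_, rfl⟩
  refine (comp_iff (Z := Z) ⟨z, hz.1⟩).2 ?_
  intro z' hz'
  rw [subtype_specializes_iff] at hz' ⊢
  exact hz.2 z'.1 hz' z'.2

lemma TS.gm_ne (H : TS F ϖ) (y : Y) : gm F y ϖ ≠ 0 := by
  intro e
  haveI := H.dom y
  exact one_ne_zero (H.nzd y 1 (by rw [e, zero_mul]))

lemma TS.fgen_of_div (H : TS F ϖ) {z : Y} (hz : ϖ ∈ (F z).asIdeal) (hd : IsDivisorialPt Y z) :
    FGen F ϖ z := by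
  haveI := H.dom z
  refine ⟨hz, fun z' hz' h' => ?_⟩
  have h1 := (ringKrullDim_eq_one_iff_of_isLocalRing_isDomain.1 hd).2 _ (H.gm_ne z)
  have h2 : Ideal.span {gm F z ϖ} ≤ genPrime hz' := by
    rw [Ideal.span_singleton_le_iff_mem, mem_genPrime]; exact h'
  have h3 := h1.trans ((Ideal.IsPrime.radical_le_iff inferInstance).2 h2)
  have h4 : genPrime (specializes_refl z) ≤ genPrime hz' := by
    refine le_trans (IsLocalRing.le_maximalIdeal (Ideal.IsPrime.ne_top inferInstance)) h3
  exact (genPrime_le _ _).1 h4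

lemma nzd_of_germ_ne {V : Y.Opens} (hd : ∀ y : Y, IsDomain (Y.presheaf.stalk y)) (s : Γ(Y, V))
    (hs : ∀ z (hz : z ∈ V), Y.presheaf.germ V z hz s ≠ 0) : s ∈ nonZeroDivisors Γ(Y, V) := by
  rw [mem_nonZeroDivisors_iff_right]
  intro t ht
  refine TopCat.Presheaf.section_ext Y.sheaf V _ _ fun z hz => ?_
  change Y.presheaf.germ V z hz t = Y.presheaf.germ V z hz 0
  haveI := hd z
  have := congrArg (Y.presheaf.germ V z hz) ht
  rw [map_mul, map_zero] at this
  rw [map_zero]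
  exact (mul_eq_zero.1 this).resolve_right (hs z hz)

theorem TS.core_exists (H : TS F ϖ) (D : Y → ℤ) (hD0 : ∀ z, ϖ ∉ (F z).asIdeal → D z = 0)
    (hloc : ∀ y, ϖ ∈ (F y).asIdeal → ∃ (n l : ℕ) (_ : l ≤ n) (c : A) (C : Ch F y n l c),
      ∀ i' j' : Fin n, i' ≠ j' → (i' : ℕ) < l → (j' : ℕ) < l → ∀ w₁ w₂ : Spec C.E, w₁ ⤳ C.q → w₂ ⤳ C.q →
      C.co i' ∈ C.q.asIdeal → C.co j' ∈ C.q.asIdeal →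
      C.co i' ∈ w₁.asIdeal → C.co j' ∈ w₂.asIdeal → FGen F ϖ (C.g w₁) → FGen F ϖ (C.g w₂) →
      ∀ k : ℕ, elemOrd A c k → (k : ℤ) ∣ D (C.g w₁) - D (C.g w₂)) : IsCartierDiv D := by
  haveI := H.noeth
  let P : Γ(Y, ⊤) := F.appTop ((Scheme.ΓSpecIso A).inv ϖ)
  have hP : ∀ z, gm F z ϖ = Y.presheaf.germ ⊤ z trivial P := by
    intro z
    rw [gm_germ]; rfl
  have hPr : ∀ (V : Y.Opens) (N : ℕ) z (hz : z ∈ V), Y.presheaf.germ V z hz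
      (Y.presheaf.map (homOfLE (le_top : V ≤ ⊤)).op (P ^ N)) = gm F z ϖ ^ N := by
    intro V N z hz
    rw [TopCat.Presheaf.germ_res_apply, map_pow, hP]
  intro y
  by_cases hy : ϖ ∈ (F y).asIdeal
  swap
  · let V : Y.Opens := F ⁻¹ᵁ (PrimeSpectrum.basicOpen ϖ)
    refine ⟨V, hy, 1, 1, Submonoid.one_mem _, Submonoid.one_mem _, ?_⟩
    intro z hz hd m₁ m₂ h1 h2
    rw [hD0 z hz, elemOrd_unique h1 h2, sub_self]
  -- main case
  have key : ∃ (a a' : Y.presheaf.stalk y) (M N : ℕ), a * a' = gm F y ϖ ^ M ∧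
      ∀ z (hz : z ⤳ y), FGen F ϖ z → ∃ m : ℕ, OrdEx (gm F y ϖ) (genPrime hz) m a ∧ D z = (m : ℤ) - N := by
    obtain ⟨n, l, hln, c, C, hC⟩ := hloc y hy
    obtain ⟨E, g, q, θ, g_et, θ_et, rfl, comm⟩ := C
    obtain ⟨-, ι, _, _, x, k', hL, hx⟩ := H.model (⟨E, g, q, θ, g_et, θ_et, rfl, comm⟩ : Ch F (g q) n l c) hln hy
    letI := (g.stalkMap q).hom.toAlgebra
    haveI : Flat g := inferInstance
    haveI := stalkMap_ff g q
    have hi : ∀ i, ∃ w, ∃ hw : w ⤳ q, genPrime hw = Ideal.span {algebraMap _ _ (gm F (g q) ϖ), x i} ∧ 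
       genPrime (hw.map g.continuous) = dpr (Y.presheaf.stalk (g q)) (gm F (g q) ϖ) x i ∧ FGen F ϖ (g w) := by
      intro i
      haveI := hL.prime i
      obtain ⟨w, hw, e, -⟩ := exists_genPrime (Ideal.span {algebraMap (Y.presheaf.stalk (g q)) _ (gm F (g q) ϖ), x i})
      have e2 : genPrime (hw.map g.continuous) = dpr (Y.presheaf.stalk (g q)) (gm F (g q) ϖ) x i := by
        refine (genPrime_comap g hw).symm.trans ?_
        rw [e]; rfl
      refine ⟨w, hw, e, e2, FGen.of_minimal (hw.map g.continuous) ?_ ?_⟩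
      · rw [e2]; exact mem_dpr i
      · intro Q hQ h1 h2
        rw [e2] at h2 ⊢
        exact hL.dpr_min i Q h1 h2
    choose w hw hwe hwd hwg using hi
    have hdiv : ∀ i j, (k' : ℤ) ∣ D (g (w i)) - D (g (w j)) := by
      intro i j
      by_cases hij : i = j
      · subst hij; simp
      obtain ⟨hk, i', j', hne, hi', hj', hiq, hjq, hxi, hxj⟩ := hx i j hij
      refine hC i' j' hne hi' hj' (w i) (w j) (hw i) (hw j) hiq hjq ?_ ?_ (hwg i) (hwg j) k' hk
      · rw [← mem_genPrime_toSt (hw i), hwe, ← hxi]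
        exact Ideal.subset_span (Set.mem_insert_of_mem _ rfl)
      · rw [← mem_genPrime_toSt (hw j), hwe, ← hxj]
        exact Ideal.subset_span (Set.mem_insert_of_mem _ rfl)
    obtain ⟨N, hN⟩ : ∃ N : ℕ, ∀ i, 0 ≤ D (g (w i)) + N := by
      obtain ⟨i0, hi0⟩ := Finite.exists_min (fun i => D (g (w i)))
      refine ⟨(D (g (w i0))).natAbs, fun i => ?_⟩
      have := hi0 i
      omega
    have hwu : ∀ i j, dpr (Y.presheaf.stalk (g q)) (gm F (g q) ϖ) x j ≤ dpr (Y.presheaf.stalk (g q)) (gm F (g q) ϖ) x i →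
        g (w i) = g (w j) := by
      intro i j hle
      haveI := hL.dpr_prime j
      have e := hL.dpr_min i _ (mem_dpr j) hle
      rw [← hwd i, ← hwd j] at e
      exact (((genPrime_le _ _).1 e.ge).antisymm ((genPrime_le _ _).1 e.le)).eq
    obtain ⟨a, a', M, haa, hord⟩ := LModel.core_exists hL (fun i => (D (g (w i)) + N).toNat) (by
      intro i j
      have h1 := hN i
      have h2 := hN j
      have h3 := hdiv i j
      rw [Int.toNat_of_nonneg h1, Int.toNat_of_nonneg h2]
      rwa [add_sub_add_right_eq_sub]) (by
      intro i j hle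
      rw [hwu i j hle])
    refine ⟨a, a', M, N, haa, ?_⟩
    intro z hz hg
    obtain ⟨i, hi⟩ := hL.eq_dpr (genPrime hz) (hg.minimal hz).1 (hg.minimal hz).2
    have hzi : z = g (w i) := by
      rw [← hwd i] at hi
      exact (((genPrime_le _ _).1 hi.le).antisymm ((genPrime_le _ _).1 hi.ge)).eq
    refine ⟨(D (g (w i)) + N).toNat, ?_, ?_⟩
    · rw [hi]; exact hord i
    · rw [hzi, Int.toNat_of_nonneg (hN i)]; ring
  obtain ⟨a, a', M, N, haa, hord⟩ := key
  obtain ⟨U1, hU1, α, hα⟩ := TopCat.Presheaf.exists_germ_eq Y.presheaf a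
  obtain ⟨U2, hU2, α', hα'⟩ := TopCat.Presheaf.exists_germ_eq Y.presheaf a'
  let W0 : Y.Opens := U1 ⊓ U2
  let β : Γ(Y, W0) := Y.presheaf.map (homOfLE (inf_le_left : W0 ≤ U1)).op α
  let β' : Γ(Y, W0) := Y.presheaf.map (homOfLE (inf_le_right : W0 ≤ U2)).op α'
  have hy0 : y ∈ W0 := ⟨hU1, hU2⟩
  have hβ : Y.presheaf.germ W0 y hy0 β = a := by
    rw [← hα]; exact TopCat.Presheaf.germ_res_apply _ _ _ _ _
  have hβ' : Y.presheaf.germ W0 y hy0 β' = a' := by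
    rw [← hα']; exact TopCat.Presheaf.germ_res_apply _ _ _ _ _
  obtain ⟨W1, hy1, i1, i2, e⟩ := Y.presheaf.germ_eq y hy0 hy0 (β * β')
    (Y.presheaf.map (homOfLE (le_top : W0 ≤ ⊤)).op (P ^ M)) (by
      rw [map_mul, hβ, hβ', hPr, haa])
  have hprod : ∀ z (hz : z ∈ W1), Y.presheaf.germ W0 z (i1.le hz) β * Y.presheaf.germ W0 z (i1.le hz) β' = gm F z ϖ ^ M := by
    intro z hz
    have := congrArg (Y.presheaf.germ W1 z hz) e
    rw [TopCat.Presheaf.germ_res_apply, TopCat.Presheaf.germ_res_apply, hPr, map_mul] at this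
    exact this
  let Bad : Set Y := ⋃ z ∈ {z | FGen F ϖ z ∧ ¬ z ⤳ y}, closure {z}
  have hBad : IsClosed Bad := by
    refine Set.Finite.isClosed_biUnion (H.fgen_finite.subset fun z hz => hz.1) fun z _ => isClosed_closure
  let V : Y.Opens := W1 ⊓ ⟨Badᶜ, hBad.isOpen_compl⟩
  have hyV : y ∈ V := by
    refine ⟨hy1, ?_⟩
    intro hb
    simp only [Bad, Set.mem_iUnion] at hb
    obtain ⟨z, hz, h⟩ := hb
    exact hz.2 (specializes_iff_mem_closure.2 h)
  have hV0 : V ≤ W0 := inf_le_left.trans i1.le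
  let γ : Γ(Y, V) := Y.presheaf.map (homOfLE hV0).op β
  have hγ : ∀ z (hz : z ∈ V), Y.presheaf.germ V z hz γ = Y.presheaf.germ W0 z (hV0 hz) β :=
    fun z hz => TopCat.Presheaf.germ_res_apply _ _ _ _ _
  refine ⟨V, hyV, γ, Y.presheaf.map (homOfLE (le_top : V ≤ ⊤)).op (P ^ N), ?_, ?_, ?_⟩
  · refine nzd_of_germ_ne H.dom _ fun z hz h0 => ?_
    rw [hγ] at h0
    have h3 := hprod z hz.1
    rw [h0, zero_mul] at h3
    haveI := H.dom z
    exact pow_ne_zero M (H.gm_ne z) h3.symm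
  · refine nzd_of_germ_ne H.dom _ fun z hz h0 => ?_
    rw [hPr] at h0
    haveI := H.dom z
    exact pow_ne_zero N (H.gm_ne z) h0
  · intro z hz hd m₁ m₂ h1 h2
    unfold germOrd at h1 h2
    rw [hγ] at h1
    rw [hPr] at h2
    by_cases hϖ : ϖ ∈ (F z).asIdeal
    · have hg := H.fgen_of_div hϖ hd
      have hzy : z ⤳ y := by
        by_contra hzy
        refine hz.2 ?_
        simp only [Bad, Set.mem_iUnion]
        exact ⟨z, ⟨hg, hzy⟩, subset_closure rfl⟩
      obtain ⟨m, ho, hDz⟩ := hord z hzy hg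
      have e1 := hg.elemOrd H hzy hy ho
      have e2 := hg.elemOrd H hzy hy (OrdEx.pow_self (gm F y ϖ) (genPrime hzy) N)
      rw [← hβ] at e1
      have e3 : (Y.presheaf.stalkSpecializes hzy).hom (Y.presheaf.germ W0 y hy0 β) = Y.presheaf.germ W0 z (hV0 hz) β :=
        TopCat.Presheaf.germ_stalkSpecializes_apply Y.presheaf hy0 hzy β
      rw [e3] at e1
      have e4 : (Y.presheaf.stalkSpecializes hzy).hom (gm F y ϖ ^ N) = gm F z ϖ ^ N := by
        rw [map_pow]
        congr 1
        exact congrArg (fun φ => φ.hom ϖ) (gm_spec F hzy)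
      rw [e4] at e2
      rw [hDz, elemOrd_unique h1 e1, elemOrd_unique h2 e2]
    · have hu : IsUnit (gm F z ϖ) := (isUnit_gm F z ϖ).2 hϖ
      have hu1 : IsUnit (Y.presheaf.germ W0 z (hV0 hz) β) := by
        refine isUnit_of_mul_isUnit_left (y := Y.presheaf.germ W0 z (hV0 hz) β') ?_
        rw [hprod z hz.1]
        exact hu.pow M
      rw [hD0 z hϖ, elemOrd_unique h1 (elemOrd_unit hu1), elemOrd_unique h2 (elemOrd_unit (hu.pow N))]
      simp

end texists


section construct

lemma smoothAt_bc {X S T Y : Scheme.{u}} {f : X ⟶ S} {g : T ⟶ S} {p : Y ⟶ X} {F : Y ⟶ T}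
    (hp : IsPullback p F f g) (U : S.Opens) (hsm : Smooth (f ∣_ U)) (y : Y) (hy : f (p y) ∈ U) :
    SmoothAtPt F y := by
  let V : Y.Opens := p ⁻¹ᵁ (f ⁻¹ᵁ U)
  refine ⟨V, hy, ?_⟩
  have h1 : IsPullback (p ∣_ (f ⁻¹ᵁ U)) V.ι (f ⁻¹ᵁ U).ι p := (isPullback_morphismRestrict p (f ⁻¹ᵁ U))
  have h2 := h1.flip.paste_horiz hp.flip
  have h3 : Smooth ((f ⁻¹ᵁ U).ι ≫ f) := by
    rw [← morphismRestrict_ι]; infer_instance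
  exact MorphismProperty.of_isPullback (P := @Smooth) h2.flip h3

lemma geomConn_bc {X S T : Scheme.{u}} (f : X ⟶ S) (g : T ⟶ S) (h : GeomConnFibers f) :
    GeomConnFibers (pullback.snd f g) := by
  intro K _ _ e
  haveI := h K (e ≫ g)
  let i := (pullbackLeftPullbackSndIso f g e).symm
  exact (Scheme.homeoOfIso i).surjective.connectedSpace (Scheme.homeoOfIso i).continuous

lemma dvr_bot {A : Type*} [CommRing A] [IsDomain A] [IsDiscreteValuationRing A] {ϖ : A} (hϖ : Irreducible ϖ)
    (P : Ideal A) [P.IsPrime] (h : ϖ ∉ P) : P = ⊥ := by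
  by_contra hP
  have := Ring.DimensionLEOne.maximalOfPrime hP ‹_›
  have h2 := IsLocalRing.eq_maximalIdeal this
  rw [h2] at h
  exact h hϖ.not_isUnit

lemma TS.mk' (R : CommRingCat.{u}) (hsh : StrictlyHenselianLocal ↥R)
    {X : Scheme.{u}} (f : X ⟶ Spec R) (hss : IsSemistable f)
    (U : (Spec R).Opens) (hsm : Smooth (f ∣_ U))
    (A : CommRingCat.{u}) [IsDomain ↥A] [IsDiscreteValuationRing ↥A] (ψ : R ⟶ A)
    (htraitc : (Spec.map ψ) (closedPt A inferInstance) = closedPt R hsh.toIsLocalRing)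
    (htraitg : (Spec.map ψ) (pt A ⊥) ∈ U) (ϖ : A) (hϖ : Irreducible ϖ) :
    TS (pullback.snd f (Spec.map ψ)) ϖ := by
  have hpb := IsPullback.of_hasPullback f (Spec.map ψ)
  haveI := hss.1
  haveI : IsProper (pullback.snd f (Spec.map ψ)) := inferInstance
  refine ⟨hϖ, ?_, inferInstance, ?_, ?_, geomConn_bc _ _ hss.2.1⟩
  · haveI : IsNoetherianRing A := inferInstance
    exact LocallyOfFiniteType.isLocallyNoetherian (pullback.snd f (Spec.map ψ))
  · intro y hy
    have h1 := dvr_pt hϖ _ hy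
    have h2 : f (pullback.fst f (Spec.map ψ) y) = closedPt R hsh.toIsLocalRing := by
      rw [← Scheme.Hom.comp_apply, pullback.condition, Scheme.Hom.comp_apply, h1, htraitc]
    obtain ⟨D⟩ := hss.2.2 (pullback.fst f (Spec.map ψ) y)
    obtain ⟨n, l, hln, b, ⟨C⟩⟩ := chart_henselian R hsh f _ h2 D
    obtain ⟨C', -⟩ := C.baseChange ψ hpb y rfl
    exact ⟨n, l, hln, _, ⟨C'⟩⟩
  · intro y hy
    refine smoothAt_bc hpb U hsm y ?_
    rw [← Scheme.Hom.comp_apply, pullback.condition, Scheme.Hom.comp_apply]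
    have : (pullback.snd f (Spec.map ψ)) y = pt A ⊥ := by
      haveI := ((pullback.snd f (Spec.map ψ)) y).2
      exact PrimeSpectrum.ext (dvr_bot hϖ _ hy)
    rw [this]; exact htraitg

end construct


section assembly

lemma fiberι_range {X S : Scheme.{u}} (f : X ⟶ S) (s : S) (x : X) :
    x ∈ Set.range (fiberι f s) ↔ f x = s := by
  have := Scheme.Hom.range_fiberι f s
  change x ∈ Set.range (f.fiberι s) ↔ _
  rw [this]; rfl

lemma fiberι_f {X S : Scheme.{u}} (f : X ⟶ S) (s : S) (x : fiberScheme f s) :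
    f (fiberι f s x) = s := (fiberι_range f s _).1 ⟨x, rfl⟩

lemma fiberι_emb {X S : Scheme.{u}} (f : X ⟶ S) (s : S) : Topology.IsEmbedding (fiberι f s) :=
  (f.fiberι s).isEmbedding

lemma fiberι_spec {X S : Scheme.{u}} (f : X ⟶ S) (s : S) (x y : fiberScheme f s) :
    fiberι f s x ⤳ fiberι f s y ↔ x ⤳ y :=
  (fiberι_emb f s).isInducing.specializes_iff

/-- maximal points of a fibre -/
def FibGen {X S : Scheme.{u}} (f : X ⟶ S) (s : S) (x : X) : Prop :=
  f x = s ∧ ∀ x', x' ⤳ x → f x' = s → x ⤳ x'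

lemma fibGen_iff {X S : Scheme.{u}} (f : X ⟶ S) (s : S) (x : fiberScheme f s) :
    FibGen f s (fiberι f s x) ↔ closure {x} ∈ irreducibleComponents (fiberScheme f s) := by
  rw [comp_iff]
  constructor
  · intro h x' hx'
    rw [← fiberι_spec] at hx' ⊢
    exact h.2 _ hx' (fiberι_f f s x')
  · intro h
    refine ⟨fiberι_f f s x, fun x' hx' hf => ?_⟩
    obtain ⟨x', rfl⟩ := (fiberι_range f s _).2 hf
    rw [fiberι_spec] at hx' ⊢
    exact h _ hx'

lemma exists_fibGen_comp {X S : Scheme.{u}} (f : X ⟶ S) (s : S) (v : Set (fiberScheme f s))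
    (hv : v ∈ irreducibleComponents (fiberScheme f s)) :
    ∃ ξ, v = closure {ξ} ∧ FibGen f s (fiberι f s ξ) := by
  obtain ⟨ξ, hξ⟩ := QuasiSober.sober hv.1 (isClosed_of_mem_irreducibleComponents v hv)
  have : closure {ξ} = v := hξ
  refine ⟨ξ, this.symm, (fibGen_iff f s ξ).2 ?_⟩
  rw [this]; exact hv

lemma exists_fibGen {X S : Scheme.{u}} (f : X ⟶ S) (s : S) (x : X) (hx : f x = s) :
    ∃ z, z ⤳ x ∧ FibGen f s z := by
  obtain ⟨x, rfl⟩ := (fiberι_range f s _).2 hx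
  obtain ⟨ξ, h1, h2⟩ := exists_fibGen_comp f s _ (irreducibleComponent_mem_irreducibleComponents x)
  refine ⟨_, ?_, h2⟩
  rw [fiberι_spec, specializes_iff_mem_closure, ← h1]
  exact mem_irreducibleComponent

lemma fib_lift {X S T Y : Scheme.{u}} {f : X ⟶ S} {g : T ⟶ S} {p : Y ⟶ X} {F : Y ⟶ T}
    (hp : IsPullback p F f g) (t : T) (z : Y) (hz : F z = t) (x' : X) (hx' : f x' = g t)
    (h : x' ⤳ p z) : ∃ z', z' ⤳ z ∧ F z' = t ∧ p z' = x' := by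
  obtain ⟨z0, rfl⟩ := (fiberι_range F t z).2 hz
  obtain ⟨x0, rfl⟩ := (fiberι_range f (g t) x').2 hx'
  have h1 : IsPullback (fiberι F t) (fiberRes F t) F (T.fromSpecResidueField t) := IsPullback.of_hasPullback _ _
  have h2 : IsPullback (fiberι f (g t)) (fiberRes f (g t)) f (S.fromSpecResidueField (g t)) := IsPullback.of_hasPullback _ _
  have e := Scheme.Hom.SpecMap_residueFieldMap_fromSpecResidueField g t
  have h3 : IsPullback (fiberι F t ≫ p) (fiberRes F t) f
      (Spec.map (g.residueFieldMap t) ≫ S.fromSpecResidueField (g t)) := by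
    rw [e]
    exact (h1.flip.paste_vert hp.flip).flip
  have h4 := IsPullback.of_right' h3 h2
  set r := h2.lift _ _ _ with hr
  have hrι : r ≫ fiberι f (g t) = fiberι F t ≫ p := IsPullback.lift_fst _ _ _ _
  haveI : Flat (Spec.map (g.residueFieldMap t)) := by
    rw [HasRingHomProperty.Spec_iff (P := @Flat)]
    letI := (g.residueFieldMap t).hom.toAlgebra
    change Module.Flat _ _
    infer_instance
  haveI : Flat r := MorphismProperty.of_isPullback (P := @Flat) h4.flip inferInstance
  have hrz : fiberι f (g t) (r z0) = p (fiberι F t z0) := by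
    rw [← Scheme.Hom.comp_apply, hrι, Scheme.Hom.comp_apply]
  rw [← hrz, fiberι_spec] at h
  obtain ⟨z0', h5, h6⟩ := Flat.generalizingMap r h
  refine ⟨fiberι F t z0', (fiberι_spec _ _ _ _).2 h5, fiberι_f _ _ _, ?_⟩
  rw [← h6, ← Scheme.Hom.comp_apply, ← Scheme.Hom.comp_apply, hrι]

end assembly


section smoothpt

lemma smoothAtPt_iff {Y S : Scheme.{u}} (F : Y ⟶ S) [LocallyOfFinitePresentation F] (y : Y) :
    SmoothAtPt F y ↔ y ∈ F.smoothLocus := by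
  constructor
  · rintro ⟨U, hy, hU⟩
    haveI : Smooth (U.ι ≫ F) := hU
    have h := Scheme.Hom.preimage_smoothLocus_eq U.ι F
    rw [Scheme.Hom.smoothLocus_eq_top (U.ι ≫ F)] at h
    have : (⟨y, hy⟩ : U) ∈ U.ι ⁻¹ᵁ F.smoothLocus := by rw [h]; trivial
    exact this
  · intro hy
    refine ⟨F.smoothLocus, hy, ?_⟩
    change Smooth _
    rw [← Scheme.Hom.smoothLocus_eq_top_iff, ← Scheme.Hom.preimage_smoothLocus_eq]
    exact Scheme.Opens.ι_preimage_self _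

lemma SmoothAtPt.of_etale {V Y S : Scheme.{u}} (h : V ⟶ Y) [Etale h] (F : Y ⟶ S)
    [LocallyOfFinitePresentation F] (v : V) (hv : SmoothAtPt (h ≫ F) v) : SmoothAtPt F (h v) := by
  rw [smoothAtPt_iff, Scheme.Hom.mem_smoothLocus] at hv ⊢
  obtain ⟨U, hU, hyU, -⟩ := exists_isAffineOpen_mem_and_subset (X := S) (U := ⊤) (x := F (h v)) trivial
  obtain ⟨V1, hV1, hy1, e1⟩ := exists_isAffineOpen_mem_and_subset (X := Y) (U := F ⁻¹ᵁ U) (x := h v) hyU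
  obtain ⟨V2, hV2, hy2, e2⟩ := exists_isAffineOpen_mem_and_subset (X := V) (U := h ⁻¹ᵁ V1) (x := v) hy1
  replace e1 : V1 ≤ F ⁻¹ᵁ U := e1
  replace e2 : V2 ≤ h ⁻¹ᵁ V1 := e2
  have e3 : V2 ≤ (h ≫ F) ⁻¹ᵁ U := fun a ha => e1 (e2 ha)
  rw [formallySmooth_stalkMap_iff U hU V1 hV1 e1 hy1]
  have hv' := (formallySmooth_stalkMap_iff U hU V2 hV2 e3 hy2).1 hv
  letI : Algebra Γ(S, U) Γ(Y, V1) := (F.appLE U V1 e1).hom.toAlgebra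
  letI : Algebra Γ(Y, V1) Γ(V, V2) := (h.appLE V1 V2 e2).hom.toAlgebra
  letI : Algebra Γ(S, U) Γ(V, V2) := ((h ≫ F).appLE U V2 e3).hom.toAlgebra
  haveI : IsScalarTower Γ(S, U) Γ(Y, V1) Γ(V, V2) := by
    refine IsScalarTower.of_algebraMap_eq' ?_
    change ((h ≫ F).appLE U V2 e3).hom = (h.appLE V1 V2 e2).hom.comp (F.appLE U V1 e1).hom
    rw [← CommRingCat.hom_comp, Scheme.Hom.appLE_comp_appLE]
  haveI : Algebra.FinitePresentation Γ(S, U) Γ(Y, V1) :=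
    HasRingHomProperty.appLE @LocallyOfFinitePresentation F inferInstance ⟨U, hU⟩ ⟨V1, hV1⟩ e1
  haveI : Algebra.Etale Γ(Y, V1) Γ(V, V2) :=
    HasRingHomProperty.appLE @Etale h inferInstance ⟨V1, hV1⟩ ⟨V2, hV2⟩ e2
  haveI : Algebra.IsSmoothAt Γ(S, U) (hV2.primeIdealOf ⟨v, hy2⟩).asIdeal := hv'
  exact smooth_descent_pt (K := Γ(S, U)) (hV2.primeIdealOf ⟨v, hy2⟩).asIdeal (hV1.primeIdealOf ⟨h v, hy1⟩).asIdeal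
    (congr_arg (fun p => p.asIdeal) (IsAffineOpen.comap_primeIdealOf_appLE V1 hV1 V2 hV2 e2 hy2))

/-- formal smoothness of the stalk over the base ring -/
lemma smoothAtPt_of_gm {Y : Scheme.{u}} {K : CommRingCat.{u}} (F : Y ⟶ Spec K)
    [LocallyOfFinitePresentation F] (y : Y) (h : (gm F y).hom.FormallySmooth) : SmoothAtPt F y := by
  rw [smoothAtPt_iff, Scheme.Hom.mem_smoothLocus]
  have e : gm F y = toSt (F y) ≫ F.stalkMap y := by
    have h1 := gm_comp (𝟙 (Spec K)) F y
    rw [Category.comp_id] at h1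
    rw [← h1, ← Spec.map_id, gm_Spec, Category.id_comp]
  letI : Algebra K ((Spec K).presheaf.stalk (F y)) := (toSt (F y)).hom.toAlgebra
  haveI hpr : (F y).asIdeal.IsPrime := (F y).2
  haveI := toSt_loc (F y)
  letI : Algebra ((Spec K).presheaf.stalk (F y)) (Y.presheaf.stalk y) := (F.stalkMap y).hom.toAlgebra
  letI : Algebra K (Y.presheaf.stalk y) := (gm F y).hom.toAlgebra
  haveI : IsScalarTower K ((Spec K).presheaf.stalk (F y)) (Y.presheaf.stalk y) := by
    refine IsScalarTower.of_algebraMap_eq' ?_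
    change (gm F y).hom = (F.stalkMap y).hom.comp (toSt (F y)).hom
    rw [e]; rfl
  haveI : Algebra.FormallySmooth K (Y.presheaf.stalk y) := h
  exact Algebra.FormallySmooth.localization_base (R := K) (F y).asIdeal.primeCompl
end smoothpt


section strata

lemma exists_reducedSub {X : Scheme.{u}} (C : Set X) (hC : IsClosed C) :
    Nonempty (ReducedClosedSubscheme X C) := by
  let I := Scheme.IdealSheafData.vanishingIdeal (X := X) ⟨C, hC⟩
  refine ⟨⟨I.subscheme, I.subschemeι, inferInstance, ?_, ?_⟩⟩
  · have key : ∀ i : X.affineOpens, IsReduced (Spec (CommRingCat.of (Γ(X, i.1) ⧸ I.ideal i))) := by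
      intro i
      have : (I.ideal i).IsRadical := by
        change (Scheme.IdealSheafData.ideal (Scheme.IdealSheafData.vanishingIdeal (X := X) ⟨C, hC⟩) i).IsRadical
        rw [Scheme.IdealSheafData.vanishingIdeal_ideal]
        exact PrimeSpectrum.isRadical_vanishingIdeal _
      haveI : _root_.IsReduced (Γ(X, i.1) ⧸ I.ideal i) := (Ideal.isRadical_iff_quotient_reduced _).1 this
      exact (affine_isReduced_iff (CommRingCat.of (Γ(X, i.1) ⧸ I.ideal i))).2 this
    haveI : ∀ i, IsReduced (I.subschemeCover.openCover.X i) := key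
    exact IsReduced.of_openCover I.subscheme I.subschemeCover.openCover
  · change Set.range I.subschemeι = C
    rw [Scheme.IdealSheafData.range_subschemeι]
    simp [I]

lemma isOpen_smoothAtPt {Y S : Scheme.{u}} (F : Y ⟶ S) : IsOpen {y | SmoothAtPt F y} := by
  rw [isOpen_iff_forall_mem_open]
  rintro y ⟨U, hy, hU⟩
  exact ⟨U, fun z hz => ⟨U, hz, hU⟩, U.2, hy⟩

/-- the next singular set -/
def nextSing {k : CommRingCat.{u}} {Z : Scheme.{u}} (g : Z ⟶ Spec k) (C : TopologicalSpace.Closeds Z) :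
    TopologicalSpace.Closeds Z :=
  let W := (exists_reducedSub C.1 C.2).some
  ⟨W.ι '' {z | ¬ SmoothAtPt (W.ι ≫ g) z}, by
    haveI := W.isClosedImmersion
    exact W.ι.isClosedEmbedding.isClosedMap _ (isOpen_smoothAtPt (W.ι ≫ g)).isClosed_compl⟩

/-- the sequence of singular sets -/
def singSeq {k : CommRingCat.{u}} {Z : Scheme.{u}} (g : Z ⟶ Spec k) : ℕ → TopologicalSpace.Closeds Z
  | 0 => ⊤
  | r + 1 => nextSing g (singSeq g r)

lemma singSeq_isSing {k : CommRingCat.{u}} {Z : Scheme.{u}} (g : Z ⟶ Spec k) :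
    IsSingSeq g (fun r => (singSeq g r : Set Z)) :=
  ⟨rfl, fun r => ⟨(exists_reducedSub (singSeq g r).1 (singSeq g r).2).some, rfl⟩⟩

lemma smooth_red {k : CommRingCat.{u}} [IsDomain k] [UniqueFactorizationMonoid k] {Z : Scheme.{u}}
    (g : Z ⟶ Spec k)
    (W : ReducedClosedSubscheme Z Set.univ) (z : W.Z) (h : SmoothAtPt g (W.ι z)) :
    SmoothAtPt (W.ι ≫ g) z := by
  obtain ⟨V, hz, hV⟩ := h
  haveI : Smooth (V.ι ≫ g) := hV
  haveI := W.isClosedImmersion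
  haveI hst : ∀ x : V, _root_.IsReduced ((V : Scheme.{u}).presheaf.stalk x) := by
    intro x
    obtain ⟨h1, -⟩ := stalk_normal (V.ι ≫ g) x ⟨⊤, trivial, by
      change Smooth _; infer_instance⟩
    infer_instance
  haveI : IsReduced (V : Scheme.{u}) := @isReduced_of_isReduced_stalk _ hst
  haveI : Surjective (W.ι ∣_ V) := by
    have hW : Surjective W.ι := ⟨Set.range_eq_univ.1 W.range⟩
    exact MorphismProperty.of_isPullback (P := @Surjective) (isPullback_morphismRestrict W.ι V).flip hW
  haveI : IsIso (W.ι ∣_ V) := isIso_of_isClosedImmersion_of_surjective _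
  refine ⟨W.ι ⁻¹ᵁ V, hz, ?_⟩
  change Smooth _
  have : (W.ι ⁻¹ᵁ V).ι ≫ W.ι ≫ g = (W.ι ∣_ V) ≫ V.ι ≫ g := by
    rw [morphismRestrict_ι_assoc]
  rw [this]
  infer_instance

lemma not_smooth_of_two {k : CommRingCat.{u}} [IsDomain k] [UniqueFactorizationMonoid k]
    {Z : Scheme.{u}} (g : Z ⟶ Spec k) (y ξ₁ ξ₂ : Z) (h₁ : ξ₁ ⤳ y) (h₂ : ξ₂ ⤳ y)
    (g₁ : ∀ z, z ⤳ ξ₁ → ξ₁ ⤳ z) (g₂ : ∀ z, z ⤳ ξ₂ → ξ₂ ⤳ z) (hne : ξ₁ ≠ ξ₂) :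
    ¬ SmoothAtPt g y := by
  intro h
  obtain ⟨h1, -⟩ := stalk_normal g y h
  obtain ⟨z, hz, hz', -⟩ := exists_genPrime (⊥ : Ideal (Z.presheaf.stalk y))
  have e : ∀ ξ, ξ ⤳ y → (∀ z, z ⤳ ξ → ξ ⤳ z) → ξ = z := by
    intro ξ hξ hg
    have : z ⤳ ξ := by rw [← genPrime_le hz hξ, hz']; exact bot_le
    exact ((hg z this).antisymm this).eq
  exact hne ((e _ h₁ g₁).trans (e _ h₂ g₂).symm)

/-- A general criterion for a stratum. -/
lemma exists_stratum {k : CommRingCat.{u}} [IsDomain k] [UniqueFactorizationMonoid k]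
    {Z : Scheme.{u}} (g : Z ⟶ Spec k) (y : Z)
    (hns : ∀ W : ReducedClosedSubscheme Z Set.univ, ∀ z, W.ι z = y → ¬ SmoothAtPt (W.ι ≫ g) z)
    (hgen : ∀ z, z ⤳ y → ¬ (y ⤳ z) → SmoothAtPt g z)
    (hsm : ∀ C, ∀ W : ReducedClosedSubscheme Z C, ∀ z, W.ι z = y → (∀ z', z' ⤳ z → z' = z) →
      SmoothAtPt (W.ι ≫ g) z) :
    ∃ T, IsStratum g 1 T ∧ y ∈ T ∧ T ⊆ closure {y} := by
  let W0 := (exists_reducedSub (singSeq g 0).1 (singSeq g 0).2).some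
  let W1 := (exists_reducedSub (singSeq g 1).1 (singSeq g 1).2).some
  haveI := W0.isClosedImmersion
  haveI := W1.isClosedImmersion
  obtain ⟨y0, hy0⟩ : y ∈ Set.range W0.ι := by
    have := W0.range
    change Set.range W0.ι = _ at this
    rw [this]; trivial
  have hy1 : y ∈ (singSeq g 1).1 := ⟨y0, hns W0 y0 hy0, hy0⟩
  have hr1 : Set.range W1.ι = (singSeq g 1).1 := W1.range
  obtain ⟨y1, hy1'⟩ : y ∈ Set.range W1.ι := by rw [hr1]; exact hy1
  have hmin : ∀ z', z' ⤳ y1 → z' = y1 := by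
    intro z' hz'
    have h1 : W1.ι z' ⤳ y := by rw [← hy1']; exact hz'.map W1.ι.continuous
    have h2 : y ⤳ W1.ι z' := by
      by_contra h2
      have h3 := hgen _ h1 h2
      have h4 : W1.ι z' ∈ (singSeq g 1).1 := hr1.subset ⟨z', rfl⟩
      obtain ⟨z0, h5, h6⟩ := h4
      refine h5 (smooth_red g W0 z0 ?_)
      have h6' : W0.ι z0 = W1.ι z' := h6
      rw [h6']; exact h3
    have h3 := (h1.antisymm h2).eq
    rw [← hy1'] at h3
    exact W1.ι.isClosedEmbedding.injective h3
  have hs := hsm _ W1 y1 hy1' hmin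
  let y2 : {z : W1.Z // SmoothAtPt (W1.ι ≫ g) z} := ⟨y1, hs⟩
  haveI : QuasiSober {z : W1.Z // SmoothAtPt (W1.ι ≫ g) z} :=
    (isOpen_smoothAtPt (W1.ι ≫ g)).isOpenEmbedding_subtypeVal.quasiSober
  refine ⟨W1.ι '' (Subtype.val '' closure {y2}), ⟨_, singSeq_isSing g, W1, closure {y2}, ?_, rfl⟩, ?_, ?_⟩
  · rw [comp_iff]
    intro z' hz'
    have h1 := hmin z'.1 ((subtype_specializes_iff _ _).1 hz')
    have : z' = y2 := Subtype.ext h1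
    rw [this]
  · exact ⟨y1, ⟨y2, subset_closure rfl, rfl⟩, hy1'⟩
  · rintro _ ⟨_, ⟨z, hz, rfl⟩, rfl⟩
    rw [← specializes_iff_mem_closure] at hz ⊢
    rw [← hy1']
    exact ((subtype_specializes_iff _ _).1 hz).map W1.ι.continuous

end strata


lemma fs_of_ringEquiv {A B : Type u} [CommRing A] [CommRing B] (e : A ≃+* B) :
    (e.toRingHom).FormallySmooth := by
  apply RingHom.FormallySmooth.of_bijective
  exact e.bijective

section fieldstd

variable {K : Type u} [CommRing K] {n l : ℕ} {c : K} {E : Type u} [CommRing E]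
  [Algebra (stdRing K n l c) E] [Algebra.Etale (stdRing K n l c) E]

lemma isMaximal_bot_of_field (hK : IsField K) : (⊥ : Ideal K).IsMaximal := by
  letI := hK.toField
  exact Ideal.bot_isMaximal (K := K)

lemma std_prime (hK : IsField K) (q : Ideal E) [q.IsPrime] (hc : c = 0) (S : Set (Fin n)) (s : Fin n)
    (hs : s ∈ S) (hsl : (s : ℕ) < l)
    (hSq : ∀ j ∈ S, algebraMap (stdRing K n l c) E (stdCoord K n l c j) ∈ q) :
    ∃ w : Ideal E, w.IsPrime ∧ w ≤ q ∧
      (∀ j, algebraMap (stdRing K n l c) E (stdCoord K n l c j) ∈ w ↔ j ∈ S) ∧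
      (∀ w' : Ideal E, w'.IsPrime → w' ≤ q →
        (∀ j ∈ S, algebraMap (stdRing K n l c) E (stdCoord K n l c j) ∈ w') → w ≤ w') ∧
      ∀ e ∈ w, ∃ t ∉ q, t * e ∈ (stdI n l c ⊥ S).map (algebraMap _ E) := by
  obtain ⟨O, iO, iA, iL⟩ : ∃ (O : Type u) (_ : CommRing O) (_ : Algebra E O), IsLocalization.AtPrime O q :=
    ⟨Localization.AtPrime q, inferInstance, inferInstance, inferInstance⟩
  haveI : IsLocalization q.primeCompl O := iL
  letI : Algebra (stdRing K n l c) O := ((algebraMap E O).comp (algebraMap _ E)).toAlgebra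
  haveI : IsScalarTower (stdRing K n l c) E O := IsScalarTower.of_algebraMap_eq' rfl
  obtain ⟨h1, h2⟩ := std_local (O := O) q (⊥ : Ideal K) (isMaximal_bot_of_field hK) S (by simp [hc]) s hs hsl
    (by rintro r hr; rw [Ideal.mem_bot.1 hr, map_zero, map_zero]; exact q.zero_mem) hSq
  set P := (stdI n l c ⊥ S).map (algebraMap (stdRing K n l c) O) with hP
  have hPE : P = ((stdI n l c ⊥ S).map (algebraMap _ E)).map (algebraMap E O) := by
    rw [Ideal.map_map]; rfl
  have hfrac : ∀ e ∈ P.comap (algebraMap E O), ∃ t ∉ q, t * e ∈ (stdI n l c ⊥ S).map (algebraMap _ E) := by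
    intro e he
    rw [Ideal.mem_comap, hPE, IsLocalization.mem_map_algebraMap_iff q.primeCompl] at he
    obtain ⟨⟨a, t⟩, h⟩ := he
    rw [← map_mul] at h
    obtain ⟨t', ht'⟩ := (IsLocalization.eq_iff_exists q.primeCompl O).1 h
    refine ⟨t' * t, (t' * t).2, ?_⟩
    have : (t' : E) * t * e = t' * (e * t) := by ring
    rw [this, ht']
    exact Ideal.mul_mem_left _ _ a.2
  have hstd : ∀ w' : Ideal E, (∀ j ∈ S, algebraMap (stdRing K n l c) E (stdCoord K n l c j) ∈ w') →
      (stdI n l c ⊥ S).map (algebraMap _ E) ≤ w' := by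
    intro w' h
    rw [stdI, Ideal.map_bot, bot_sup_eq, Ideal.map_span, Ideal.span_le]
    rintro _ ⟨_, ⟨j, hj, rfl⟩, rfl⟩
    exact h j hj
  refine ⟨P.comap (algebraMap E O), Ideal.IsPrime.comap _, ?_, ?_, ?_, hfrac⟩
  · intro e he
    obtain ⟨t, ht, h⟩ := hfrac e he
    exact (Ideal.IsPrime.mem_or_mem ‹_› (hstd q hSq h)).resolve_left ht
  · intro j
    refine ⟨fun h => ?_, fun h => ?_⟩
    · by_contra hj
      exact h2 j hj h
    · refine Ideal.mem_map_of_mem (algebraMap (stdRing K n l c) O) ?_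
      exact Ideal.mem_sup_right (Ideal.subset_span ⟨j, h, rfl⟩)
  · intro w' hw' hle h e he
    obtain ⟨t, ht, h'⟩ := hfrac e he
    exact (hw'.mem_or_mem (hstd w' h h')).resolve_left (fun h => ht (hle h))

lemma std_residue_smooth (hc : c = 0) (S : Set (Fin n)) (s : Fin n)
    (hs : s ∈ S) (hsl : (s : ℕ) < l) (w : Ideal E) [w.IsPrime]
    (hw : ∀ j ∈ S, algebraMap (stdRing K n l c) E (stdCoord K n l c j) ∈ w)
    (hgen : ∀ e ∈ w, ∃ t ∉ w, t * e ∈ (stdI n l c ⊥ S).map (algebraMap _ E))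
    {L : Type u} [CommRing L] (hL : IsField L) (τ : E →+* L) (hτ : RingHom.ker τ = w)
    (hfr : ∀ z : L, ∃ e t, t ∉ w ∧ z * τ t = τ e) :
    (τ.comp ((algebraMap (stdRing K n l c) E).comp (algebraMap K _))).FormallySmooth := by
  set I := stdI n l c ⊥ S with hI
  have hIw : I.map (algebraMap _ E) ≤ w := by
    rw [hI, stdI, Ideal.map_bot, bot_sup_eq, Ideal.map_span, Ideal.span_le]
    rintro _ ⟨_, ⟨j, hj, rfl⟩, rfl⟩
    exact hw j hj
  obtain ⟨φ, p1, p2, p3, p4⟩ := stdI_quot (K := K) (l := l) (c := c) ⊥ S (by simp [hc]) s hs hsl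
  -- the polynomial step
  have f1 : (Ideal.Quotient.mk (⊥ : Ideal K)).FormallySmooth := by
    apply RingHom.FormallySmooth.of_bijective
    exact ⟨by rw [RingHom.injective_iff_ker_eq_bot, Ideal.mk_ker], Ideal.Quotient.mk_surjective⟩
  have f2 : (MvPolynomial.C : K ⧸ (⊥ : Ideal K) →+* MvPolynomial {j // j ∉ S} (K ⧸ (⊥ : Ideal K))).FormallySmooth := by
    have := (RingHom.formallySmooth_algebraMap (R := K ⧸ (⊥ : Ideal K))
      (S := MvPolynomial {j // j ∉ S} (K ⧸ (⊥ : Ideal K)))).2 inferInstance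
    exact this
  let ε : stdRing K n l c ⧸ I ≃+* MvPolynomial {j // j ∉ S} (K ⧸ (⊥ : Ideal K)) :=
    (Ideal.quotEquivOfEq p2.symm).trans (RingHom.quotientKerEquivOfSurjective p1)
  have hε : ∀ a, ε (Ideal.Quotient.mk I a) = φ a := fun a => rfl
  have f3 := fs_of_ringEquiv (A := MvPolynomial {j // j ∉ S} (K ⧸ (⊥ : Ideal K))) (B := stdRing K n l c ⧸ I) ε.symm
  haveI := etale_quot (E := E) I
  have f4 : (algebraMap (stdRing K n l c ⧸ I) (E ⧸ I.map (algebraMap _ E))).FormallySmooth :=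
    (RingHom.formallySmooth_algebraMap).2 inferInstance
  let τ' : E ⧸ I.map (algebraMap _ E) →+* L := Ideal.Quotient.lift _ τ (fun a ha => by
    rw [← RingHom.mem_ker, hτ]; exact hIw ha)
  have f5 : τ'.FormallySmooth := by
    letI := τ'.toAlgebra
    let M : Submonoid (E ⧸ I.map (algebraMap _ E)) := w.primeCompl.map (Ideal.Quotient.mk _)
    haveI : IsLocalization M L := by
      have hne : ∀ t, t ∉ w → τ t ≠ 0 := fun t ht h => ht (by rw [← hτ]; exact h)
      refine ⟨?_, ?_, ?_⟩
      · rintro ⟨_, t, ht, rfl⟩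
        obtain ⟨b, hb⟩ := hL.mul_inv_cancel (hne t ht)
        exact IsUnit.of_mul_eq_one b hb
      · intro z
        obtain ⟨e, t, ht, h⟩ := hfr z
        exact ⟨⟨Ideal.Quotient.mk _ e, ⟨_, t, ht, rfl⟩⟩, h⟩
      · intro a b h
        obtain ⟨a, rfl⟩ := Ideal.Quotient.mk_surjective a
        obtain ⟨b, rfl⟩ := Ideal.Quotient.mk_surjective b
        have h' : τ a = τ b := h
        obtain ⟨t, ht, h2⟩ := hgen (a - b) (by rw [← hτ, RingHom.mem_ker, map_sub, h', sub_self])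
        refine ⟨⟨_, t, ht, rfl⟩, ?_⟩
        change Ideal.Quotient.mk _ t * Ideal.Quotient.mk _ a = Ideal.Quotient.mk _ t * Ideal.Quotient.mk _ b
        rw [← map_mul, ← map_mul, Ideal.Quotient.eq, ← mul_sub]
        exact h2
    exact Algebra.FormallySmooth.of_isLocalization M
  have f := (((f1.comp f2).comp f3).comp f4).comp f5
  convert f using 1
  ext r
  have : (ε.symm (MvPolynomial.C (Ideal.Quotient.mk ⊥ r)) : stdRing K n l c ⧸ I) =
      Ideal.Quotient.mk I (algebraMap K _ r) := by
    rw [RingEquiv.symm_apply_eq, hε, p4]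
  simp only [RingHom.comp_apply]
  erw [this]
  rfl

lemma std_co_mem {q : Ideal E} [q.IsPrime] (hc : c = 0) :
    ∃ i : Fin n, (i : ℕ) < l ∧ algebraMap (stdRing K n l c) E (stdCoord K n l c i) ∈ q := by
  have h := congrArg (algebraMap (stdRing K n l c) E) (std_prod (K := K) (n := n) (l := l) (c := c))
  have hc' : algebraMap K (stdRing K n l c) c = 0 := (congrArg (algebraMap K _) hc).trans (map_zero _)
  rw [hc', map_zero, map_prod] at h
  have h0 : (0 : E) ∈ q := q.zero_mem
  rw [← h, Ideal.IsPrime.prod_mem_iff] at h0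
  obtain ⟨i, -, hi⟩ := h0
  by_cases hl : (i : ℕ) < l
  · rw [if_pos hl] at hi
    exact ⟨i, hl, hi⟩
  · rw [if_neg hl, map_one] at hi
    exact absurd hi ((Ideal.ne_top_iff_one q).1 (Ideal.IsPrime.ne_top ‹_›))

lemma std_c_zero (hK : IsField K) {q : Ideal E} [q.IsPrime] (i : Fin n) (hi : (i : ℕ) < l)
    (hq : algebraMap (stdRing K n l c) E (stdCoord K n l c i) ∈ q) : c = 0 := by
  by_contra hc
  obtain ⟨d, hd⟩ := hK.mul_inv_cancel hc
  have h := congrArg (algebraMap (stdRing K n l c) E) (std_prod (K := K) (n := n) (l := l) (c := c))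
  rw [map_prod] at h
  have h1 : algebraMap (stdRing K n l c) E (algebraMap K _ c) ∈ q := by
    rw [← h]
    refine Ideal.mem_of_dvd _ (Finset.dvd_prod_of_mem _ (Finset.mem_univ i)) ?_
    rw [if_pos hi]; exact hq
  have h2 := q.mul_mem_right (algebraMap (stdRing K n l c) E (algebraMap K _ d)) h1
  rw [← map_mul, ← map_mul, hd, map_one, map_one] at h2
  exact (Ideal.ne_top_iff_one q).1 (Ideal.IsPrime.ne_top ‹_›) h2

end fieldstd


section k8core

lemma spec_le {E : CommRingCat.{u}} {w q : Spec E} : w ⤳ q ↔ w.asIdeal ≤ q.asIdeal :=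
  (PrimeSpectrum.le_iff_specializes (w : PrimeSpectrum E) q).symm

variable {k : CommRingCat.{u}} {Z : Scheme.{u}} {g : Z ⟶ Spec k} {y : Z} {n l : ℕ} {c : k}

lemma Ch.etale (C : Ch g y n l c) : C.θ.hom.Etale := by
  have := C.θ_et
  rwa [HasRingHomProperty.Spec_iff (P := @Etale)] at this

lemma Ch.prime (hk : IsField k) (C : Ch g y n l c) (hc : c = 0) (q' : Spec C.E) (S : Set (Fin n)) (s : Fin n)
    (hs : s ∈ S) (hsl : (s : ℕ) < l) (hS : ∀ a ∈ S, C.co a ∈ q'.asIdeal) :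
    ∃ w : Spec C.E, w ⤳ q' ∧ (∀ a, C.co a ∈ w.asIdeal ↔ a ∈ S) ∧
      (∀ w' : Spec C.E, w' ⤳ q' → (∀ a ∈ S, C.co a ∈ w'.asIdeal) → w ⤳ w') ∧
      ∀ e ∈ w.asIdeal, ∃ t ∉ w.asIdeal, t * e ∈ (stdI n l c ⊥ S).map C.θ.hom := by
  letI := C.θ.hom.toAlgebra
  haveI : Algebra.Etale (stdRing k n l c) C.E := C.etale
  haveI : q'.asIdeal.IsPrime := q'.2
  obtain ⟨w, h0, h1, h2, h3, h4⟩ := std_prime (K := k) (n := n) (l := l) (c := c) (E := C.E) hk q'.asIdeal hc S s hs hsl hS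
  refine ⟨pt _ w, spec_le.2 h1, h2, fun w' hw' h => spec_le.2 (h3 _ w'.2 (spec_le.1 hw') h), fun e he => ?_⟩
  obtain ⟨t, ht, h⟩ := h4 e he
  exact ⟨t, fun h => ht (h1 h), h⟩

lemma Ch.smoothAt [LocallyOfFinitePresentation g] (C : Ch g y n l c) (w : Spec C.E) (i0 : Fin n) (hi0 : (i0 : ℕ) < l)
    (h : ∀ a : Fin n, (a : ℕ) < l → a ≠ i0 → C.co a ∉ w.asIdeal) : SmoothAtPt g (C.g w) := by
  haveI := C.g_et
  apply SmoothAtPt.of_etale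
  apply smoothAtPt_of_gm
  rw [C.comm', gm_Spec]
  letI := C.θ.hom.toAlgebra
  letI : Algebra k C.E := C.a.hom.toAlgebra
  haveI : IsScalarTower k (stdRing k n l c) C.E := IsScalarTower.of_algebraMap_eq (R := k) (S := stdRing k n l c) (A := C.E) (fun _ => rfl)
  haveI : Algebra.Etale (stdRing k n l c) C.E := C.etale
  haveI : w.asIdeal.IsPrime := w.2
  have h1 : Algebra.FormallySmooth k (Localization.AtPrime w.asIdeal) :=
    std_smoothAt (K := k) (n := n) (l := l) (c := c) (E := C.E) w.asIdeal i0 hi0 h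
  letI := (toSt w).hom.toAlgebra
  haveI := toSt_loc w
  letI : Algebra k ((Spec C.E).presheaf.stalk w) := (C.a ≫ toSt w).hom.toAlgebra
  haveI : IsScalarTower k C.E ((Spec C.E).presheaf.stalk w) := IsScalarTower.of_algebraMap_eq' rfl
  let ε : Localization.AtPrime w.asIdeal ≃ₐ[C.E] ((Spec C.E).presheaf.stalk w) :=
    IsLocalization.algEquiv w.asIdeal.primeCompl _ _
  change Algebra.FormallySmooth k ((Spec C.E).presheaf.stalk w)
  exact Algebra.FormallySmooth.of_equiv (ε.restrictScalars k)

end k8core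


section k8res
open IsLocalRing

lemma stalk_field {W : Scheme.{u}} (hW : AlgebraicGeometry.IsReduced W) (z : W) (hz : ∀ z', z' ⤳ z → z' = z) :
    IsField (W.presheaf.stalk z) := by
  rw [IsLocalRing.isField_iff_maximalIdeal_eq, eq_bot_iff]
  intro a ha
  have : _root_.IsReduced (W.presheaf.stalk z) := inferInstance
  rw [Ideal.mem_bot]
  have h : a ∈ nilradical (W.presheaf.stalk z) := by
    rw [nilradical_eq_sInf, Ideal.mem_sInf]
    intro P hP
    haveI : P.IsPrime := hP
    obtain ⟨z', h1, h2, -⟩ := exists_genPrime P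
    obtain rfl := hz z' h1
    rw [← h2, genPrime, Ideal.mem_comap, mem_maximalIdeal]
    have h3 : (W.presheaf.stalkSpecializes h1) = 𝟙 _ := W.presheaf.stalkSpecializes_refl z'
    rw [h3]
    exact ha
  rw [nilradical_eq_zero] at h
  exact h

lemma stalk_field_etale {V W : Scheme.{u}} (h : V ⟶ W) [Etale h] (v : V)
    (hf : IsField (W.presheaf.stalk (h v))) : IsField (V.presheaf.stalk v) := by
  rw [IsLocalRing.isField_iff_maximalIdeal_eq] at hf ⊢
  letI := (h.stalkMap v).hom.toAlgebra
  haveI : IsLocalHom (algebraMap (W.presheaf.stalk (h v)) (V.presheaf.stalk v)) :=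
    inferInstanceAs <| IsLocalHom (h.stalkMap v).hom
  haveI : Algebra.EssFiniteType (W.presheaf.stalk (h v)) (V.presheaf.stalk v) := by
    rw [← RingHom.essFiniteType_algebraMap, RingHom.algebraMap_toAlgebra]
    exact LocallyOfFiniteType.stalkMap h v
  haveI : Algebra.FormallyUnramified (W.presheaf.stalk (h v)) (V.presheaf.stalk v) := by
    rw [← RingHom.formallyUnramified_algebraMap, RingHom.algebraMap_toAlgebra]
    exact FormallyUnramified.stalkMap h v
  rw [← Algebra.FormallyUnramified.map_maximalIdeal (R := W.presheaf.stalk (h v)), hf, Ideal.map_bot]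

variable {k : CommRingCat.{u}} {Z : Scheme.{u}} {g : Z ⟶ Spec k} {y : Z} {n l : ℕ} {c : k}

lemma gm_eq_toSt {Y : Scheme.{u}} {K : CommRingCat.{u}} (F : Y ⟶ Spec K) (y : Y) :
    gm F y = toSt (F y) ≫ F.stalkMap y := by
  have h1 := gm_comp (𝟙 (Spec K)) F y
  rw [Category.comp_id] at h1
  rw [← h1, ← Spec.map_id, gm_Spec, Category.id_comp]

lemma Ch.smooth_closure [LocallyOfFiniteType g] [IsNoetherianRing k] (C : Ch g y n l c) (hc : c = 0)
    (S : Set (Fin n)) (s : Fin n) (hs : s ∈ S) (hsl : (s : ℕ) < l) (w : Spec C.E)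
    (hw : ∀ a ∈ S, C.co a ∈ w.asIdeal)
    (hgen : ∀ e ∈ w.asIdeal, ∃ t ∉ w.asIdeal, t * e ∈ (stdI n l c ⊥ S).map C.θ.hom)
    (D : Set Z) (W : ReducedClosedSubscheme Z D) (z : W.Z) (hz : W.ι z = C.g w)
    (hgz : ∀ z', z' ⤳ z → z' = z) : SmoothAtPt (W.ι ≫ g) z := by
  haveI := W.isClosedImmersion
  haveI := C.g_et
  haveI : LocallyOfFinitePresentation (W.ι ≫ g) :=
    LocallyOfFinitePresentation.iff_locallyOfFiniteType.2 inferInstance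
  have hp := IsPullback.of_hasPullback W.ι C.g
  obtain ⟨v, hv1, hv2⟩ := isPullback_point hp z w hz
  let h := pullback.fst W.ι C.g
  let i := pullback.snd W.ι C.g
  haveI : Etale h := MorphismProperty.of_isPullback (P := @Etale) hp.flip inferInstance
  haveI : IsClosedImmersion i := MorphismProperty.of_isPullback (P := @IsClosedImmersion) hp inferInstance
  have hL : IsField ((pullback W.ι C.g).presheaf.stalk v) := by
    apply stalk_field_etale h
    have := stalk_field W.reduced z hgz
    rw [← hv1] at this
    exact this
  rw [← hv1]
  refine SmoothAtPt.of_etale h _ v (smoothAtPt_of_gm _ v ?_)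
  have e1 : h ≫ W.ι ≫ g = i ≫ Spec.map C.a := by
    rw [← C.comm', ← Category.assoc, hp.w, Category.assoc]
  have e2 : gm (i ≫ Spec.map C.a) v = C.a ≫ gm i v := by
    apply Spec.map_injective
    rw [Spec.map_comp, gm_map, gm_map, Category.assoc]
  rw [e1, e2]
  letI := C.θ.hom.toAlgebra
  haveI : Algebra.Etale (stdRing k n l c) C.E := C.etale
  haveI : w.asIdeal.IsPrime := w.2
  have hmax := (IsLocalRing.isField_iff_maximalIdeal_eq).1 hL
  refine std_residue_smooth (K := k) (n := n) (l := l) (c := c) (E := C.E) hc S s hs hsl w.asIdeal hw hgen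
    hL (gm i v).hom ?_ ?_
  · ext a
    have h1 := mem_genPrime i (specializes_rfl : v ⤳ v) a
    have h2 : genPrime (specializes_rfl : v ⤳ v) = ⊥ := by
      rw [← hmax]
      have h3 : ((pullback W.ι C.g).presheaf.stalkSpecializes (specializes_rfl : v ⤳ v)) = 𝟙 _ :=
        (pullback W.ι C.g).presheaf.stalkSpecializes_refl v
      rw [genPrime, h3]
      rfl
    rw [h2, Ideal.mem_bot] at h1
    rw [RingHom.mem_ker]
    refine h1.trans ?_
    change a ∈ ((pullback.snd W.ι C.g) v).asIdeal ↔ _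
    rw [hv2]
  · intro x
    obtain ⟨x', rfl⟩ := i.stalkMap_surjective v x
    letI := (toSt (i v)).hom.toAlgebra
    haveI : (i v).asIdeal.IsPrime := (i v).2
    haveI := toSt_loc (i v)
    obtain ⟨⟨e, t⟩, he⟩ := IsLocalization.surj (i v).asIdeal.primeCompl x'
    refine ⟨e, t, ?_, ?_⟩
    · rw [← hv2]; exact t.2
    · rw [gm_eq_toSt]
      have := congrArg (i.stalkMap v).hom he
      rw [map_mul] at this
      exact this

end k8res


section k8field

lemma field_core {k : CommRingCat.{u}} (hk : IsField k) {Z : Scheme.{u}} {g : Z ⟶ Spec k}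
    [LocallyOfFiniteType g] {y : Z} {n l : ℕ} {c : k}
    (C : Ch g y n l c) (i j : Fin n) (hi : (i : ℕ) < l) (hj : (j : ℕ) < l)
    (w₁ w₂ : Spec C.E) (h₁ : w₁ ⤳ C.q) (h₂ : w₂ ⤳ C.q)
    (hi1 : C.co i ∈ w₁.asIdeal) (hj2 : C.co j ∈ w₂.asIdeal)
    (hg1 : ∀ z, z ⤳ C.g w₁ → C.g w₁ ⤳ z) (hg2 : ∀ z, z ⤳ C.g w₂ → C.g w₂ ⤳ z) (hne : C.g w₁ ≠ C.g w₂) :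
    ∃ w : Spec C.E, (∀ a, C.co a ∈ w.asIdeal ↔ a = i ∨ a = j) ∧ C.g w₁ ⤳ C.g w ∧ C.g w₂ ⤳ C.g w ∧
      (∀ ζ, ζ ⤳ C.g w → (∀ z, z ⤳ ζ → ζ ⤳ z) → ζ = C.g w₁ ∨ ζ = C.g w₂) ∧
      ∃ T, IsStratum g 1 T ∧ C.g w ∈ T ∧ T ⊆ closure {C.g w} := by
  letI : Field k := hk.toField
  haveI : IsDomain k := hk.isDomain
  haveI : IsNoetherianRing k := inferInstance
  haveI : UniqueFactorizationMonoid k := inferInstance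
  haveI : LocallyOfFinitePresentation g :=
    LocallyOfFinitePresentation.iff_locallyOfFiniteType.2 inferInstance
  have hflat := C.flat
  have hq : ∀ {w : Spec C.E}, w ⤳ C.q → ∀ a, C.co a ∈ w.asIdeal → C.co a ∈ C.q.asIdeal :=
    fun h a ha => spec_le.1 h ha
  have hc : c = 0 := by
    letI := C.θ.hom.toAlgebra
    haveI : Algebra.Etale (stdRing k n l c) C.E := C.etale
    haveI : w₁.asIdeal.IsPrime := w₁.2
    exact std_c_zero (K := k) (n := n) (l := l) (c := c) (E := C.E) hk (q := w₁.asIdeal) i hi hi1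
  obtain ⟨P, p1, p2, p3, -⟩ := C.prime hk hc C.q {i} i rfl hi (by rintro _ rfl; exact hq h₁ _ hi1)
  obtain ⟨Q, q1, q2, q3, -⟩ := C.prime hk hc C.q {j} j rfl hj (by rintro _ rfl; exact hq h₂ _ hj2)
  obtain ⟨w, w1, w2, w3, w4⟩ := C.prime hk hc C.q {i, j} i (by simp) hi (by
    rintro a (rfl | rfl)
    · exact hq h₁ _ hi1
    · exact hq h₂ _ hj2)
  have hPg : C.g P = C.g w₁ := by
    have : C.g P ⤳ C.g w₁ := (p3 w₁ h₁ (by rintro _ rfl; exact hi1)).map C.g.continuous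
    exact (this.antisymm (hg1 _ this)).eq
  have hQg : C.g Q = C.g w₂ := by
    have : C.g Q ⤳ C.g w₂ := (q3 w₂ h₂ (by rintro _ rfl; exact hj2)).map C.g.continuous
    exact (this.antisymm (hg2 _ this)).eq
  have hPw : C.g w₁ ⤳ C.g w := by
    rw [← hPg]; exact (p3 w w1 (by rintro _ rfl; exact (w2 _).2 (by simp))).map C.g.continuous
  have hQw : C.g w₂ ⤳ C.g w := by
    rw [← hQg]; exact (q3 w w1 (by rintro _ rfl; exact (w2 _).2 (by simp))).map C.g.continuous
  refine ⟨w, fun a => w2 a, hPw, hQw, ?_, ?_⟩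
  · intro ζ hζ hgen
    obtain ⟨w', hw', rfl⟩ := Flat.generalizingMap C.g hζ
    letI := C.θ.hom.toAlgebra
    haveI : Algebra.Etale (stdRing k n l c) C.E := C.etale
    haveI : w'.asIdeal.IsPrime := w'.2
    obtain ⟨a, ha, ha'⟩ := std_co_mem (K := k) (n := n) (l := l) (c := c) (E := C.E) (q := w'.asIdeal) hc
    rcases (w2 a).1 (spec_le.1 hw' ha') with rfl | rfl
    · left
      have : C.g P ⤳ C.g w' := (p3 w' (hw'.trans w1) (by rintro _ rfl; exact ha')).map C.g.continuous
      rw [← hPg]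
      exact ((hgen _ this).antisymm this).eq
    · right
      have : C.g Q ⤳ C.g w' := (q3 w' (hw'.trans w1) (by rintro _ rfl; exact ha')).map C.g.continuous
      rw [← hQg]
      exact ((hgen _ this).antisymm this).eq
  · apply exists_stratum
    · intro W z hz
      haveI := W.isClosedImmersion
      have hemb := (W.ι.isClosedEmbedding).isEmbedding.isInducing
      have hr : ∀ x, ∃ x', W.ι x' = x := fun x => by
        have : x ∈ Set.range W.ι.base := by rw [W.range]; trivial
        exact this
      obtain ⟨ξ₁, e1⟩ := hr (C.g w₁)
      obtain ⟨ξ₂, e2⟩ := hr (C.g w₂)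
      refine not_smooth_of_two _ z ξ₁ ξ₂ ?_ ?_ ?_ ?_ ?_
      · rw [← hemb.specializes_iff, e1, hz]; exact hPw
      · rw [← hemb.specializes_iff, e2, hz]; exact hQw
      · intro z' h; rw [← hemb.specializes_iff, e1] at h ⊢; exact hg1 _ h
      · intro z' h; rw [← hemb.specializes_iff, e2] at h ⊢; exact hg2 _ h
      · rintro rfl; exact hne (e1.symm.trans e2)
    · intro z hz hnz
      obtain ⟨w', hw', rfl⟩ := Flat.generalizingMap C.g hz
      by_cases h : C.co i ∈ w'.asIdeal
      · refine C.smoothAt w' i hi ?_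
        intro a ha hai ha'
        rcases (w2 a).1 (spec_le.1 hw' ha') with rfl | rfl
        · exact hai rfl
        · refine hnz ((w3 w' (hw'.trans w1) ?_).map C.g.continuous)
          rintro _ (rfl | rfl) <;> assumption
      · refine C.smoothAt w' j hj ?_
        intro a ha haj ha'
        rcases (w2 a).1 (spec_le.1 hw' ha') with rfl | rfl
        · exact h ha'
        · exact haj rfl
    · intro D W z hz hgz
      exact C.smooth_closure hc {i, j} i (by simp) hi w (fun a ha => (w2 a).2 ha) w4 D W z hz hgz

end k8field


section k8label

lemma exists_perm_two {n : ℕ} (i j : Fin n) (hij : i ≠ j) :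
    2 ≤ n ∧ ∃ σ : Equiv.Perm (Fin n), ∀ a : Fin n, (a : ℕ) < 2 ↔ (σ a = i ∨ σ a = j) := by
  have hn : 2 ≤ n := by
    have h1 := i.2
    have h2 := j.2
    have h3 : (i : ℕ) ≠ j := fun h => hij (Fin.ext h)
    omega
  refine ⟨hn, ?_⟩
  let z0 : Fin n := ⟨0, by omega⟩
  let z1 : Fin n := ⟨1, by omega⟩
  have h01 : z0 ≠ z1 := by simp [z0, z1]
  let k := Equiv.swap z0 i j
  have hk : z0 ≠ k := by
    intro h
    have : Equiv.swap z0 i z0 = Equiv.swap z0 i k := congrArg _ h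
    rw [Equiv.swap_apply_left, Equiv.swap_apply_self] at this
    exact hij this
  let σ : Equiv.Perm (Fin n) := (Equiv.swap z1 k).trans (Equiv.swap z0 i)
  have e0 : σ z0 = i := by
    change Equiv.swap z0 i (Equiv.swap z1 k z0) = i
    rw [Equiv.swap_apply_of_ne_of_ne h01 hk, Equiv.swap_apply_left]
  have e1 : σ z1 = j := by
    change Equiv.swap z0 i (Equiv.swap z1 k z1) = j
    rw [Equiv.swap_apply_left, Equiv.swap_apply_self]
  refine ⟨σ, fun a => ?_⟩
  rw [← e0, ← e1, σ.injective.eq_iff, σ.injective.eq_iff, Fin.ext_iff, Fin.ext_iff]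
  change _ ↔ ((a : ℕ) = 0 ∨ (a : ℕ) = 1)
  omega

lemma Ch.label {R : CommRingCat.{u}} {X : Scheme.{u}} {f : X ⟶ Spec R} {x : X} {n l : ℕ} {b : R}
    (C : Ch f x n l b) (i j : Fin n) (hij : i ≠ j) (hi : (i : ℕ) < l) (hj : (j : ℕ) < l) (w : Spec C.E)
    (hw : ∀ a, C.co a ∈ w.asIdeal ↔ a = i ∨ a = j) : HasLabel f (C.g w) b := by
  classical
  obtain ⟨hn, σ, hσ⟩ := exists_perm_two i j hij
  let h : C.E := ∏ a : Fin n, if a = i ∨ a = j then 1 else C.co a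
  have hhw : h ∉ w.asIdeal := by
    haveI : w.asIdeal.IsPrime := w.2
    intro hh
    rw [Ideal.IsPrime.prod_mem_iff] at hh
    obtain ⟨a, -, ha⟩ := hh
    split_ifs at ha with h1
    · exact (Ideal.ne_top_iff_one _).1 (Ideal.IsPrime.ne_top ‹_›) ha
    · exact h1 ((hw a).1 ha)
  let L : C.E ⟶ CommRingCat.of (Localization.Away h) := CommRingCat.ofHom (algebraMap C.E (Localization.Away h))
  haveI : IsOpenImmersion (Spec.map L) :=
    inferInstanceAs (IsOpenImmersion (Spec.map (CommRingCat.ofHom (algebraMap C.E (Localization.Away h)))))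
  obtain ⟨w', hw'⟩ : ∃ w', Spec.map L w' = w := by
    have h1 := PrimeSpectrum.localization_away_comap_range (Localization.Away h) h
    have h2 : (w : PrimeSpectrum C.E) ∈ Set.range (PrimeSpectrum.comap (algebraMap C.E (Localization.Away h))) := by
      rw [h1]; exact hhw
    exact h2
  haveI := C.g_et
  haveI := C.θ_et
  have hmem : ∀ e, L.hom e ∈ w'.asIdeal ↔ e ∈ w.asIdeal := by
    intro e; rw [← hw']; rfl
  have het : (C.θ ≫ L).hom.Etale := by
    have : Etale (Spec.map (C.θ ≫ L)) := by rw [Spec.map_comp]; infer_instance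
    rwa [HasRingHomProperty.Spec_iff (P := @Etale)] at this
  obtain ⟨θ2, t1, t2, t3⟩ := std_drop (K := R) (n := n) (l := l) (c := b) (E := Localization.Away h)
    (C.θ ≫ L).hom het 2 σ ⟨0, by omega⟩ (by simp) (by
      intro a ha
      rcases (hσ a).1 ha with h1 | h1 <;> rw [h1] <;> assumption) (by
      intro a _ ha
      rw [hσ] at ha
      have h1 : C.co (σ a) ∣ h := by
        refine dvd_trans ?_ (Finset.dvd_prod_of_mem _ (Finset.mem_univ (σ a)))
        rw [if_neg ha]
      have h2 : IsUnit (algebraMap C.E (Localization.Away h) h) := IsLocalization.Away.algebraMap_isUnit h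
      exact isUnit_of_dvd_unit (map_dvd (algebraMap C.E (Localization.Away h)) h1) h2)
  refine ⟨n, 2, hn, Spec (CommRingCat.of (Localization.Away h)), Spec.map L ≫ C.g, w',
    Spec.map (CommRingCat.ofHom θ2), ?_, ?_, ?_, ?_, ?_⟩
  · change Etale _
    infer_instance
  · change Etale (Spec.map (CommRingCat.ofHom θ2))
    rw [HasRingHomProperty.Spec_iff (P := @Etale)]
    exact t1
  · change (Spec.map L ≫ C.g) w' = _
    rw [Scheme.Hom.comp_apply, hw']
  · rw [Category.assoc, ← C.comm, ← Spec.map_comp]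
    refine (Spec.map_comp _ _).symm.trans ?_
    congr 1
    apply CommRingCat.hom_ext
    apply RingHom.ext
    intro r
    exact t2 r
  · intro a ha
    obtain ⟨u, -, hu⟩ := t3 a
    change θ2 (stdCoord R n 2 b a) ∈ w'.asIdeal
    rw [hu]
    exact Ideal.mul_mem_right _ _ ((hmem _).2 ((hw _).2 ((hσ a).1 ha)))

end k8label

section k8

lemma closure_fib {X S : Scheme.{u}} (f : X ⟶ S) (s : S) (ξ : fiberScheme f s) :
    {x | fiberι f s ξ ⤳ fiberι f s x} = closure {ξ} := by
  ext x
  rw [Set.mem_setOf_eq, fiberι_spec, specializes_iff_mem_closure]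

lemma Ch.baseChange_pb {K K' : CommRingCat.{u}} {Y Y' : Scheme.{u}} {f : Y ⟶ Spec K} {y : Y} {n l : ℕ}
    {c : K} (C : Ch f y n l c) (ψ : K ⟶ K') {p : Y' ⟶ Y} {f' : Y' ⟶ Spec K'}
    (hp : IsPullback p f' f (Spec.map ψ)) (y' : Y') (hy : p y' = y) :
    ∃ C' : Ch f' y' n l (ψ c), ∃ j : C.E ⟶ C'.E, C.q = Spec.map j C'.q ∧
      IsPullback (Spec.map j) C'.g C.g p ∧ ∀ i, C'.co i = j.hom (C.co i) := by
  obtain ⟨E', j, θ', h1, h2, h3⟩ := chart_bc ψ n l c C.θ C.θ_et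
  have h4 := isPullback_SpecMap_of_isPushout _ _ _ _ h2
  rw [C.comm] at h4
  have h5 := IsPullback.of_bot' h4 hp
  obtain ⟨q', hq1, hq2⟩ := isPullback_point h5 C.q y' (by rw [C.hq, hy])
  refine ⟨⟨E', _, q', θ', ?_, h1, hq2, ?_⟩, j, hq1.symm, h5, h3⟩
  · exact MorphismProperty.of_isPullback (P := @Etale) h5 C.g_et
  · rw [hp.lift_snd]

lemma k8 {R : CommRingCat.{u}} {X : Scheme.{u}} (f : X ⟶ Spec R) [LocallyOfFiniteType f] [IsNoetherianRing R]
    (s : Spec R) {x : X} {n l : ℕ} {b : R} (C : Ch f x n l b) (hln : l ≤ n) (hx : f x = s) (i j : Fin n) (hij : i ≠ j)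
    (hi : (i:ℕ)<l) (hj : (j:ℕ)<l) (w₁ w₂ : Spec C.E) (h₁ : w₁ ⤳ C.q) (h₂ : w₂ ⤳ C.q)
    (hi1 : C.co i ∈ w₁.asIdeal) (hj2 : C.co j ∈ w₂.asIdeal) (hg1 : FibGen f s (C.g w₁)) (hg2 : FibGen f s (C.g w₂)) :
    {x | C.g w₁ ⤳ fiberι f s x} = {x | C.g w₂ ⤳ fiberι f s x} ∨
    ∃ T, IsStratum (fiberRes f s) 1 T ∧ {c ∈ irreducibleComponents ↑(fiberScheme f s) | T ⊆ c} = {{x | C.g w₁ ⤳ fiberι f s x}, {x | C.g w₂ ⤳ fiberι f s x}} ∧ ∃ x ∈ T, HasLabel f (fiberι f s x) b := by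
  by_cases hne : C.g w₁ = C.g w₂
  · left; rw [hne]
  right
  let ψ : R ⟶ (Spec R).residueField s := Spec.preimage ((Spec R).fromSpecResidueField s)
  have hp : IsPullback (fiberι f s) (fiberRes f s) f (Spec.map ψ) := by
    rw [Spec.map_preimage]
    exact IsPullback.of_hasPullback _ _
  obtain ⟨y', hy'⟩ := (fiberι_range f s x).2 hx
  obtain ⟨C', t, ht, hpb, hco⟩ := C.baseChange_pb ψ hp y' hy'
  haveI : IsPreimmersion (fiberι f s) := inferInstanceAs (IsPreimmersion (f.fiberι s))
  haveI : IsPreimmersion (Spec.map t) := MorphismProperty.of_isPullback (P := @IsPreimmersion) hpb.flip inferInstance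
  have hspec : ∀ a b, Spec.map t a ⤳ Spec.map t b ↔ a ⤳ b := fun a b =>
    ((Spec.map t).isEmbedding).isInducing.specializes_iff
  have hgt : ∀ a, C.g (Spec.map t a) = fiberι f s (C'.g a) := fun a => by
    rw [← Scheme.Hom.comp_apply, hpb.w, Scheme.Hom.comp_apply]
  have hcoa : ∀ a (v : Spec C'.E), C'.co a ∈ v.asIdeal ↔ C.co a ∈ (Spec.map t v).asIdeal := fun a v => by
    rw [hco]; rfl
  have hlift : ∀ w, FibGen f s (C.g w) → ∃ v, Spec.map t v = w := by
    intro w hw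
    obtain ⟨ξ, hξ⟩ := (fiberι_range f s _).2 hw.1
    obtain ⟨v, hv, -⟩ := isPullback_point hpb w ξ hξ.symm
    exact ⟨v, hv⟩
  obtain ⟨v₁, rfl⟩ := hlift w₁ hg1
  obtain ⟨v₂, rfl⟩ := hlift w₂ hg2
  rw [ht, hspec] at h₁ h₂
  rw [← hcoa] at hi1 hj2
  have hgen : ∀ ξ, FibGen f s (fiberι f s ξ) ↔ ∀ z, z ⤳ ξ → ξ ⤳ z := by
    intro ξ
    rw [fibGen_iff, comp_iff]
  rw [hgt, hgen] at hg1 hg2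
  rw [hgt, hgt] at hne
  haveI : LocallyOfFiniteType (fiberRes f s) :=
    MorphismProperty.of_isPullback (P := @LocallyOfFiniteType) hp inferInstance
  have hk : IsField ((Spec R).residueField s) := Field.toIsField _
  obtain ⟨v, a1, a2, a3, a4, T, b1, b2, b3⟩ := field_core hk C' i j hi hj v₁ v₂ h₁ h₂ hi1 hj2 hg1 hg2
    (fun h => hne (by rw [h]))
  refine ⟨T, b1, ?_, C'.g v, b2, ?_⟩
  · rw [hgt, hgt, closure_fib, closure_fib]
    have hT : ∀ ζ, T ⊆ closure {ζ} ↔ ζ ⤳ C'.g v := by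
      intro ζ
      rw [specializes_iff_mem_closure]
      refine ⟨fun h => h b2, fun h => b3.trans (closure_minimal (Set.singleton_subset_iff.2 h) isClosed_closure)⟩
    ext Q
    simp only [Set.mem_setOf_eq, Set.mem_insert_iff, Set.mem_singleton_iff]
    constructor
    · rintro ⟨hQ, hTQ⟩
      obtain ⟨ζ, rfl, hζ⟩ := exists_fibGen_comp f s Q hQ
      rcases a4 ζ ((hT ζ).1 hTQ) ((hgen ζ).1 hζ) with rfl | rfl
      · exact Or.inl rfl
      · exact Or.inr rfl
    · rintro (rfl | rfl)
      · exact ⟨(comp_iff _).2 hg1, (hT _).2 a2⟩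
      · exact ⟨(comp_iff _).2 hg2, (hT _).2 a3⟩
  · rw [← hgt]
    refine C.label i j hij hi hj _ fun a => ?_
    rw [← hcoa]
    exact a1 a

end k8


section final

lemma fgen_iff_fib {A : CommRingCat.{u}} [IsDomain A] [IsDiscreteValuationRing A] {Y : Scheme.{u}}
    (F : Y ⟶ Spec A) {ϖ : A} (hϖ : Irreducible ϖ) (z : Y) :
    FGen F ϖ z ↔ FibGen F (closedPt A inferInstance) z := by
  have h : ∀ z', ϖ ∈ (F z').asIdeal ↔ F z' = closedPt A inferInstance := fun z' =>
    ⟨fun h => dvr_pt hϖ _ h, fun h => by rw [h]; exact dvr_pt' hϖ⟩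
  simp only [FGen, FibGen, h]

lemma fibGen_map {X S T Y : Scheme.{u}} {f : X ⟶ S} {g : T ⟶ S} {p : Y ⟶ X} {F : Y ⟶ T}
    (hp : IsPullback p F f g) (t : T) (z : Y) (hz : FibGen F t z) : FibGen f (g t) (p z) := by
  have hw : ∀ z, f (p z) = g (F z) := fun z => by
    rw [← Scheme.Hom.comp_apply, hp.w, Scheme.Hom.comp_apply]
  refine ⟨by rw [hw, hz.1], fun x' hx' hf => ?_⟩
  obtain ⟨z', h1, h2, h3⟩ := fib_lift hp t z hz.1 x' hf hx'
  rw [← h3]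
  exact (hz.2 z' h1 h2).map p.continuous

lemma fibGen_lift {X S T Y : Scheme.{u}} {f : X ⟶ S} {g : T ⟶ S} {p : Y ⟶ X} {F : Y ⟶ T}
    (hp : IsPullback p F f g) (t : T) (z : Y) (hz : F z = t) (x' : X) (hx' : FibGen f (g t) x')
    (h : x' ⤳ p z) : ∃ z', z' ⤳ z ∧ FibGen F t z' ∧ p z' = x' := by
  have hw : ∀ z, f (p z) = g (F z) := fun z => by
    rw [← Scheme.Hom.comp_apply, hp.w, Scheme.Hom.comp_apply]
  obtain ⟨z', h1, h2, h3⟩ := fib_lift hp t z hz x' hx'.1 h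
  obtain ⟨z'', h4, h5⟩ := exists_fibGen F t z' h2
  refine ⟨z'', h4.trans h1, h5, ?_⟩
  have h6 : p z'' ⤳ x' := by rw [← h3]; exact h4.map p.continuous
  exact (h6.antisymm (hx'.2 _ h6 (by rw [hw, h5.1]))).eq

lemma Ch.ofLabel {R : CommRingCat.{u}} {X : Scheme.{u}} {f : X ⟶ Spec R} {x : X} {b : R}
    (h : HasLabel f x b) : ∃ n l, l ≤ n ∧ Nonempty (Ch f x n l b) := by
  obtain ⟨n, l, hln, U, gX, x', gT, h1, h2, h3, h4, h5⟩ := h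
  obtain ⟨E, g, q, θ, e1, e2, e3, e4, e5⟩ := Ch.ofScheme n l b (𝟙 _) (f := f) gX h1 gT h2 x' (by
    rw [Category.comp_id]; exact h4)
  exact ⟨n, l, hln, ⟨⟨E, g, q, θ, e1, e2, e3.trans h3, by rw [← e4, Category.comp_id]⟩⟩⟩

theorem main_thm
    (R : CommRingCat.{u}) (hNoeth : IsNoetherianRing ↥R)
    (hsh : StrictlyHenselianLocal ↥R)
    {X : Scheme.{u}} (f : X ⟶ Spec R) (hss : IsSemistable f)
    (U : (Spec R).Opens)
    (hsm : Smooth (f ∣_ U))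
    (A : CommRingCat.{u}) [IsDomain ↥A] [IsDiscreteValuationRing ↥A] (ψ : R ⟶ A)
    (tA : Spec A) (htA : tA = closedPt A inferInstance)
    (htraitc : Spec.map ψ tA = closedPt R hsh.toIsLocalRing)
    (htraitg : Spec.map ψ (pt A ⊥) ∈ U)
    (m : Set (fiberScheme f (Spec.map ψ tA)) → ℤ) :
    ((∀ Tset v₁ v₂ : Set (fiberScheme f (Spec.map ψ tA)),
        IsStratum (fiberRes f (Spec.map ψ tA)) 1 Tset →
        {c ∈ irreducibleComponents ↑(fiberScheme f (Spec.map ψ tA)) | Tset ⊆ c} = {v₁, v₂} →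
        ∀ (b : ↥R) (x : fiberScheme f (Spec.map ψ tA)), x ∈ Tset →
          HasLabel f (fiberι f (Spec.map ψ tA) x) b →
          ∀ k : ℕ, elemOrd ↥A (ψ b) k → (k : ℤ) ∣ m v₁ - m v₂) ↔
      (∃ D : ↑(pullback f (Spec.map ψ)) → ℤ,
        IsCartierDiv D ∧
        (∀ z, D z ≠ 0 → (pullback.snd f (Spec.map ψ)) z = tA) ∧
        (∀ v ∈ irreducibleComponents ↑(fiberScheme f (Spec.map ψ tA)),
          ∀ w ∈ irreducibleComponents
              ↑(fiberScheme (pullback.snd f (Spec.map ψ)) tA),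
            (pullback.fst f (Spec.map ψ)) ''
                ((fiberι (pullback.snd f (Spec.map ψ)) tA) '' w) ⊆
              (fiberι f (Spec.map ψ tA)) '' v →
            ∀ z : ↑(pullback f (Spec.map ψ)),
              closure {z} =
                closure ((fiberι (pullback.snd f (Spec.map ψ)) tA) '' w) →
              D z = m v))) := by
  obtain ⟨ϖ, hϖ⟩ := IsDiscreteValuationRing.exists_irreducible A
  have H := TS.mk' R hsh f hss U hsm A ψ (by rw [← htA]; exact htraitc) htraitg ϖ hϖ
  have hp : IsPullback (pullback.fst f (Spec.map ψ)) (pullback.snd f (Spec.map ψ)) f (Spec.map ψ) :=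
    IsPullback.of_hasPullback _ _
  haveI : IsProper f := hss.1
  have hF : ∀ z, ϖ ∈ (pullback.snd f (Spec.map ψ) z).asIdeal ↔ pullback.snd f (Spec.map ψ) z = tA :=
    fun z' => ⟨fun h => by rw [htA]; exact dvr_pt hϖ _ h, fun h => by rw [h, htA]; exact dvr_pt' hϖ⟩
  have hFG : ∀ z, FGen (pullback.snd f (Spec.map ψ)) ϖ z ↔ FibGen (pullback.snd f (Spec.map ψ)) tA z := by
    intro z; rw [htA]; exact fgen_iff_fib _ hϖ z
  generalize pullback.fst f (Spec.map ψ) = p at *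
  generalize pullback.snd f (Spec.map ψ) = F at *
  generalize pullback f (Spec.map ψ) = Y at *
  have hw : ∀ z, f (p z) = Spec.map ψ (F z) := fun z => by
    rw [← Scheme.Hom.comp_apply, hp.w, Scheme.Hom.comp_apply]
  constructor
  · intro hT
    classical
    refine ⟨fun z => if F z = tA then m {x | p z ⤳ fiberι f (Spec.map ψ tA) x} else 0, ?_, ?_, ?_⟩
    · refine H.core_exists _ (fun z hz => if_neg (fun h => hz ((hF z).2 h))) ?_
      intro y hy
      have hy' := (hF y).1 hy
      obtain ⟨D0⟩ := hss.2.2 (p y)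
      have hpy : f (p y) = Spec.map ψ tA := by rw [hw, hy']
      obtain ⟨n, l, hln, b, ⟨C0⟩⟩ := chart_henselian R hsh f (p y) (by rw [hpy, htraitc]) D0
      obtain ⟨C, j, hq, hj, hco⟩ := C0.baseChange ψ hp y rfl
      refine ⟨n, l, hln, ψ b, C, ?_⟩
      intro i' j' hij hi hjl w₁ w₂ h₁ h₂ _ _ hi1 hj2 hg1 hg2 k hk
      rw [hFG] at hg1 hg2
      have hgw : ∀ w, C0.g (Spec.map j w) = p (C.g w) := fun w => by
        rw [← Scheme.Hom.comp_apply, hj, Scheme.Hom.comp_apply]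
      have := k8 f (Spec.map ψ tA) C0 hln hpy i' j' hij hi hjl (Spec.map j w₁) (Spec.map j w₂)
        (by rw [hq]; exact h₁.map (Spec.map j).continuous)
        (by rw [hq]; exact h₂.map (Spec.map j).continuous)
        (by rw [hco] at hi1; exact hi1) (by rw [hco] at hj2; exact hj2)
        (by rw [hgw]; exact fibGen_map hp tA _ hg1) (by rw [hgw]; exact fibGen_map hp tA _ hg2)
      simp only [hgw] at this
      simp only [hg1.1, hg2.1, if_true]
      rcases this with h | ⟨T, hT1, hT2, x, hx, hl⟩
      · rw [h, sub_self]; exact dvd_zero _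
      · exact hT T _ _ hT1 hT2 b x hx hl k hk
    · intro z hz
      by_contra h
      exact hz (if_neg h)
    · intro v hv w hw' hsub z hz
      obtain ⟨ξ, rfl, hξ⟩ := exists_fibGen_comp f _ v hv
      obtain ⟨z0, rfl, hz0⟩ := exists_fibGen_comp F _ w hw'
      have hzz : z = fiberι F tA z0 := by
        rw [closure_image_closure (fiberι F tA).continuous, Set.image_singleton] at hz
        have e1 : z ⤳ fiberι F tA z0 := specializes_iff_mem_closure.2 (hz ▸ subset_closure rfl)
        have e2 : fiberι F tA z0 ⤳ z := specializes_iff_mem_closure.2 (hz ▸ subset_closure rfl)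
        exact (e1.antisymm e2).eq
      subst hzz
      obtain ⟨ξ', h1, h2⟩ := hsub ⟨_, ⟨z0, subset_closure rfl, rfl⟩, rfl⟩
      have h3 := fibGen_map hp tA _ hz0
      rw [← h2] at h3
      have h4 : ξ ⤳ ξ' := specializes_iff_mem_closure.2 h1
      have h5 : ξ = ξ' := by
        have := h3.2 _ ((fiberι_spec _ _ _ _).2 h4) (fiberι_f _ _ _)
        rw [fiberι_spec] at this
        exact (h4.antisymm this).eq
      simp only [hz0.1, if_true]
      rw [← h2, ← h5, closure_fib]
  · rintro ⟨D, hD, hD0, hD1⟩ T v₁ v₂ hT hT2 b x hx hl k hk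
    obtain ⟨n, l, hln, ⟨C0⟩⟩ := Ch.ofLabel hl
    obtain ⟨y, hy1, hy2⟩ := isPullback_point hp (fiberι f _ x) tA (fiberι_f _ _ _)
    obtain ⟨C, j, hq, hj, hco⟩ := C0.baseChange ψ hp y hy1
    have key : ∀ v ∈ ({v₁, v₂} : Set (Set (fiberScheme f (Spec.map ψ tA)))),
        ∃ z, z ⤳ y ∧ FGen F ϖ z ∧ D z = m v := by
      intro v hv
      rw [← hT2] at hv
      have hxv := hv.2 hx
      have hv1 := hv.1
      obtain ⟨ξ, rfl, hξ⟩ := exists_fibGen_comp f _ v hv.1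
      obtain ⟨z, h1, h2, h3⟩ := fibGen_lift hp tA y hy2 _ hξ (by
        rw [hy1, fiberι_spec]; exact specializes_iff_mem_closure.2 hxv)
      refine ⟨z, h1, (hFG z).2 h2, ?_⟩
      obtain ⟨z0, rfl⟩ := (fiberι_range F tA z).2 h2.1
      refine hD1 _ hv1 (closure {z0}) ((fibGen_iff _ _ _).1 h2) ?_ _ ?_
      · rintro _ ⟨_, ⟨z', hz', rfl⟩, rfl⟩
        have h4 : fiberι f _ ξ ⤳ p (fiberι F tA z') := by
          rw [← h3]
          exact ((fiberι_spec _ _ _ _).2 (specializes_iff_mem_closure.2 hz')).map p.continuous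
        obtain ⟨x', hx'⟩ := (fiberι_range f (Spec.map ψ tA) (p (fiberι F tA z'))).2 (by
          rw [hw, fiberι_f])
        rw [← hx', fiberι_spec] at h4
        exact ⟨x', specializes_iff_mem_closure.1 h4, hx'⟩
      · rw [closure_image_closure (fiberι F tA).continuous, Set.image_singleton]
    obtain ⟨z₁, a1, a2, a3⟩ := key v₁ (by simp)
    obtain ⟨z₂, b1, b2, b3⟩ := key v₂ (by simp)
    rw [← a3, ← b3]
    refine H.core_dvd C hln ((hF y).2 hy2) D hD ?_ z₁ z₂ a1 b1 a2 b2 k hk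
    intro z hz
    by_contra h
    exact hz ((hF z).2 (hD0 z h))

end final


/-- Lemma 4.6 of the paper.  Let `S = Spec R` with `R` a Noetherian
strictly henselian local ring, `f : X ⟶ S` a semistable morphism smooth over a dense open
`U ⊆ S`, and `φ = Spec ψ : T ⟶ S` a non-degenerate trait through the closed point `s`
(`T = Spec A` with `A` a DVR).  A vertex labelling `m` of `Γ_s` is `T`-Cartier iff there
is a Cartier divisor `D` on `X_T = X ×_S T` supported in the closed fibre whose
associated vertex labelling equals `m`. -/
theorem vertex_labelling_tCartier_iff_fibral_cartier_divisor
    (R : CommRingCat.{u}) (hNoeth : IsNoetherianRing ↥R)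
    (hsh : StrictlyHenselianLocal ↥R)
    {X : Scheme.{u}} (f : X ⟶ Spec R) (hss : IsSemistable f)
    (U : (Spec R).Opens) (hdense : Dense (U : Set (Spec R)))
    (hsm : IsSmooth (f ∣_ U))
    (s : ↑(Spec R)) (hs : s = closedPt R hsh.toIsLocalRing)
    -- the non-degenerate trait through `s`
    (A : CommRingCat.{u}) [IsDomain ↥A] [IsDiscreteValuationRing ↥A] (ψ : R ⟶ A)
    (htraitc : (Spec.map ψ).base (closedPt A inferInstance) = s)
    (htraitg : (Spec.map ψ).base ⟨⊥, Ideal.bot_prime⟩ ∈ U)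
    (tA : ↑(Spec A)) (htA : tA = closedPt A inferInstance)
    -- the vertex labelling of `Γ_s`
    (m : Set (fiberScheme f s) → ℤ) :
    -- `m` is `T`-Cartier ...
    ((∀ Tset v₁ v₂ : Set (fiberScheme f s),
        IsStratum (fiberRes f s) 1 Tset →
        {c ∈ irreducibleComponents ↑(fiberScheme f s) | Tset ⊆ c} = {v₁, v₂} →
        ∀ (b : ↥R) (x : fiberScheme f s), x ∈ Tset →
          HasLabel f ((fiberι f s).base x) b →
          ∀ k : ℕ, elemOrd ↥A (ψ b) k → (k : ℤ) ∣ m v₁ - m v₂) ↔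
      -- ... iff there is a fibral Cartier divisor on `X_T` with vertex labelling `m`
      (∃ D : ↑(pullback f (Spec.map ψ)) → ℤ,
        IsCartierDiv D ∧
        (∀ z, D z ≠ 0 → (pullback.snd f (Spec.map ψ)).base z = tA) ∧
        (∀ v ∈ irreducibleComponents ↑(fiberScheme f s),
          ∀ w ∈ irreducibleComponents
              ↑(fiberScheme (pullback.snd f (Spec.map ψ)) tA),
            (pullback.fst f (Spec.map ψ)).base ''
                ((fiberι (pullback.snd f (Spec.map ψ)) tA).base '' w) ⊆
              (fiberι f s).base '' v →
            ∀ z : ↑(pullback f (Spec.map ψ)),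
              closure {z} =
                closure ((fiberι (pullback.snd f (Spec.map ψ)) tA).base '' w) →
              D z = m v))) := by
  subst htA
  subst htraitc
  exact main_thm R hNoeth hsh f hss U hsm A ψ _ rfl hs htraitg m

end NeronSemistable
end
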